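/- Let n ≥ 2 and suppose (1/p, 1/q) lies on the half-open segment [A, D) (which lies on the line 2/q + n/p = n). Then for every α < q there is a constant C such that ‖ Σ_j λ_j |e^{itΔ}f_j|² ‖_{L^q(ℝ, L^p(ℝⁿ))} ≤ C ‖{λ_j}‖_{ℓ^α} for all families {f_j} orthonormal in L²(ℝⁿ) and all {λ_j} ∈ ℓ^α; moreover, for every α > q no such finite constant exists. -/

import Mathlib

noncomputable section

open MeasureTheory ENNReal Real Set

namespace OS

/-- `ℝⁿ` as a Euclidean space. -/
abbrev Rn (n : ℕ) := EuclideanSpace ℝ (Fin n)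

/-- The real dot product `x·ξ`, viewed as a complex number. -/
def dotC {n : ℕ} (x ξ : Rn n) : ℂ := ((∑ i, x i * ξ i : ℝ) : ℂ)

/-- The Fourier transform `f̂(ξ) = ∫ f(x) e^{-i x·ξ} dx`. -/
def FT {n : ℕ} (f : Rn n → ℂ) (ξ : Rn n) : ℂ :=
  ∫ x : Rn n, Complex.exp (-(Complex.I * dotC x ξ)) * f x

/-- The propagator `e^{itΔ}` composed with a Fourier multiplier `m`:
`x ↦ (2π)^{-n} ∫ e^{i(x·ξ - t|ξ|²)} m(ξ) f̂(ξ) dξ`. -/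
def prop {n : ℕ} (m : Rn n → ℂ) (f : Rn n → ℂ) (t : ℝ) (x : Rn n) : ℂ :=
  ((2 * π : ℝ) ^ (-(n : ℝ)) : ℝ) •
    ∫ ξ : Rn n, Complex.exp (Complex.I * (dotC x ξ - (t : ℂ) * ((‖ξ‖ : ℝ) : ℂ) ^ 2)) *
      (m ξ * FT f ξ)

/-- The free Schrödinger propagator `e^{itΔ} f`, as a function of `(t, x)`. -/
def schrodinger {n : ℕ} (f : Rn n → ℂ) : ℝ → Rn n → ℂ := prop (fun _ => 1) f

/-- The Fourier multiplier `|ξ|^{-s} ψ(2^{-k}|ξ|)` of `(-Δ)^{-s/2} P_k`. -/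
def LPmult {n : ℕ} (s : ℝ) (ψ : ℝ → ℝ) (k : ℤ) (ξ : Rn n) : ℂ :=
  ((‖ξ‖ ^ (-s) * ψ ((2 : ℝ) ^ (-k) * ‖ξ‖) : ℝ) : ℂ)

/-- The Littlewood–Paley projection `P_k h`. -/
def LP {n : ℕ} (ψ : ℝ → ℝ) (k : ℤ) (h : Rn n → ℂ) (x : Rn n) : ℂ :=
  ((2 * π : ℝ) ^ (-(n : ℝ)) : ℝ) •
    ∫ ξ : Rn n, Complex.exp (Complex.I * dotC x ξ) *
      (((ψ ((2 : ℝ) ^ (-k) * ‖ξ‖) : ℝ) : ℂ) * FT h ξ)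

/-- The standing hypotheses on the Littlewood–Paley bump function `ψ`:
smooth, `[0,1]`-valued, supported in `[1/2,2]`, with `∑_{k∈ℤ} ψ(2^{-k} r) = 1` for `r ≠ 0`. -/
structure IsLPF (ψ : ℝ → ℝ) : Prop where
  smooth : ContDiff ℝ (⊤ : ℕ∞) ψ
  mem_Icc : ∀ r, ψ r ∈ Icc (0 : ℝ) 1
  supp : Function.support ψ ⊆ Icc (1 / 2 : ℝ) 2
  sum_one : ∀ r : ℝ, r ≠ 0 → ∑' k : ℤ, ψ ((2 : ℝ) ^ (-k) * r) = 1

/-- Orthonormality in `L²(ℝⁿ)`. -/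
def OrthonormalL2 {n : ℕ} (f : ℕ → Rn n → ℂ) : Prop :=
  ∀ j k, (∫ x : Rn n, f j x * (starRingEnd ℂ) (f k x)) = if j = k then 1 else 0

/-- Orthonormality in the homogeneous Sobolev space `Ḣ^s(ℝⁿ)`:
`(2π)^{-n} ∫ |ξ|^{2s} f̂_j(ξ) conj(f̂_k(ξ)) dξ = δ_{jk}`. -/
def OrthonormalHs {n : ℕ} (s : ℝ) (f : ℕ → Rn n → ℂ) : Prop :=
  ∀ j k, ((2 * π : ℝ) ^ (-(n : ℝ)) : ℝ) •
    (∫ ξ : Rn n, ((‖ξ‖ ^ (2 * s) : ℝ) : ℂ) * (FT (f j) ξ * (starRingEnd ℂ) (FT (f k) ξ)))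
      = if j = k then 1 else 0

/-- The density `Σ_j λ_j |u_j(t,x)|²` of a system of space-time functions. -/
def density2 {n : ℕ} (lam : ℕ → ℝ) (u : ℕ → ℝ → Rn n → ℂ) (t : ℝ) (x : Rn n) : ℝ :=
  ∑' j, lam j * ‖u j t x‖ ^ 2

/-- The density `Σ_j λ_j |e^{itΔ}f_j(x)|²`. -/
def density {n : ℕ} (lam : ℕ → ℝ) (f : ℕ → Rn n → ℂ) : ℝ → Rn n → ℝ :=
  density2 lam fun j => schrodinger (f j)

/-- The `L^q` norm (w.r.t. `μ`) of an `ℝ≥0∞`-valued function. -/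
def eLp {α : Type*} [MeasurableSpace α] (μ : Measure α) (q : ℝ≥0∞) (F : α → ℝ≥0∞) : ℝ≥0∞ :=
  if q = ∞ then essSup F μ
  else (∫⁻ t, F t ^ q.toReal ∂μ) ^ (1 / q.toReal)

/-- The Lorentz `L^{p,r}` (quasi)norm of an `ℝ≥0∞`-valued function, via the
distribution function.  For `r = ∞` this is the weak-`L^p` quasinorm
`sup_{s>0} s μ(G > s)^{1/p} = sup_{t>0} t^{1/p} G^*(t)`. -/
def lor {α : Type*} [MeasurableSpace α] (μ : Measure α) (p r : ℝ≥0∞) (G : α → ℝ≥0∞) : ℝ≥0∞ :=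
  if p = ∞ then essSup G μ
  else if r = ∞ then
    ⨆ (s : ℝ) (_ : 0 < s), ENNReal.ofReal s * μ {x | ENNReal.ofReal s < G x} ^ (1 / p.toReal)
  else
    (∫⁻ s in Ioi (0 : ℝ),
      (ENNReal.ofReal s * μ {x | ENNReal.ofReal s < G x} ^ (1 / p.toReal)) ^ r.toReal *
        (ENNReal.ofReal s)⁻¹) ^ (1 / r.toReal)

/-- The mixed norm `‖u‖_{L^q(ℝ, L^p(ℝⁿ))}`. -/
def mixedLp {n : ℕ} {E : Type*} [NormedAddCommGroup E] (q p : ℝ≥0∞)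
    (u : ℝ → Rn n → E) : ℝ≥0∞ :=
  eLp volume q fun t => eLpNorm (u t) p volume

/-- The mixed norm `‖u‖_{L^{q,∞}(ℝ, L^p(ℝⁿ))}` (weak in time). -/
def mixedWeakLp {n : ℕ} {E : Type*} [NormedAddCommGroup E] (q p : ℝ≥0∞)
    (u : ℝ → Rn n → E) : ℝ≥0∞ :=
  lor volume q ∞ fun t => eLpNorm (u t) p volume

/-- The weak `L^{p,∞}(ℝⁿ)` quasinorm. -/
def wLp {n : ℕ} {E : Type*} [NormedAddCommGroup E] (p : ℝ≥0∞) (g : Rn n → E) : ℝ≥0∞ :=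
  lor volume p ∞ fun x => (‖g x‖₊ : ℝ≥0∞)

/-- The mixed Lorentz norm `‖u‖_{L^{q,r}(ℝ, L^{p,r̃}(ℝⁿ))}`. -/
def mixedLorentz {n : ℕ} {E : Type*} [NormedAddCommGroup E] (q r p rt : ℝ≥0∞)
    (u : ℝ → Rn n → E) : ℝ≥0∞ :=
  lor volume q r fun t => lor volume p rt fun x => (‖u t x‖₊ : ℝ≥0∞)

/-- The `ℓ^a` norm of a sequence (with `ℓ^∞` the supremum norm). -/
def seqNormE (a : ℝ≥0∞) (lam : ℕ → ℝ) : ℝ≥0∞ :=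
  if a = ∞ then ⨆ j, ENNReal.ofReal |lam j|
  else (∑' j, ENNReal.ofReal |lam j| ^ a.toReal) ^ (1 / a.toReal)

/-- The decreasing rearrangement of a sequence: `seqRearr lam j` is the
`(j+1)`-th largest value of `|lam i|`. -/
def seqRearr (lam : ℕ → ℝ) (j : ℕ) : ℝ≥0∞ :=
  sInf {s : ℝ≥0∞ | Measure.count {i : ℕ | s < ENNReal.ofReal |lam i|} ≤ (j : ℝ≥0∞)}

/-- The Lorentz sequence norm `‖lam‖_{ℓ^{q,r}} = (Σ_j (j^{1/q} λ*_j)^r / j)^{1/r}`,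
parametrized by `qinv = 1/q` and a finite second exponent `r`. -/
def seqLor (qinv r : ℝ) (lam : ℕ → ℝ) : ℝ≥0∞ :=
  (∑' j : ℕ, (((j : ℝ≥0∞) + 1) ^ qinv * seqRearr lam j) ^ r * ((j : ℝ≥0∞) + 1)⁻¹) ^ (1 / r)

/-- The interior of the triangle `OAB`, in the coordinates `(a, b) = (1/p, 1/q)`. -/
def IntOAB (n : ℕ) (a b : ℝ) : Prop :=
  a ∈ Ioo (0 : ℝ) 1 ∧ b ∈ Ioo (0 : ℝ) 1 ∧ b < (n : ℝ) / (n - 1) * a ∧ 2 * b + n * a < n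

/-- The interior of the quadrilateral `OCDA`, in the coordinates `(a, b) = (1/p, 1/q)`. -/
def IntOCDA (n : ℕ) (a b : ℝ) : Prop :=
  a ∈ Ioo (0 : ℝ) 1 ∧ b ∈ Ioo (0 : ℝ) 1 ∧ (n : ℝ) / (n - 1) * a < b ∧ 2 * b + n * a < n

def ptO : ℝ × ℝ := (0, 0)
def ptA (n : ℕ) : ℝ × ℝ := (((n : ℝ) - 1) / (n + 1), (n : ℝ) / (n + 1))
def ptB : ℝ × ℝ := (1, 0)
def ptC : ℝ × ℝ := (0, 1)
def ptD (n : ℕ) : ℝ × ℝ := (((n : ℝ) - 2) / n, 1)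

/-- The closed triangle `OAB`. -/
def OAB (n : ℕ) : Set (ℝ × ℝ) := convexHull ℝ {ptO, ptA n, ptB}

/-- The closed quadrilateral `OCDA`. -/
def OCDA (n : ℕ) : Set (ℝ × ℝ) := convexHull ℝ {ptO, ptC, ptD n, ptA n}

/-- The half-open segment `[A, D)`. -/
def segAD (n : ℕ) : Set (ℝ × ℝ) := {x | ∃ t ∈ Ico (0 : ℝ) 1, x = (1 - t) • ptA n + t • ptD n}

/-- The Lebesgue exponent with reciprocal `a` (so `expOf 0 = ∞`). -/
def expOf (a : ℝ) : ℝ≥0∞ := (ENNReal.ofReal a)⁻¹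

/-- The weighted velocity average `∫ f(x - tv, v) |v|^{-2s} dv` of the solution of
the kinetic transport equation with datum `f`. -/
def velAvg {n : ℕ} (s : ℝ) (f : Rn n × Rn n → ℂ) (t : ℝ) (x : Rn n) : ℂ :=
  ∫ v : Rn n, ((‖v‖ ^ (-(2 * s)) : ℝ) : ℂ) * f (x - t • v, v)

end OS

open OS

namespace OS

lemma lintegral_comp_abs_le (f : ℝ → ℝ≥0∞) :
    ∫⁻ t : ℝ, f |t| ≤ 2 * ∫⁻ t in Ioi (0 : ℝ), f t := by
  have h1 : ∫⁻ t in Ioi (0 : ℝ), f |t| = ∫⁻ t in Ioi (0 : ℝ), f t :=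
    setLIntegral_congr_fun measurableSet_Ioi fun t ht => by simp [abs_of_pos (mem_Ioi.1 ht)]
  have h2 : ∫⁻ t in Iic (0 : ℝ), f |t| = ∫⁻ t in Ioi (0 : ℝ), f t := by
    rw [← lintegral_indicator measurableSet_Iic, ← lintegral_neg_eq_self,
      ← h1, ← lintegral_indicator measurableSet_Ioi]
    apply lintegral_congr_ae
    filter_upwards [compl_mem_ae_iff.2 (measure_singleton (0 : ℝ))] with t ht
    have ht : t ≠ 0 := ht
    by_cases h : 0 < t
    · simp [indicator, h, h.le]
    · have : ¬ 0 ≤ t := fun h' => h (lt_of_le_of_ne h' ht.symm)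
      simp [indicator, h, this]
  have h3 := lintegral_add_compl (μ := volume) (fun t : ℝ => f |t|) (measurableSet_Iic (a := (0 : ℝ)))
  rw [← h3, compl_Iic, h1, h2, two_mul]

lemma lintegral_rpow_near {σ R : ℝ} (hσ : σ < 1) (hR : 0 < R) :
    ∫⁻ t : ℝ in {t | |t| ≤ R}, ENNReal.ofReal (|t| ^ (-σ)) ≤
      ENNReal.ofReal (2 / (1 - σ) * R ^ (1 - σ)) := by
  have hm : MeasurableSet {t : ℝ | |t| ≤ R} := measurableSet_le measurable_abs measurable_const
  have hI : IntegrableOn (fun t : ℝ => t ^ (-σ)) (Ioc 0 R) := by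
    rw [← intervalIntegrable_iff_integrableOn_Ioc_of_le hR.le]
    exact intervalIntegral.intervalIntegrable_rpow' (by linarith)
  have h1 := lintegral_comp_abs_le (indicator (Iic R) fun t => ENNReal.ofReal (t ^ (-σ)))
  rw [← lintegral_indicator hm]
  refine (le_of_eq ?_).trans (h1.trans (le_of_eq ?_))
  · congr 1
  · rw [setLIntegral_indicator measurableSet_Iic, inter_comm, Ioi_inter_Iic,
      ← ofReal_integral_eq_lintegral_ofReal hI, ← intervalIntegral.integral_of_le hR.le,
      integral_rpow (Or.inl (by linarith)), Real.zero_rpow (by linarith), sub_zero]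
    · rw [show (2 : ℝ≥0∞) = ENNReal.ofReal 2 by simp, ← ENNReal.ofReal_mul (by norm_num)]
      congr 1
      rw [show -σ + 1 = 1 - σ by ring]; ring
    · filter_upwards [ae_restrict_mem measurableSet_Ioc] with t ht
      exact Real.rpow_nonneg ht.1.le _

lemma lintegral_rpow_far {R : ℝ} (hR : 0 < R) :
    ∫⁻ t : ℝ in {t | R < |t|}, ENNReal.ofReal (|t| ^ (-2 : ℝ)) ≤ ENNReal.ofReal (2 / R) := by
  have hm : MeasurableSet {t : ℝ | R < |t|} := measurableSet_lt measurable_const measurable_abs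
  have hI := integrableOn_Ioi_rpow_of_lt (a := -2) (by norm_num) hR
  have h1 := lintegral_comp_abs_le (indicator (Ioi R) fun t => ENNReal.ofReal (t ^ (-2 : ℝ)))
  rw [← lintegral_indicator hm]
  refine (le_of_eq ?_).trans (h1.trans (le_of_eq ?_))
  · congr 1
  · rw [setLIntegral_indicator measurableSet_Ioi, Ioi_inter_Ioi, max_eq_left hR.le,
      ← ofReal_integral_eq_lintegral_ofReal hI, integral_Ioi_rpow_of_lt (by norm_num) hR]
    · rw [show (2 : ℝ≥0∞) = ENNReal.ofReal 2 by simp, ← ENNReal.ofReal_mul (by norm_num)]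
      congr 1
      rw [show (-2 : ℝ) + 1 = -1 by norm_num, Real.rpow_neg_one]
      field_simp
    · filter_upwards [ae_restrict_mem measurableSet_Ioi] with t ht
      exact Real.rpow_nonneg (hR.trans ht).le _

/-- The part of the Hardy-Littlewood-Sobolev integral where `φ s ≤ φ t`. -/
lemma hls_inner {σ : ℝ} (h0 : 0 < σ) (h1 : σ < 1) {φ : ℝ → ℝ≥0∞} (hφ : Measurable φ)
    (hN0 : ∫⁻ s, φ s ^ (2 / (2 - σ)) ≠ 0) (hN : ∫⁻ s, φ s ^ (2 / (2 - σ)) ≠ ∞) (t : ℝ)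
    (ht0 : φ t ≠ 0) (ht : φ t ≠ ∞) :
    ∫⁻ s in {s | φ s ≤ φ t}, ENNReal.ofReal (|t - s| ^ (-σ)) * φ s ≤
      ENNReal.ofReal (2 / (1 - σ) + 2 ^ (σ / 2)) *
        ((∫⁻ s, φ s ^ (2 / (2 - σ))) ^ (1 - σ) * φ t ^ (2 / (2 - σ) - 1)) := by
  set r := 2 / (2 - σ) with hr
  have hr0 : 0 < r := by rw [hr]; apply div_pos <;> linarith
  obtain ⟨N, hNp, hNe⟩ : ∃ N : ℝ, 0 < N ∧ ∫⁻ s, φ s ^ r = ENNReal.ofReal N :=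
    ⟨_, ENNReal.toReal_pos hN0 hN, (ENNReal.ofReal_toReal hN).symm⟩
  obtain ⟨x, hxp, hxe⟩ : ∃ x : ℝ, 0 < x ∧ φ t = ENNReal.ofReal x :=
    ⟨_, ENNReal.toReal_pos ht0 ht, (ENNReal.ofReal_toReal ht).symm⟩
  set R := N * x ^ (-r) with hR
  have hRp : 0 < R := by positivity
  have hmφ : MeasurableSet {s | φ s ≤ φ t} := measurableSet_le hφ measurable_const
  have near : ∫⁻ s in {s | |t - s| ≤ R}, ENNReal.ofReal (|t - s| ^ (-σ)) ≤
      ENNReal.ofReal (2 / (1 - σ) * R ^ (1 - σ)) := by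
    refine le_trans (le_of_eq ?_) (lintegral_rpow_near h1 hRp)
    rw [← lintegral_indicator (measurableSet_le (by fun_prop) measurable_const),
      ← lintegral_indicator (measurableSet_le (by fun_prop) measurable_const),
      ← lintegral_sub_left_eq_self _ t]
    simp [indicator]
  have far : ∫⁻ s in {s | R < |t - s|}, ENNReal.ofReal (|t - s| ^ (-2 : ℝ)) ≤
      ENNReal.ofReal (2 / R) := by
    refine le_trans (le_of_eq ?_) (lintegral_rpow_far hRp)
    rw [← lintegral_indicator (measurableSet_lt measurable_const (by fun_prop)),
      ← lintegral_indicator (measurableSet_lt measurable_const (by fun_prop)),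
      ← lintegral_sub_left_eq_self _ t]
    simp [indicator]
  have hmR : MeasurableSet {s | |t - s| ≤ R} := measurableSet_le (by fun_prop) measurable_const
  have bnear : ∫⁻ s in {s | |t - s| ≤ R} ∩ {s | φ s ≤ φ t}, ENNReal.ofReal (|t - s| ^ (-σ)) * φ s ≤
      ENNReal.ofReal (2 / (1 - σ) * R ^ (1 - σ)) * φ t := by
    calc _ ≤ ∫⁻ s in {s | |t - s| ≤ R} ∩ {s | φ s ≤ φ t},
            ENNReal.ofReal (|t - s| ^ (-σ)) * φ t := by
          refine setLIntegral_mono (by fun_prop) fun s hs => ?_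
          gcongr; exact hs.2
      _ ≤ ∫⁻ s in {s | |t - s| ≤ R}, ENNReal.ofReal (|t - s| ^ (-σ)) * φ t :=
          lintegral_mono_set inter_subset_left
      _ = (∫⁻ s in {s | |t - s| ≤ R}, ENNReal.ofReal (|t - s| ^ (-σ))) * φ t :=
          lintegral_mul_const _ (by fun_prop)
      _ ≤ _ := by gcongr
  have bfar : ∫⁻ s in {s | |t - s| ≤ R}ᶜ ∩ {s | φ s ≤ φ t}, ENNReal.ofReal (|t - s| ^ (-σ)) * φ s ≤
      ENNReal.ofReal (2 / R) ^ (σ / 2) * ENNReal.ofReal N ^ (1 - σ / 2) := by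
    calc _ ≤ ∫⁻ s in {s | R < |t - s|}, ENNReal.ofReal (|t - s| ^ (-σ)) * φ s :=
          lintegral_mono_set fun s hs => by simpa using hs.1
      _ = ∫⁻ s in {s | R < |t - s|},
            ENNReal.ofReal (|t - s| ^ (-2 : ℝ)) ^ (σ / 2) * (φ s ^ r) ^ (1 - σ / 2) := by
          refine lintegral_congr fun s => ?_
          rw [ENNReal.ofReal_rpow_of_nonneg (by positivity) (by positivity),
            ← Real.rpow_mul (abs_nonneg _), ← ENNReal.rpow_mul,
            show r * (1 - σ / 2) = 1 by rw [hr]; field_simp [show (2 - σ) ≠ 0 by linarith],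
            ENNReal.rpow_one]
          ring_nf
      _ ≤ (∫⁻ s in {s | R < |t - s|}, ENNReal.ofReal (|t - s| ^ (-2 : ℝ))) ^ (σ / 2) *
          (∫⁻ s in {s | R < |t - s|}, φ s ^ r) ^ (1 - σ / 2) :=
          ENNReal.lintegral_mul_norm_pow_le (by fun_prop) (by fun_prop) (by linarith)
            (by linarith) (by ring)
      _ ≤ _ := by
          gcongr
          · linarith
          · rw [← hNe]; exact setLIntegral_le_lintegral _ _
  have split := lintegral_add_compl (μ := volume.restrict {s | φ s ≤ φ t})
    (fun s => ENNReal.ofReal (|t - s| ^ (-σ)) * φ s) hmR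
  rw [Measure.restrict_restrict hmR, Measure.restrict_restrict hmR.compl] at split
  rw [← split]
  refine (add_le_add bnear bfar).trans (le_of_eq ?_)
  rw [hNe, hxe, ENNReal.ofReal_rpow_of_pos (by positivity), ENNReal.ofReal_rpow_of_pos hNp,
    ENNReal.ofReal_rpow_of_pos hNp, ENNReal.ofReal_rpow_of_pos hxp,
    ← ENNReal.ofReal_mul (by positivity), ← ENNReal.ofReal_mul (by have : 0 < 1 - σ := by linarith
                                                                   positivity),
    ← ENNReal.ofReal_mul (by positivity), ← ENNReal.ofReal_mul (by have : 0 < 1 - σ := by linarith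
                                                                   positivity),
    ← ENNReal.ofReal_add (by have : 0 < 1 - σ := by linarith
                             positivity) (by positivity)]
  congr 1
  have e1 : R ^ (1 - σ) * x = N ^ (1 - σ) * x ^ (r - 1) := by
    rw [hR, Real.mul_rpow hNp.le (by positivity), ← Real.rpow_mul hxp.le, mul_assoc,
      ← Real.rpow_add_one hxp.ne']
    congr 2
    rw [hr]; field_simp [show (2 - σ) ≠ 0 by linarith]; ring
  have e2 : (2 / R) ^ (σ / 2) * N ^ (1 - σ / 2) = 2 ^ (σ / 2) * (N ^ (1 - σ) * x ^ (r - 1)) := by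
    have h2 : (2 : ℝ) / R = 2 * (N ^ (-1 : ℝ) * x ^ r) := by
      rw [hR, Real.rpow_neg hxp.le, Real.rpow_neg_one]; field_simp
    rw [h2, Real.mul_rpow (by norm_num) (by positivity), Real.mul_rpow (by positivity)
      (by positivity), ← Real.rpow_mul hxp.le, ← Real.rpow_mul hNp.le,
      show r * (σ / 2) = r - 1 by rw [hr]; field_simp [show (2 - σ) ≠ 0 by linarith]; ring,
      show (1 - σ) = (-1 * (σ / 2)) + (1 - σ / 2) by ring, Real.rpow_add hNp]
    ring
  rw [e2, mul_assoc, e1]; ring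

/-- The diagonal Hardy-Littlewood-Sobolev inequality on the line. -/
lemma hls {σ : ℝ} (h0 : 0 < σ) (h1 : σ < 1) : ∃ C : ℝ≥0∞, C ≠ ∞ ∧ ∀ φ : ℝ → ℝ≥0∞, Measurable φ →
    ∫⁻ t, ∫⁻ s, ENNReal.ofReal (|t - s| ^ (-σ)) * (φ t * φ s) ≤
      C * (∫⁻ s, φ s ^ (2 / (2 - σ))) ^ (2 - σ) := by
  have hr0 : 0 < 2 / (2 - σ) := by apply div_pos <;> linarith
  have hC1 : 1 ≤ ENNReal.ofReal (2 / (1 - σ) + 2 ^ (σ / 2)) := by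
    rw [← ENNReal.ofReal_one]
    apply ENNReal.ofReal_le_ofReal
    have : 0 ≤ 2 / (1 - σ) := by apply div_nonneg <;> linarith
    have := Real.one_le_rpow (x := 2) (z := σ / 2) (by norm_num) (by positivity)
    linarith
  set C1 := ENNReal.ofReal (2 / (1 - σ) + 2 ^ (σ / 2))
  refine ⟨2 * C1, by finiteness, fun φ hφ => ?_⟩
  by_cases hN : ∫⁻ s, φ s ^ (2 / (2 - σ)) = ∞
  · rw [hN, ENNReal.top_rpow_of_pos (by linarith), ENNReal.mul_top]
    · exact le_top
    · have : C1 ≠ 0 := (lt_of_lt_of_le one_pos hC1).ne'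
      simp [this]
  by_cases hN0 : ∫⁻ s, φ s ^ (2 / (2 - σ)) = 0
  · have : φ =ᵐ[volume] 0 := by
      rw [lintegral_eq_zero_iff (by fun_prop)] at hN0
      filter_upwards [hN0] with s hs
      simpa [ENNReal.rpow_eq_zero_iff, hr0, hr0.not_gt] using hs
    refine le_trans (le_of_eq ?_) zero_le
    rw [lintegral_eq_zero_iff' (by fun_prop)]
    filter_upwards [this] with t ht
    simp [ht]
  set J : ℝ → ℝ → ℝ≥0∞ := fun t s =>
    indicator {p : ℝ × ℝ | φ p.2 ≤ φ p.1} (fun p => ENNReal.ofReal (|p.1 - p.2| ^ (-σ)) *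
      (φ p.1 * φ p.2)) (t, s) with hJ
  have hJm : Measurable (Function.uncurry J) := by
    have : Function.uncurry J = indicator {p : ℝ × ℝ | φ p.2 ≤ φ p.1}
      (fun p => ENNReal.ofReal (|p.1 - p.2| ^ (-σ)) * (φ p.1 * φ p.2)) := by
      ext ⟨t, s⟩; rfl
    rw [this]
    exact Measurable.indicator (by fun_prop) (measurableSet_le (by fun_prop) (by fun_prop))
  have hle : ∀ t s, ENNReal.ofReal (|t - s| ^ (-σ)) * (φ t * φ s) ≤ J t s + J s t := by
    intro t s
    rcases le_total (φ s) (φ t) with h | h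
    · refine le_add_right ?_
      simp [hJ, indicator, h]
    · refine le_add_left ?_
      simp [hJ, indicator, h, abs_sub_comm s t, mul_comm (φ s)]
  have key : ∫⁻ t, ∫⁻ s, J t s ≤ C1 * (∫⁻ s, φ s ^ (2 / (2 - σ))) ^ (2 - σ) := by
    have hfin : ∀ᵐ t, φ t ^ (2 / (2 - σ)) < ∞ := ae_lt_top (by fun_prop) hN
    calc ∫⁻ t, ∫⁻ s, J t s ≤ ∫⁻ t, C1 * (∫⁻ s, φ s ^ (2 / (2 - σ))) ^ (1 - σ) *
          φ t ^ (2 / (2 - σ)) := by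
          refine lintegral_mono_ae ?_
          filter_upwards [hfin] with t ht
          have ht' : φ t ≠ ∞ := by
            intro h; rw [h, ENNReal.top_rpow_of_pos hr0] at ht; exact lt_irrefl _ ht
          by_cases ht0 : φ t = 0
          · simp [hJ, ht0, indicator]
          have e : ∫⁻ s, J t s = φ t * ∫⁻ s in {s | φ s ≤ φ t},
              ENNReal.ofReal (|t - s| ^ (-σ)) * φ s := by
            rw [← lintegral_const_mul _ (by fun_prop),
              ← lintegral_indicator (measurableSet_le hφ measurable_const)]
            refine lintegral_congr fun s => ?_
            by_cases h : φ s ≤ φ t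
            · simp [hJ, indicator, h]; ring
            · simp [hJ, indicator, h]
          rw [e]
          refine (mul_le_mul_right (hls_inner h0 h1 hφ hN0 hN t ht0 ht') _).trans (le_of_eq ?_)
          have : φ t ^ (2 / (2 - σ)) = φ t ^ (1 : ℝ) * φ t ^ (2 / (2 - σ) - 1) := by
            rw [← ENNReal.rpow_add _ _ ht0 ht']; congr 1; ring
          rw [this, ENNReal.rpow_one]; ring
      _ = C1 * ((∫⁻ s, φ s ^ (2 / (2 - σ))) ^ (1 - σ) * ∫⁻ s, φ s ^ (2 / (2 - σ))) := by
          rw [lintegral_const_mul _ (by fun_prop), mul_assoc]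
      _ = _ := by
          congr 1
          have := ENNReal.rpow_add (1 - σ) 1 hN0 hN
          rw [ENNReal.rpow_one] at this
          rw [← this]; congr 1; ring
  calc _ ≤ ∫⁻ t, ∫⁻ s, (J t s + J s t) :=
        lintegral_mono fun t => lintegral_mono fun s => hle t s
    _ = (∫⁻ t, ∫⁻ s, J t s) + ∫⁻ t, ∫⁻ s, J s t := by
        rw [← lintegral_add_left (Measurable.lintegral_prod_right hJm)]
        exact lintegral_congr fun t => lintegral_add_left
          (hJm.comp measurable_prodMk_left) _
    _ = (∫⁻ t, ∫⁻ s, J t s) + ∫⁻ t, ∫⁻ s, J t s := by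
        rw [lintegral_lintegral_swap (f := fun t s => J s t)]
        exact (hJm.comp measurable_swap).aemeasurable
    _ ≤ _ := by rw [mul_assoc, two_mul]; exact add_le_add key key

lemma norm_cexp_mul_ofReal_le {L c : ℝ} (hc : |c| ≤ L) (z : ℂ) :
    ‖Complex.exp (z * c)‖ ≤ Real.exp (‖z‖ * L) := by
  rw [Complex.norm_exp]
  refine Real.exp_le_exp.2 ((Complex.re_le_norm _).trans ?_)
  rw [norm_mul, Complex.norm_real, Real.norm_eq_abs]
  gcongr

lemma norm_cexp_mul_ofReal_le_re {L c : ℝ} (hc : |c| ≤ L) (z : ℂ) :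
    ‖Complex.exp (z * c)‖ ≤ Real.exp (|z.re| * L) := by
  rw [Complex.norm_exp]
  refine Real.exp_le_exp.2 ?_
  rw [Complex.re_mul_ofReal]
  refine (le_abs_self _).trans ?_
  rw [abs_mul]
  gcongr

lemma differentiable_integral_cexp {X : Type*} [MeasurableSpace X] {m : Measure X} {c : X → ℝ}
    (hc : Measurable c) {L : ℝ} (hL : ∀ x, |c x| ≤ L) {Ψ : X → ℂ} (hΨ : Integrable Ψ m) :
    Differentiable ℂ fun z : ℂ => ∫ x, Complex.exp (z * c x) * Ψ x ∂m := by
  intro z₀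
  have hm : ∀ z : ℂ, AEStronglyMeasurable (fun x => Complex.exp (z * c x)) m := fun z =>
    (by fun_prop : Measurable fun x => Complex.exp (z * c x)).aestronglyMeasurable
  refine (hasDerivAt_integral_of_dominated_loc_of_deriv_le
    (s := Metric.ball z₀ 1) (F' := fun z x => (c x * Complex.exp (z * c x)) * Ψ x)
    (bound := fun x => (L * Real.exp ((‖z₀‖ + 1) * L)) * ‖Ψ x‖)
    (Metric.ball_mem_nhds _ one_pos) ?_ ?_ ?_ ?_ ?_ ?_).2.differentiableAt
  · exact Filter.Eventually.of_forall fun z => (hm z).mul hΨ.aestronglyMeasurable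
  · exact hΨ.bdd_mul (hm z₀) (Filter.Eventually.of_forall fun x =>
      norm_cexp_mul_ofReal_le (hL x) z₀)
  · exact ((by fun_prop : Measurable fun x => (c x : ℂ) *
      Complex.exp (z₀ * c x)).aestronglyMeasurable).mul hΨ.aestronglyMeasurable
  · refine Filter.Eventually.of_forall fun x z hz => ?_
    have hz' : ‖z‖ ≤ ‖z₀‖ + 1 := by
      have h1 : ‖z - z₀‖ < 1 := by simpa [dist_eq_norm] using hz
      have := norm_le_norm_add_norm_sub z₀ z
      rw [norm_sub_rev] at h1
      linarith
    have hL0 : 0 ≤ L := (abs_nonneg _).trans (hL x)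
    rw [norm_mul, norm_mul, Complex.norm_real, Real.norm_eq_abs]
    gcongr
    · exact hL x
    · refine (norm_cexp_mul_ofReal_le (hL x) z).trans ?_
      gcongr
  · exact hΨ.norm.const_mul _
  · refine Filter.Eventually.of_forall fun x z _ => ?_
    have := ((hasDerivAt_id z).mul_const (c x : ℂ)).cexp.mul_const (Ψ x)
    simpa [mul_comm] using this

/-- The complex power `W ^ z` of a nonnegative function, taken to be `0` where `W = 0`. -/
def wpow {X : Type*} (W : X → ℝ) (z : ℂ) (x : X) : ℂ :=
  if W x = 0 then 0 else Complex.exp (z * Real.log (W x))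

lemma measurable_wpow {X : Type*} [MeasurableSpace X] {W : X → ℝ} (hW : Measurable W) (z : ℂ) :
    Measurable (wpow W z) :=
  Measurable.ite (hW (measurableSet_singleton 0)) measurable_const (by fun_prop)

lemma norm_wpow {X : Type*} {W : X → ℝ} {x : X} (h : 0 < W x) (z : ℂ) :
    ‖wpow W z x‖ = W x ^ z.re := by
  rw [wpow, if_neg h.ne', Complex.norm_exp, Complex.re_mul_ofReal, Real.rpow_def_of_pos h, mul_comm]

lemma wpow_one {X : Type*} {W : X → ℝ} {x : X} (h : 0 ≤ W x) : wpow W 1 x = W x := by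
  rcases h.eq_or_lt with h | h
  · simp [wpow, ← h]
  · rw [wpow, if_neg h.ne', one_mul, ← Complex.ofReal_exp, Real.exp_log h]

/-- Three lines interpolation for a bilinear form in two weights which take values in
`{0} ∪ [δ, M]`. -/
lemma weight_interpolation {X Y : Type*} [MeasurableSpace X] [MeasurableSpace Y]
    {m : Measure (X × Y)} {Ψ : X × Y → ℂ} (hΨ : Integrable Ψ m) {W₁ : X → ℝ} {W₂ : Y → ℝ}
    (hW₁ : Measurable W₁) (hW₂ : Measurable W₂) {δ M : ℝ} (hδ : 0 < δ)
    (h₁ : ∀ x, W₁ x = 0 ∨ δ ≤ W₁ x) (h₂ : ∀ x, W₂ x = 0 ∨ δ ≤ W₂ x)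
    (h₁M : ∀ x, W₁ x ≤ M) (h₂M : ∀ x, W₂ x ≤ M) {θ : ℝ} (hθ : 0 < θ) (hθ1 : θ < 1) {a b : ℝ}
    (ha : ∀ (w₁ : X → ℂ) (w₂ : Y → ℂ), Measurable w₁ → Measurable w₂ → (∀ x, ‖w₁ x‖ ≤ 1) →
      (∀ y, ‖w₂ y‖ ≤ 1) → ‖∫ p, w₁ p.1 * w₂ p.2 * Ψ p ∂m‖ ≤ a)
    (hb : ∀ (w₁ : X → ℂ) (w₂ : Y → ℂ), Measurable w₁ → Measurable w₂ →
      (∀ x, ‖w₁ x‖ = W₁ x ^ (1 / θ)) → (∀ y, ‖w₂ y‖ = W₂ y ^ (1 / θ)) →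
      ‖∫ p, w₁ p.1 * w₂ p.2 * Ψ p ∂m‖ ≤ b) :
    ‖∫ p, (W₁ p.1 : ℂ) * W₂ p.2 * Ψ p ∂m‖ ≤ a ^ (1 - θ) * b ^ θ := by
  set S : Set (X × Y) := {p | W₁ p.1 ≠ 0 ∧ W₂ p.2 ≠ 0} with hS
  have hSm : MeasurableSet S :=
    ((hW₁.comp measurable_fst) (measurableSet_singleton 0)).compl.inter
      ((hW₂.comp measurable_snd) (measurableSet_singleton 0)).compl
  set L₀ := max |Real.log δ| |Real.log M|
  have hlog : ∀ w : ℝ, w = 0 ∨ δ ≤ w → w ≤ M → |Real.log w| ≤ L₀ := by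
    intro w h hM
    rcases h with h | h
    · simp [h, L₀]
    · exact abs_le_max_abs_abs (Real.log_le_log hδ h) (Real.log_le_log (hδ.trans_le h) hM)
  set c : X × Y → ℝ := fun p => (Real.log (W₁ p.1) + Real.log (W₂ p.2)) / θ with hc
  have hcm : Measurable c := by fun_prop
  have hcL : ∀ p, |c p| ≤ (L₀ + L₀) / θ := by
    intro p
    rw [hc, abs_div, abs_of_pos hθ]
    gcongr
    exact (abs_add_le _ _).trans (add_le_add (hlog _ (h₁ _) (h₁M _)) (hlog _ (h₂ _) (h₂M _)))
  set F : ℂ → ℂ := fun z => ∫ p, Complex.exp (z * c p) * S.indicator Ψ p ∂m with hF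
  have hFd : Differentiable ℂ F := differentiable_integral_cexp hcm hcL (hΨ.indicator hSm)
  have hFw : ∀ z, F z = ∫ p, wpow W₁ (z / θ) p.1 * wpow W₂ (z / θ) p.2 * Ψ p ∂m := by
    intro z
    refine integral_congr_ae (Filter.Eventually.of_forall fun p => ?_)
    by_cases hp : p ∈ S
    · simp only [indicator_of_mem hp, wpow, if_neg hp.1, if_neg hp.2, hc]
      rw [← Complex.exp_add]
      congr 2
      push_cast
      ring
    · simp only [indicator_of_notMem hp, mul_zero]
      have : W₁ p.1 = 0 ∨ W₂ p.2 = 0 := by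
        by_contra! h
        exact hp h
      rcases this with h | h <;> simp [wpow, h]
  have h0 : ∀ x, 0 ≤ W₁ x := fun x => (h₁ x).elim (fun h => h.ge) (fun h => hδ.le.trans h)
  have h0' : ∀ x, 0 ≤ W₂ x := fun x => (h₂ x).elim (fun h => h.ge) (fun h => hδ.le.trans h)
  have hθmem : (θ : ℂ) ∈ Complex.HadamardThreeLines.verticalClosedStrip 0 1 := by
    simp [Complex.HadamardThreeLines.verticalClosedStrip, hθ.le, hθ1.le]
  have key := Complex.HadamardThreeLines.norm_le_interp_of_mem_verticalClosedStrip₀₁' F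
    (a := a) (b := b) hθmem hFd.diffContOnCl ?_ ?_ ?_
  · rw [Complex.ofReal_re, hFw, div_self (by exact_mod_cast hθ.ne')] at key
    simpa only [wpow_one (h0 _), wpow_one (h0' _)] using key
  · refine ⟨∫ p, Real.exp ((L₀ + L₀) / θ) * ‖S.indicator Ψ p‖ ∂m, ?_⟩
    rintro _ ⟨z, hz, rfl⟩
    refine norm_integral_le_of_norm_le ((hΨ.indicator hSm).norm.const_mul _)
      (Filter.Eventually.of_forall fun p => ?_)
    rw [norm_mul]
    gcongr
    refine (norm_cexp_mul_ofReal_le_re (hcL p) z).trans (Real.exp_le_exp.2 ?_)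
    have hz1 : |z.re| ≤ 1 := abs_le.2 ⟨by linarith [hz.1], hz.2⟩
    exact mul_le_of_le_one_left ((abs_nonneg _).trans (hcL p)) hz1
  · intro z hz
    rw [hFw]
    have hz : (z / θ).re = 0 := by
      have : z.re = 0 := hz
      simp [Complex.div_ofReal_re, this]
    refine ha _ _ (measurable_wpow hW₁ _) (measurable_wpow hW₂ _) (fun x => ?_) (fun x => ?_)
    · rcases (h0 x).eq_or_lt with h | h
      · simp [wpow, ← h]
      · rw [norm_wpow h, hz, Real.rpow_zero]
    · rcases (h0' x).eq_or_lt with h | h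
      · simp [wpow, ← h]
      · rw [norm_wpow h, hz, Real.rpow_zero]
  · intro z hz
    rw [hFw]
    have hz : (z / θ).re = 1 / θ := by
      have : z.re = 1 := hz
      simp [Complex.div_ofReal_re, this]
    refine hb _ _ (measurable_wpow hW₁ _) (measurable_wpow hW₂ _) (fun x => ?_) (fun x => ?_)
    · rcases (h0 x).eq_or_lt with h | h
      · simp [wpow, ← h, hθ.ne']
      · rw [norm_wpow h, hz]
    · rcases (h0' x).eq_or_lt with h | h
      · simp [wpow, ← h, hθ.ne']
      · rw [norm_wpow h, hz]

lemma dotC_eq_inner {n : ℕ} (x ξ : Rn n) : dotC x ξ = ((inner ℝ x ξ : ℝ) : ℂ) := by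
  simp [dotC, PiLp.inner_apply, mul_comm]

/-- The Gaussian kernel `∫ e^{-a|ξ|²+iz·ξ} dξ`. -/
def gaussK {n : ℕ} (a : ℂ) (z : Rn n) : ℂ :=
  ∫ ξ : Rn n, Complex.exp (-a * (‖ξ‖ : ℂ) ^ 2 + Complex.I * dotC z ξ)

lemma gaussK_eq {n : ℕ} {a : ℂ} (ha : 0 < a.re) (z : Rn n) :
    gaussK a z = (π / a) ^ ((n : ℂ) / 2) * Complex.exp (-(‖z‖ : ℂ) ^ 2 / (4 * a)) := by
  simp only [gaussK, dotC_eq_inner]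
  rw [GaussianFourier.integral_cexp_neg_mul_sq_norm_add ha]
  simp

lemma norm_gaussK_le {n : ℕ} {a : ℂ} (ha : 0 < a.re) (z : Rn n) :
    ‖gaussK a z‖ ≤ (π / ‖a‖) ^ ((n : ℝ) / 2) := by
  rw [gaussK_eq ha, norm_mul]
  have h1 : ‖(π / a : ℂ) ^ ((n : ℂ) / 2)‖ = (π / ‖a‖) ^ ((n : ℝ) / 2) := by
    have : ((n : ℂ) / 2) = (((n : ℝ) / 2 : ℝ) : ℂ) := by push_cast; rfl
    rw [this, Complex.norm_cpow_real, norm_div, Complex.norm_real, Real.norm_eq_abs,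
      abs_of_pos Real.pi_pos]
  rw [h1]
  refine mul_le_of_le_one_right (by positivity) ?_
  rw [Complex.norm_exp, Real.exp_le_one_iff]
  have : (-(‖z‖ : ℂ) ^ 2 / (4 * a)) = ((-(‖z‖ ^ 2 / 4) : ℝ) : ℂ) * a⁻¹ := by
    push_cast; rw [div_eq_mul_inv, mul_inv]; ring
  rw [this, Complex.re_ofReal_mul, Complex.inv_re]
  have : 0 ≤ ‖z‖ ^ 2 / 4 * (a.re / Complex.normSq a) :=
    mul_nonneg (by positivity) (div_nonneg ha.le (Complex.normSq_nonneg a))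
  linarith

lemma continuous_gaussK {n : ℕ} {a : ℂ} (ha : 0 < a.re) :
    Continuous (gaussK a : Rn n → ℂ) := by
  rw [show (gaussK a : Rn n → ℂ) = _ from funext (gaussK_eq ha)]
  have : a ≠ 0 := by rintro rfl; simp at ha
  fun_prop

lemma measurable_dotC {n : ℕ} : Measurable fun p : Rn n × Rn n => dotC p.1 p.2 := by
  simp only [dotC_eq_inner]; fun_prop

lemma continuous_dotC {n : ℕ} : Continuous fun p : Rn n × Rn n => dotC p.1 p.2 := by
  simp only [dotC_eq_inner]; fun_prop

lemma norm_exp_I_dotC {n : ℕ} (x ξ : Rn n) : ‖Complex.exp (Complex.I * dotC x ξ)‖ = 1 := by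
  rw [dotC_eq_inner, mul_comm]; exact Complex.norm_exp_ofReal_mul_I _

lemma norm_exp_neg_I_dotC {n : ℕ} (x ξ : Rn n) :
    ‖Complex.exp (-(Complex.I * dotC x ξ))‖ = 1 := by
  rw [dotC_eq_inner, mul_comm, ← neg_mul, ← Complex.ofReal_neg]
  exact Complex.norm_exp_ofReal_mul_I _

lemma dotC_sub {n : ℕ} (x y ξ : Rn n) : dotC (x - y) ξ = dotC x ξ - dotC y ξ := by
  simp [dotC_eq_inner, inner_sub_left]

lemma conj_dotC {n : ℕ} (x ξ : Rn n) : (starRingEnd ℂ) (dotC x ξ) = dotC x ξ := by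
  simp [dotC]

lemma norm_FT_le {n : ℕ} (f : Rn n → ℂ) (ξ : Rn n) : ‖FT f ξ‖ ≤ ∫ x, ‖f x‖ := by
  refine (norm_integral_le_integral_norm _).trans_eq ?_
  simp [norm_exp_neg_I_dotC]

lemma integrable_FT_integrand {n : ℕ} {f : Rn n → ℂ} (hf : Integrable f) (ξ : Rn n) :
    Integrable fun x => Complex.exp (-(Complex.I * dotC x ξ)) * f x := by
  refine hf.bdd_mul (c := 1) ?_ (Filter.Eventually.of_forall fun x => (norm_exp_neg_I_dotC x ξ).le)
  have : Continuous fun x : Rn n => dotC x ξ := continuous_dotC.comp (by fun_prop : Continuous fun x : Rn n => (x, ξ))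
  exact (by fun_prop : Continuous _).aestronglyMeasurable

lemma continuous_FT {n : ℕ} {f : Rn n → ℂ} (hf : Integrable f) : Continuous (FT f) := by
  refine continuous_of_dominated (bound := fun x => ‖f x‖) ?_ ?_ hf.norm ?_
  · exact fun ξ => (integrable_FT_integrand hf ξ).aestronglyMeasurable
  · exact fun ξ => Filter.Eventually.of_forall fun x => by simp [norm_exp_neg_I_dotC]
  · refine Filter.Eventually.of_forall fun x => ?_
    have : Continuous fun ξ : Rn n => dotC x ξ := continuous_dotC.comp (by fun_prop : Continuous fun ξ : Rn n => (x, ξ))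
    fun_prop

lemma norm_cexp_neg_mul_sq {n : ℕ} (a : ℂ) (ξ : Rn n) :
    ‖Complex.exp (-a * (‖ξ‖ : ℂ) ^ 2)‖ = Real.exp (-a.re * ‖ξ‖ ^ 2) := by
  rw [Complex.norm_exp]; congr 1
  rw [← Complex.ofReal_pow, Complex.re_mul_ofReal, Complex.neg_re]

lemma integrable_rexp_neg_mul_sq {n : ℕ} {ε : ℝ} (hε : 0 < ε) :
    Integrable fun ξ : Rn n => Real.exp (-ε * ‖ξ‖ ^ 2) := by
  have := (GaussianFourier.integrable_cexp_neg_mul_sq_norm_add (b := (ε : ℂ)) (by simpa) 0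
    (0 : Rn n)).norm
  simpa [Complex.norm_exp, ← Complex.ofReal_pow, Complex.re_mul_ofReal] using this

lemma integral_conj_FT_mul_FT {n : ℕ} {a : ℂ} (ha : 0 < a.re) {f g : Rn n → ℂ}
    (hf : Integrable f) (hg : Integrable g) :
    ∫ ξ, Complex.exp (-a * (‖ξ‖ : ℂ) ^ 2) * ((starRingEnd ℂ) (FT f ξ) * FT g ξ) =
      ∫ p : Rn n × Rn n, (starRingEnd ℂ) (f p.1) * g p.2 * gaussK a (p.1 - p.2) := by
  have key : ∀ (ξ : Rn n) (p : Rn n × Rn n),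
      Complex.exp (-a * (‖ξ‖ : ℂ) ^ 2) * ((starRingEnd ℂ)
        (Complex.exp (-(Complex.I * dotC p.1 ξ)) * f p.1) *
          (Complex.exp (-(Complex.I * dotC p.2 ξ)) * g p.2)) =
      (starRingEnd ℂ) (f p.1) * g p.2 *
        Complex.exp (-a * (‖ξ‖ : ℂ) ^ 2 + Complex.I * dotC (p.1 - p.2) ξ) := by
    intro ξ p
    rw [map_mul, ← Complex.exp_conj, map_neg, map_mul, conj_dotC, Complex.conj_I, dotC_sub,
      Complex.exp_add, mul_sub, sub_eq_add_neg, Complex.exp_add]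
    ring_nf
  have hfc : Integrable fun x => (starRingEnd ℂ) (f x) :=
    hf.congr' (Complex.continuous_conj.comp_aestronglyMeasurable hf.1)
      (Filter.Eventually.of_forall fun x => by simp)
  have hfg : Integrable (fun p : Rn n × Rn n => (starRingEnd ℂ) (f p.1) * g p.2) :=
    hfc.mul_prod hg
  calc _ = ∫ ξ, ∫ p : Rn n × Rn n, (starRingEnd ℂ) (f p.1) * g p.2 *
        Complex.exp (-a * (‖ξ‖ : ℂ) ^ 2 + Complex.I * dotC (p.1 - p.2) ξ) := by
        refine integral_congr_ae (Filter.Eventually.of_forall fun ξ => ?_)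
        simp only [FT]
        rw [← integral_conj, ← integral_prod_mul, ← integral_const_mul]
        exact integral_congr_ae (Filter.Eventually.of_forall fun p => key ξ p)
    _ = ∫ p : Rn n × Rn n, ∫ ξ, (starRingEnd ℂ) (f p.1) * g p.2 *
        Complex.exp (-a * (‖ξ‖ : ℂ) ^ 2 + Complex.I * dotC (p.1 - p.2) ξ) := by
        refine integral_integral_swap ?_
        refine ((integrable_rexp_neg_mul_sq (n := n) ha).mul_prod hfg.norm).congr' ?_ ?_
        · refine (hfg.1.comp_snd (μ := volume)).mul ?_
          refine Continuous.aestronglyMeasurable ?_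
          have := continuous_dotC (n := n)
          have : Continuous fun q : Rn n × Rn n × Rn n => dotC (q.2.1 - q.2.2) q.1 :=
            this.comp (by fun_prop : Continuous fun q : Rn n × Rn n × Rn n => (q.2.1 - q.2.2, q.1))
          fun_prop
        · refine Filter.Eventually.of_forall fun q => ?_
          simp only [Function.uncurry, norm_mul, Complex.exp_add, norm_cexp_neg_mul_sq,
            norm_exp_I_dotC]
          rw [Real.norm_of_nonneg (Real.exp_pos _).le, norm_norm, norm_norm]
          ring
    _ = _ := by
        simp only [integral_const_mul]; rfl

lemma norm_gaussK_ofReal {n : ℕ} {ε : ℝ} (hε : 0 < ε) (z : Rn n) :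
    ‖gaussK (ε : ℂ) z‖ = (π / ε) ^ ((n : ℝ) / 2) * Real.exp (-(1 / (4 * ε)) * ‖z‖ ^ 2) := by
  rw [gaussK_eq (by simpa using hε), norm_mul]
  congr 1
  · have : ((n : ℂ) / 2) = (((n : ℝ) / 2 : ℝ) : ℂ) := by push_cast; rfl
    rw [this, Complex.norm_cpow_real, norm_div, Complex.norm_real, Complex.norm_real,
      Real.norm_eq_abs, Real.norm_eq_abs, abs_of_pos Real.pi_pos, abs_of_pos hε]
  · rw [show (-(‖z‖ : ℂ) ^ 2 / (4 * ε)) = ((-(1 / (4 * ε)) * ‖z‖ ^ 2 : ℝ) : ℂ) by push_cast; ring,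
      Complex.norm_exp, Complex.ofReal_re]

lemma lintegral_enorm_gaussK {n : ℕ} {ε : ℝ} (hε : 0 < ε) :
    ∫⁻ z : Rn n, ‖gaussK (ε : ℂ) z‖ₑ = ENNReal.ofReal ((2 * π) ^ n) := by
  have h4 : 0 < 1 / (4 * ε) := by positivity
  simp_rw [← ofReal_norm, norm_gaussK_ofReal hε]
  rw [← ofReal_integral_eq_lintegral_ofReal ((integrable_rexp_neg_mul_sq h4).const_mul _)
    (Filter.Eventually.of_forall fun z => by positivity), integral_const_mul,
    GaussianFourier.integral_rexp_neg_mul_sq_norm h4, finrank_euclideanSpace_fin,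
    ← Real.mul_rpow (by positivity) (by positivity)]
  rw [show π / ε * (π / (1 / (4 * ε))) = (2 * π) ^ (2 : ℝ) by
    rw [Real.rpow_two]; field_simp; ring, ← Real.rpow_mul (by positivity),
    mul_div_cancel₀ _ (two_ne_zero), Real.rpow_natCast]

lemma integrable_exp_mul_FT {n : ℕ} {a : ℂ} (ha : 0 < a.re) {f g : Rn n → ℂ}
    (hf : Integrable f) (hg : Integrable g) :
    Integrable fun ξ => Complex.exp (-a * (‖ξ‖ : ℂ) ^ 2) *
      ((starRingEnd ℂ) (FT f ξ) * FT g ξ) := by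
  have := continuous_FT hf
  have := continuous_FT hg
  refine ((integrable_rexp_neg_mul_sq (n := n) ha).mul_const
    ((∫ x, ‖f x‖) * ∫ x, ‖g x‖)).mono' ?_ (Filter.Eventually.of_forall fun ξ => ?_)
  · refine Continuous.aestronglyMeasurable ?_
    have : Continuous fun ξ => (starRingEnd ℂ) (FT f ξ) := Complex.continuous_conj.comp ‹_›
    fun_prop
  · rw [norm_mul, norm_mul, norm_cexp_neg_mul_sq, RCLike.norm_conj]
    gcongr
    · exact norm_FT_le f ξ
    · exact norm_FT_le g ξ

lemma integrable_exp_mul_normSq_FT {n : ℕ} {ε : ℝ} (hε : 0 < ε) {g : Rn n → ℂ}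
    (hg : Integrable g) :
    Integrable fun ξ : Rn n => Real.exp (-ε * ‖ξ‖ ^ 2) * ‖FT g ξ‖ ^ 2 := by
  refine (integrable_exp_mul_FT (a := (ε : ℂ)) (by simpa) hg hg).norm.congr
    (Filter.Eventually.of_forall fun ξ => ?_)
  simp only [norm_mul, norm_cexp_neg_mul_sq, RCLike.norm_conj, Complex.ofReal_re]
  ring

/-- Plancherel's inequality with a Gaussian cutoff. -/
lemma integral_exp_mul_normSq_FT_le {n : ℕ} {ε : ℝ} (hε : 0 < ε) {g : Rn n → ℂ}
    (hg : Integrable g) (hg2 : Integrable fun x => ‖g x‖ ^ 2) :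
    ∫ ξ : Rn n, Real.exp (-ε * ‖ξ‖ ^ 2) * ‖FT g ξ‖ ^ 2 ≤ (2 * π) ^ n * ∫ x, ‖g x‖ ^ 2 := by
  have ha : 0 < (ε : ℂ).re := by simpa
  have h0 := integral_conj_FT_mul_FT ha hg hg
  have h1 : ∫ ξ : Rn n, Complex.exp (-(ε : ℂ) * (‖ξ‖ : ℂ) ^ 2) *
      ((starRingEnd ℂ) (FT g ξ) * FT g ξ) =
      ((∫ ξ : Rn n, Real.exp (-ε * ‖ξ‖ ^ 2) * ‖FT g ξ‖ ^ 2 : ℝ) : ℂ) := by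
    rw [← integral_complex_ofReal]
    refine integral_congr_ae (Filter.Eventually.of_forall fun ξ => ?_)
    simp only
    rw [Complex.conj_mul']
    push_cast
    rfl
  rw [h1] at h0
  have hnn : 0 ≤ ∫ ξ : Rn n, Real.exp (-ε * ‖ξ‖ ^ 2) * ‖FT g ξ‖ ^ 2 :=
    integral_nonneg fun ξ => by positivity
  have h2 : ENNReal.ofReal (∫ ξ : Rn n, Real.exp (-ε * ‖ξ‖ ^ 2) * ‖FT g ξ‖ ^ 2) ≤
      ∫⁻ p : Rn n × Rn n, ‖(starRingEnd ℂ) (g p.1) * g p.2 * gaussK (ε : ℂ) (p.1 - p.2)‖ₑ := by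
    refine le_trans (le_of_eq ?_) (enorm_integral_le_lintegral_enorm _)
    rw [← h0, ← ofReal_norm, Complex.norm_real, Real.norm_of_nonneg hnn]
  have hK : Measurable fun z : Rn n => ‖gaussK (ε : ℂ) z‖ₑ :=
    (continuous_gaussK ha).measurable.enorm
  have hG : AEMeasurable (fun x => ENNReal.ofReal (‖g x‖ ^ 2)) := hg2.1.aemeasurable.ennreal_ofReal
  set A := ∫⁻ x, ENNReal.ofReal (‖g x‖ ^ 2) with hA
  have h3 : ∀ x : Rn n, ∫⁻ y, ‖gaussK (ε : ℂ) (x - y)‖ₑ = ENNReal.ofReal ((2 * π) ^ n) := by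
    intro x
    rw [← lintegral_enorm_gaussK hε]
    exact lintegral_sub_left_eq_self (fun z => ‖gaussK (ε : ℂ) z‖ₑ) x
  have h3' : ∀ y : Rn n, ∫⁻ x, ‖gaussK (ε : ℂ) (x - y)‖ₑ = ENNReal.ofReal ((2 * π) ^ n) := by
    intro y
    rw [← lintegral_enorm_gaussK hε]
    exact lintegral_sub_right_eq_self (fun z => ‖gaussK (ε : ℂ) z‖ₑ) y
  have hKs : Measurable fun p : Rn n × Rn n => ‖gaussK (ε : ℂ) (p.1 - p.2)‖ₑ :=
    hK.comp (measurable_fst.sub measurable_snd)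
  have hm1 : AEMeasurable (fun p : Rn n × Rn n => ENNReal.ofReal (‖g p.1‖ ^ 2) *
      ‖gaussK (ε : ℂ) (p.1 - p.2)‖ₑ) (volume.prod volume) := hG.comp_fst.mul hKs.aemeasurable
  have hm2 : AEMeasurable (fun p : Rn n × Rn n => ENNReal.ofReal (‖g p.2‖ ^ 2) *
      ‖gaussK (ε : ℂ) (p.1 - p.2)‖ₑ) (volume.prod volume) := hG.comp_snd.mul hKs.aemeasurable
  have h4 : ∫⁻ p : Rn n × Rn n, ENNReal.ofReal (‖g p.1‖ ^ 2) * ‖gaussK (ε : ℂ) (p.1 - p.2)‖ₑ =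
      A * ENNReal.ofReal ((2 * π) ^ n) := by
    rw [Measure.volume_eq_prod, lintegral_prod _ hm1]
    simp only
    rw [hA, ← lintegral_mul_const'' _ hG]
    refine lintegral_congr fun x => ?_
    rw [lintegral_const_mul' _ _ ENNReal.ofReal_ne_top, h3]
  have h5 : ∫⁻ p : Rn n × Rn n, ENNReal.ofReal (‖g p.2‖ ^ 2) * ‖gaussK (ε : ℂ) (p.1 - p.2)‖ₑ =
      A * ENNReal.ofReal ((2 * π) ^ n) := by
    rw [Measure.volume_eq_prod, lintegral_prod_symm _ hm2]
    simp only
    rw [hA, ← lintegral_mul_const'' _ hG]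
    refine lintegral_congr fun x => ?_
    rw [lintegral_const_mul' _ _ ENNReal.ofReal_ne_top, h3']
  have h6 : 2 * ENNReal.ofReal (∫ ξ : Rn n, Real.exp (-ε * ‖ξ‖ ^ 2) * ‖FT g ξ‖ ^ 2) ≤
      2 * (A * ENNReal.ofReal ((2 * π) ^ n)) := by
    calc _ ≤ ∫⁻ p : Rn n × Rn n, 2 * ‖(starRingEnd ℂ) (g p.1) * g p.2 *
            gaussK (ε : ℂ) (p.1 - p.2)‖ₑ := by
          rw [lintegral_const_mul' _ _ (by simp)]; gcongr
      _ ≤ ∫⁻ p : Rn n × Rn n, (ENNReal.ofReal (‖g p.1‖ ^ 2) * ‖gaussK (ε : ℂ) (p.1 - p.2)‖ₑ +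
            ENNReal.ofReal (‖g p.2‖ ^ 2) * ‖gaussK (ε : ℂ) (p.1 - p.2)‖ₑ) := by
          refine lintegral_mono fun p => ?_
          simp only [enorm_mul]
          rw [← add_mul, ← mul_assoc, ← ofReal_norm, ← ofReal_norm (g p.2),
            RCLike.norm_conj, ← ENNReal.ofReal_mul (norm_nonneg _),
            ← ENNReal.ofReal_add (by positivity) (by positivity)]
          gcongr
          rw [show (2 : ℝ≥0∞) = ENNReal.ofReal 2 by simp, ← ENNReal.ofReal_mul (by norm_num)]
          refine ENNReal.ofReal_le_ofReal ?_
          nlinarith [sq_nonneg (‖g p.1‖ - ‖g p.2‖)]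
      _ = _ := by
          exact (lintegral_add_left' hm1 _).trans (by rw [two_mul]; exact congrArg₂ _ h4 h5)
  have h7 := (ENNReal.mul_le_mul_iff_right (by norm_num) (by simp)).1 h6
  rw [hA, ← ofReal_integral_eq_lintegral_ofReal hg2 (Filter.Eventually.of_forall fun x => by
    positivity), ← ENNReal.ofReal_mul (integral_nonneg fun x => by positivity)] at h7
  rw [mul_comm]
  exact (ENNReal.ofReal_le_ofReal_iff (mul_nonneg (integral_nonneg fun x => by positivity)
    (by positivity))).1 h7

lemma integral_mul_le_sqrt_mul_sqrt {X : Type*} [MeasurableSpace X] {m : Measure X} {F G : X → ℝ}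
    (hF : AEStronglyMeasurable F m) (hG : AEStronglyMeasurable G m) (hF0 : ∀ x, 0 ≤ F x)
    (hG0 : ∀ x, 0 ≤ G x) (hF2 : Integrable (fun x => F x ^ 2) m)
    (hG2 : Integrable (fun x => G x ^ 2) m) :
    ∫ x, F x * G x ∂m ≤ √(∫ x, F x ^ 2 ∂m) * √(∫ x, G x ^ 2 ∂m) := by
  have h := integral_mul_le_Lp_mul_Lq_of_nonneg (μ := m) (f := F) (g := G)
    Real.HolderConjugate.two_two (Filter.Eventually.of_forall hF0)
    (Filter.Eventually.of_forall hG0) (by simpa using (memLp_two_iff_integrable_sq hF).2 hF2)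
    (by simpa using (memLp_two_iff_integrable_sq hG).2 hG2)
  simpa [Real.sqrt_eq_rpow] using h

lemma integrable_of_bounded_support {X E : Type*} [MeasurableSpace X] {m : Measure X}
    [NormedAddCommGroup E] {f : X → E} {K : Set X} (hf : AEStronglyMeasurable f m)
    (hK : m K < ∞) {B : ℝ} (hB : ∀ x, ‖f x‖ ≤ B)
    (h0 : ∀ x, x ∉ K → f x = 0) :
    Integrable f m := by
  have : IntegrableOn f K m := Measure.integrableOn_of_bounded (M := B) hK.ne hf
    (Filter.Eventually.of_forall hB)
  exact (integrableOn_iff_integrable_of_support_subset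
    (fun x hx => by by_contra h; exact hx (h0 x h))).1 this

lemma integral_bilinear_gaussK {n : ℕ} {ι : Type*} (J : Finset ι) {z : ℂ} (hz : 0 < z.re)
    {a b : ι → Rn n → ℂ} (ha : ∀ j ∈ J, Integrable (a j)) (hb : ∀ j ∈ J, Integrable (b j))
    {w₁ w₂ : Rn n → ℂ} (hw₁ : Measurable w₁) (hw₂ : Measurable w₂) {M : ℝ}
    (hM₁ : ∀ x, ‖w₁ x‖ ≤ M) (hM₂ : ∀ x, ‖w₂ x‖ ≤ M) :
    ∫ p : Rn n × Rn n, w₁ p.1 * w₂ p.2 *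
        ∑ j ∈ J, (starRingEnd ℂ) (a j p.1) * b j p.2 * gaussK z (p.1 - p.2) =
      ∑ j ∈ J, ∫ ξ, Complex.exp (-z * (‖ξ‖ : ℂ) ^ 2) *
        ((starRingEnd ℂ) (FT (fun x => (starRingEnd ℂ) (w₁ x) * a j x) ξ) *
          FT (fun x => w₂ x * b j x) ξ) := by
  have hKb : ∀ p : Rn n × Rn n, ‖gaussK z (p.1 - p.2)‖ ≤ (π / ‖z‖) ^ ((n : ℝ) / 2) :=
    fun p => norm_gaussK_le hz _
  have hKm : Continuous fun p : Rn n × Rn n => gaussK z (p.1 - p.2) :=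
    (continuous_gaussK hz).comp (by fun_prop)
  have ha' : ∀ j ∈ J, Integrable fun x => (starRingEnd ℂ) (w₁ x) * a j x := fun j hj =>
    (ha j hj).bdd_mul (c := M) (Complex.continuous_conj.measurable.comp hw₁).aestronglyMeasurable
      (Filter.Eventually.of_forall fun x => by simpa using hM₁ x)
  have hb' : ∀ j ∈ J, Integrable fun x => w₂ x * b j x := fun j hj =>
    (hb j hj).bdd_mul (c := M) hw₂.aestronglyMeasurable (Filter.Eventually.of_forall hM₂)
  have hconj : ∀ {f : Rn n → ℂ}, Integrable f → Integrable fun x => (starRingEnd ℂ) (f x) :=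
    fun {f} hf => hf.congr' (Complex.continuous_conj.comp_aestronglyMeasurable hf.1)
      (Filter.Eventually.of_forall fun x => by simp)
  simp_rw [Finset.mul_sum]
  rw [integral_finsetSum]
  · refine Finset.sum_congr rfl fun j hj => ?_
    rw [integral_conj_FT_mul_FT hz (ha' j hj) (hb' j hj)]
    refine integral_congr_ae (Filter.Eventually.of_forall fun p => ?_)
    simp only [map_mul, Complex.conj_conj]
    ring
  · intro j hj
    have h1 := (hconj (ha' j hj)).mul_prod (hb' j hj)
    refine (h1.mul_bdd (c := (π / ‖z‖) ^ ((n : ℝ) / 2)) hKm.aestronglyMeasurable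
      (Filter.Eventually.of_forall hKb)).congr (Filter.Eventually.of_forall fun p => ?_)
    simp only [map_mul, Complex.conj_conj]
    ring

lemma integrable_normSq_of_bounded_support {n : ℕ} {K : Set (Rn n)} (hK : volume K < ∞)
    {f : Rn n → ℂ} (hf : Measurable f) {B : ℝ} (hB : ∀ x, ‖f x‖ ≤ B)
    (h0 : ∀ x, x ∉ K → f x = 0) : Integrable fun x => ‖f x‖ ^ 2 := by
  refine integrable_of_bounded_support (by fun_prop) hK (B := B ^ 2) (fun x => ?_)
    (fun x hx => by simp [h0 x hx])
  rw [Real.norm_of_nonneg (by positivity)]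
  gcongr
  exact hB x

/-- The interpolated dispersive estimate for a system at two fixed times. -/
lemma norm_integral_weighted_le {n : ℕ} {ι : Type*} (J : Finset ι) {z : ℂ} (hz : 0 < z.re)
    {K : Set (Rn n)} (hK : volume K < ∞)
    {a b : ι → Rn n → ℂ} (ham : ∀ j, Measurable (a j)) (hbm : ∀ j, Measurable (b j)) {B : ℝ}
    (haB : ∀ j x, ‖a j x‖ ≤ B) (hbB : ∀ j x, ‖b j x‖ ≤ B)
    (ha0 : ∀ j x, x ∉ K → a j x = 0) (hb0 : ∀ j x, x ∉ K → b j x = 0)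
    {W₁ W₂ : Rn n → ℝ} (hW₁ : Measurable W₁) (hW₂ : Measurable W₂) {δ M : ℝ} (hδ : 0 < δ)
    (h₁ : ∀ x, W₁ x = 0 ∨ δ ≤ W₁ x) (h₂ : ∀ x, W₂ x = 0 ∨ δ ≤ W₂ x)
    (h₁M : ∀ x, W₁ x ≤ M) (h₂M : ∀ x, W₂ x ≤ M)
    (h₁0 : ∀ x, x ∉ K → W₁ x = 0) (h₂0 : ∀ x, x ∉ K → W₂ x = 0)
    {θ : ℝ} (hθ : 0 < θ) (hθ1 : θ < 1) :
    ‖∑ j ∈ J, ∫ ξ, Complex.exp (-z * (‖ξ‖ : ℂ) ^ 2) *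
        ((starRingEnd ℂ) (FT (fun x => W₁ x * a j x) ξ) * FT (fun x => W₂ x * b j x) ξ)‖ ≤
      ((2 * π) ^ n * (√(∑ j ∈ J, ∫ x, ‖a j x‖ ^ 2) * √(∑ j ∈ J, ∫ x, ‖b j x‖ ^ 2))) ^ (1 - θ) *
      ((π / ‖z‖) ^ ((n : ℝ) / 2) * (√((∫ x, W₁ x ^ (2 / θ)) * ∫ x, W₂ x ^ (2 / θ)) *
        √(∫ p : Rn n × Rn n, ‖∑ j ∈ J, (starRingEnd ℂ) (a j p.1) * b j p.2‖ ^ 2))) ^ θ := by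
  have hai : ∀ j, Integrable (a j) := fun j =>
    integrable_of_bounded_support (ham j).aestronglyMeasurable hK (haB j) (ha0 j)
  have hbi : ∀ j, Integrable (b j) := fun j =>
    integrable_of_bounded_support (hbm j).aestronglyMeasurable hK (hbB j) (hb0 j)
  have hW₁n : ∀ x, 0 ≤ W₁ x := fun x => (h₁ x).elim (fun h => h.ge) fun h => hδ.le.trans h
  have hW₂n : ∀ x, 0 ≤ W₂ x := fun x => (h₂ x).elim (fun h => h.ge) fun h => hδ.le.trans h
  have hconjm : ∀ j, Measurable fun x => (starRingEnd ℂ) (a j x) := fun j =>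
    Complex.continuous_conj.measurable.comp (ham j)
  have hKb : ∀ p : Rn n × Rn n, ‖gaussK z (p.1 - p.2)‖ ≤ (π / ‖z‖) ^ ((n : ℝ) / 2) :=
    fun p => norm_gaussK_le hz _
  have hKc : Continuous fun p : Rn n × Rn n => gaussK z (p.1 - p.2) :=
    (continuous_gaussK hz).comp (by fun_prop)
  set D := (π / ‖z‖) ^ ((n : ℝ) / 2) with hD
  set Ψ : Rn n × Rn n → ℂ := fun p =>
    ∑ j ∈ J, (starRingEnd ℂ) (a j p.1) * b j p.2 * gaussK z (p.1 - p.2) with hΨ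
  have hprodm : Measurable fun p : Rn n × Rn n => ∑ j ∈ J, (starRingEnd ℂ) (a j p.1) * b j p.2 :=
    Finset.measurable_sum _ fun j _ =>
      ((hconjm j).comp measurable_fst).mul ((hbm j).comp measurable_snd)
  have hΨeq : ∀ p, Ψ p = (∑ j ∈ J, (starRingEnd ℂ) (a j p.1) * b j p.2) * gaussK z (p.1 - p.2) :=
    fun p => by rw [hΨ, Finset.sum_mul]
  have hΨm : Measurable Ψ := by
    rw [show Ψ = _ from funext hΨeq]
    exact hprodm.mul hKc.measurable
  have hKK : (volume : Measure (Rn n × Rn n)) (K ×ˢ K) < ∞ := by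
    rw [Measure.volume_eq_prod, Measure.prod_prod]; exact ENNReal.mul_lt_top hK hK
  have hprodB : ∀ p : Rn n × Rn n,
      ‖∑ j ∈ J, (starRingEnd ℂ) (a j p.1) * b j p.2‖ ≤ J.card * (B * B) := by
    intro p
    refine (norm_sum_le _ _).trans ?_
    rw [← nsmul_eq_mul]
    refine Finset.sum_le_card_nsmul _ _ _ fun j _ => ?_
    rw [norm_mul, RCLike.norm_conj]
    exact mul_le_mul (haB j _) (hbB j _) (norm_nonneg _) ((norm_nonneg _).trans (haB j p.1))
  have hprod0 : ∀ p : Rn n × Rn n, p ∉ K ×ˢ K →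
      ∑ j ∈ J, (starRingEnd ℂ) (a j p.1) * b j p.2 = 0 := by
    intro p hp
    refine Finset.sum_eq_zero fun j _ => ?_
    by_cases h : p.1 ∈ K
    · rw [hb0 j _ fun h' => hp ⟨h, h'⟩, mul_zero]
    · rw [ha0 j _ h, map_zero, zero_mul]
  have hprod2 : Integrable fun p : Rn n × Rn n =>
      ‖∑ j ∈ J, (starRingEnd ℂ) (a j p.1) * b j p.2‖ ^ 2 := by
    refine integrable_of_bounded_support (hprodm.norm.pow_const 2).aestronglyMeasurable hKK
      (B := (J.card * (B * B)) ^ 2) (fun x => ?_) (fun x hx => by simp [hprod0 x hx])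
    rw [Real.norm_of_nonneg (by positivity)]
    gcongr
    exact hprodB x
  have hΨi : Integrable Ψ := by
    have : Integrable fun p : Rn n × Rn n => ∑ j ∈ J, (starRingEnd ℂ) (a j p.1) * b j p.2 :=
      integrable_of_bounded_support hprodm.aestronglyMeasurable hKK hprodB hprod0
    rw [show Ψ = _ from funext hΨeq]
    exact this.mul_bdd (c := D) hKc.aestronglyMeasurable (Filter.Eventually.of_forall hKb)
  have key := weight_interpolation hΨi hW₁ hW₂ hδ h₁ h₂ h₁M h₂M hθ hθ1
    (a := (2 * π) ^ n * (√(∑ j ∈ J, ∫ x, ‖a j x‖ ^ 2) * √(∑ j ∈ J, ∫ x, ‖b j x‖ ^ 2)))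
    (b := D * (√((∫ x, W₁ x ^ (2 / θ)) * ∫ x, W₂ x ^ (2 / θ)) *
        √(∫ p : Rn n × Rn n, ‖∑ j ∈ J, (starRingEnd ℂ) (a j p.1) * b j p.2‖ ^ 2))) ?_ ?_
  · have hM₁ : ∀ x, ‖(W₁ x : ℂ)‖ ≤ M := fun x => by
      rw [Complex.norm_real, Real.norm_of_nonneg (hW₁n x)]; exact h₁M x
    have hM₂ : ∀ x, ‖(W₂ x : ℂ)‖ ≤ M := fun x => by
      rw [Complex.norm_real, Real.norm_of_nonneg (hW₂n x)]; exact h₂M x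
    rw [hΨ, integral_bilinear_gaussK J hz (fun j _ => hai j) (fun j _ => hbi j) (by fun_prop)
      (by fun_prop) hM₁ hM₂] at key
    simpa only [Complex.conj_ofReal] using key
  · intro w₁ w₂ hw₁ hw₂ hn₁ hn₂
    rw [hΨ, integral_bilinear_gaussK J hz (fun j _ => hai j) (fun j _ => hbi j) hw₁ hw₂ hn₁ hn₂]
    have hA : ∀ j, Integrable (fun x => (starRingEnd ℂ) (w₁ x) * a j x) ∧
        ∫ ξ : Rn n, Real.exp (-z.re * ‖ξ‖ ^ 2) *
          ‖FT (fun x => (starRingEnd ℂ) (w₁ x) * a j x) ξ‖ ^ 2 ≤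
        (2 * π) ^ n * ∫ x, ‖a j x‖ ^ 2 := by
      intro j
      have hle : ∀ x, ‖(starRingEnd ℂ) (w₁ x) * a j x‖ ≤ ‖a j x‖ := fun x => by
        rw [norm_mul, RCLike.norm_conj]
        exact mul_le_of_le_one_left (norm_nonneg _) (hn₁ x)
      have hm : Measurable fun x => (starRingEnd ℂ) (w₁ x) * a j x :=
        (Complex.continuous_conj.measurable.comp hw₁).mul (ham j)
      have hi : Integrable fun x => (starRingEnd ℂ) (w₁ x) * a j x :=
        (hai j).mono hm.aestronglyMeasurable (Filter.Eventually.of_forall hle)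
      have ha2 := integrable_normSq_of_bounded_support hK (ham j) (haB j) (ha0 j)
      have hi2 := integrable_normSq_of_bounded_support hK hm
        (fun x => (hle x).trans (haB j x)) (fun x hx => by simp [ha0 j x hx])
      refine ⟨hi, (integral_exp_mul_normSq_FT_le hz hi hi2).trans ?_⟩
      refine mul_le_mul_of_nonneg_left (integral_mono hi2 ha2 fun x => ?_) (by positivity)
      exact pow_le_pow_left₀ (norm_nonneg _) (hle x) 2
    have hB' : ∀ j, Integrable (fun x => w₂ x * b j x) ∧
        ∫ ξ : Rn n, Real.exp (-z.re * ‖ξ‖ ^ 2) * ‖FT (fun x => w₂ x * b j x) ξ‖ ^ 2 ≤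
        (2 * π) ^ n * ∫ x, ‖b j x‖ ^ 2 := by
      intro j
      have hle : ∀ x, ‖w₂ x * b j x‖ ≤ ‖b j x‖ := fun x => by
        rw [norm_mul]
        exact mul_le_of_le_one_left (norm_nonneg _) (hn₂ x)
      have hm : Measurable fun x => w₂ x * b j x := hw₂.mul (hbm j)
      have hi : Integrable fun x => w₂ x * b j x :=
        (hbi j).mono hm.aestronglyMeasurable (Filter.Eventually.of_forall hle)
      have ha2 := integrable_normSq_of_bounded_support hK (hbm j) (hbB j) (hb0 j)
      have hi2 := integrable_normSq_of_bounded_support hK hm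
        (fun x => (hle x).trans (hbB j x)) (fun x hx => by simp [hb0 j x hx])
      refine ⟨hi, (integral_exp_mul_normSq_FT_le hz hi hi2).trans ?_⟩
      refine mul_le_mul_of_nonneg_left (integral_mono hi2 ha2 fun x => ?_) (by positivity)
      exact pow_le_pow_left₀ (norm_nonneg _) (hle x) 2
    have hterm : ∀ j ∈ J, ‖∫ ξ, Complex.exp (-z * (‖ξ‖ : ℂ) ^ 2) *
        ((starRingEnd ℂ) (FT (fun x => (starRingEnd ℂ) (w₁ x) * a j x) ξ) *
          FT (fun x => w₂ x * b j x) ξ)‖ ≤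
        √((2 * π) ^ n * ∫ x, ‖a j x‖ ^ 2) * √((2 * π) ^ n * ∫ x, ‖b j x‖ ^ 2) := by
      intro j _
      refine (norm_integral_le_integral_norm _).trans ?_
      have hsq : ∀ (f : Rn n → ℂ) (ξ : Rn n), (Real.exp (-(z.re / 2) * ‖ξ‖ ^ 2) * ‖FT f ξ‖) ^ 2 =
          Real.exp (-z.re * ‖ξ‖ ^ 2) * ‖FT f ξ‖ ^ 2 := fun f ξ => by
        rw [mul_pow, ← Real.exp_nat_mul]; congr 2; push_cast; ring
      have hc1 := continuous_FT (hA j).1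
      have hc2 := continuous_FT (hB' j).1
      have hcs := integral_mul_le_sqrt_mul_sqrt (m := (volume : Measure (Rn n)))
        (F := fun ξ => Real.exp (-(z.re / 2) * ‖ξ‖ ^ 2) *
          ‖FT (fun x => (starRingEnd ℂ) (w₁ x) * a j x) ξ‖)
        (G := fun ξ => Real.exp (-(z.re / 2) * ‖ξ‖ ^ 2) * ‖FT (fun x => w₂ x * b j x) ξ‖)
        (Continuous.aestronglyMeasurable (by fun_prop))
        (Continuous.aestronglyMeasurable (by fun_prop))
        (fun ξ => by positivity) (fun ξ => by positivity)
        (by simpa only [hsq] using integrable_exp_mul_normSq_FT hz (hA j).1)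
        (by simpa only [hsq] using integrable_exp_mul_normSq_FT hz (hB' j).1)
      simp only [hsq] at hcs
      calc _ = ∫ ξ : Rn n, (Real.exp (-(z.re / 2) * ‖ξ‖ ^ 2) *
          ‖FT (fun x => (starRingEnd ℂ) (w₁ x) * a j x) ξ‖) *
          (Real.exp (-(z.re / 2) * ‖ξ‖ ^ 2) * ‖FT (fun x => w₂ x * b j x) ξ‖) := by
            refine integral_congr_ae (Filter.Eventually.of_forall fun ξ => ?_)
            simp only
            rw [norm_mul, norm_mul, norm_cexp_neg_mul_sq, RCLike.norm_conj,
              show -z.re * ‖ξ‖ ^ 2 = -(z.re / 2) * ‖ξ‖ ^ 2 + -(z.re / 2) * ‖ξ‖ ^ 2 by ring,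
              Real.exp_add]
            ring
        _ ≤ _ := hcs
        _ ≤ _ := by
            gcongr
            · exact (hA j).2
            · exact (hB' j).2
    calc _ ≤ ∑ j ∈ J, √((2 * π) ^ n * ∫ x, ‖a j x‖ ^ 2) * √((2 * π) ^ n * ∫ x, ‖b j x‖ ^ 2) :=
          (norm_sum_le _ _).trans (Finset.sum_le_sum hterm)
      _ ≤ √(∑ j ∈ J, (2 * π) ^ n * ∫ x, ‖a j x‖ ^ 2) *
            √(∑ j ∈ J, (2 * π) ^ n * ∫ x, ‖b j x‖ ^ 2) :=
          Real.sum_sqrt_mul_sqrt_le _ (fun j => mul_nonneg (by positivity)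
            (integral_nonneg fun x => by positivity)) (fun j => mul_nonneg (by positivity)
            (integral_nonneg fun x => by positivity))
      _ = _ := by
          rw [← Finset.mul_sum, ← Finset.mul_sum, Real.sqrt_mul (by positivity),
            Real.sqrt_mul (by positivity), mul_mul_mul_comm,
            Real.mul_self_sqrt (by positivity)]
  · intro w₁ w₂ hw₁ hw₂ hn₁ hn₂
    have hInt : ∀ {W : Rn n → ℝ}, Measurable W → (∀ x, 0 ≤ W x) → (∀ x, W x ≤ M) →
        (∀ x, x ∉ K → W x = 0) → Integrable fun x => W x ^ (2 / θ) := by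
      intro W hWm hWn hWM hW0
      refine integrable_of_bounded_support (hWm.pow_const _).aestronglyMeasurable hK (B := M ^ (2 / θ)) (fun x => ?_)
        (fun x hx => by rw [hW0 x hx, Real.zero_rpow (by positivity)])
      rw [Real.norm_of_nonneg (Real.rpow_nonneg (hWn x) _)]
      exact Real.rpow_le_rpow (hWn x) (hWM x) (by positivity)
    have hi₁ := hInt hW₁ hW₁n h₁M h₁0
    have hi₂ := hInt hW₂ hW₂n h₂M h₂0
    have hsq : ∀ p : Rn n × Rn n, (W₁ p.1 ^ (1 / θ) * W₂ p.2 ^ (1 / θ)) ^ 2 =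
        W₁ p.1 ^ (2 / θ) * W₂ p.2 ^ (2 / θ) := fun p => by
      rw [mul_pow, ← Real.rpow_mul_natCast (hW₁n _), ← Real.rpow_mul_natCast (hW₂n _)]
      congr 2 <;> · push_cast; ring
    have hcs := integral_mul_le_sqrt_mul_sqrt (m := (volume : Measure (Rn n × Rn n)))
      (F := fun p => W₁ p.1 ^ (1 / θ) * W₂ p.2 ^ (1 / θ))
      (G := fun p => ‖∑ j ∈ J, (starRingEnd ℂ) (a j p.1) * b j p.2‖)
      (Measurable.aestronglyMeasurable (by fun_prop)) hprodm.norm.aestronglyMeasurable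
      (fun p => mul_nonneg (Real.rpow_nonneg (hW₁n _) _) (Real.rpow_nonneg (hW₂n _) _))
      (fun p => norm_nonneg _) (by simp only [hsq]; exact hi₁.mul_prod hi₂) hprod2
    simp only [hsq] at hcs
    rw [show ∫ p : Rn n × Rn n, W₁ p.1 ^ (2 / θ) * W₂ p.2 ^ (2 / θ) =
      (∫ x, W₁ x ^ (2 / θ)) * ∫ x, W₂ x ^ (2 / θ) from
      integral_prod_mul (fun x => W₁ x ^ (2 / θ)) fun x => W₂ x ^ (2 / θ)] at hcs
    refine le_trans ?_ (mul_le_mul_of_nonneg_left hcs (by positivity : 0 ≤ D))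
    rw [← integral_const_mul]
    refine (norm_integral_le_integral_norm _).trans ?_
    refine integral_mono_of_nonneg (Filter.Eventually.of_forall fun p => norm_nonneg _) ?_
      (Filter.Eventually.of_forall fun p => ?_)
    · refine Integrable.const_mul ?_ _
      refine integrable_of_bounded_support (K := K ×ˢ K)
        (B := (M ^ (1 / θ) * M ^ (1 / θ)) * (J.card * (B * B)))
        (Measurable.aestronglyMeasurable (by fun_prop)) hKK (fun p => ?_)
        (fun p hp => by simp [hprod0 p hp])
      have e1 := Real.rpow_nonneg (hW₁n p.1) (1 / θ)
      have e2 := Real.rpow_nonneg (hW₂n p.2) (1 / θ)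
      rw [norm_mul, norm_mul, norm_norm, Real.norm_of_nonneg e1, Real.norm_of_nonneg e2]
      have hM0 : 0 ≤ M := (hW₁n p.1).trans (h₁M _)
      refine mul_le_mul (mul_le_mul ?_ ?_ e2 (by positivity)) (hprodB p) (norm_nonneg _)
        (by positivity)
      · exact Real.rpow_le_rpow (hW₁n _) (h₁M _) (by positivity)
      · exact Real.rpow_le_rpow (hW₂n _) (h₂M _) (by positivity)
    · simp only
      rw [norm_mul, norm_mul, hn₁, hn₂, hΨeq, norm_mul]
      have e1 := Real.rpow_nonneg (hW₁n p.1) (1 / θ)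
      have e2 := Real.rpow_nonneg (hW₂n p.2) (1 / θ)
      have := mul_le_mul_of_nonneg_left (hKb p) (mul_nonneg (mul_nonneg e1 e2)
        (norm_nonneg (∑ j ∈ J, (starRingEnd ℂ) (a j p.1) * b j p.2)))
      linarith

/-- The Hölder and Hardy–Littlewood–Sobolev step in the time variables. -/
lemma time_integration {b μ : ℝ} (hb : 0 < b) (hμ : 0 < μ) (hμ1 : μ < 1)
    (hbμ : μ < 2 * (1 - b)) :
    ∃ C : ℝ≥0∞, C ≠ ∞ ∧ ∀ (v G : ℝ → ℝ≥0∞) (Γ : ℝ × ℝ → ℝ≥0∞), Measurable v → Measurable G →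
      Measurable Γ →
      ∫⁻ p : ℝ × ℝ, ENNReal.ofReal (|p.1 - p.2| ^ (-b)) * ((v p.1 * v p.2) ^ (1 / 2 : ℝ) *
        (G p.1 * G p.2) ^ ((1 - μ) / 2) * Γ p ^ (μ / 2)) ≤
      C * ((∫⁻ p, Γ p) ^ (μ / 2) * ((∫⁻ t, v t ^ (1 / (1 - b))) ^ (1 - b) *
        (∫⁻ t, G t) ^ (1 - μ))) := by
  have h2μ : 0 < 2 - μ := by linarith
  have hb1 : 0 < 1 - b := by linarith
  set σ := 2 * b / (2 - μ) with hσ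
  have hσ0 : 0 < σ := by positivity
  have hσ1 : σ < 1 := by rw [hσ, div_lt_one h2μ]; linarith
  obtain ⟨C, hC, hhls⟩ := hls hσ0 hσ1
  refine ⟨C ^ (1 - μ / 2), ENNReal.rpow_ne_top_of_nonneg (by linarith) hC, ?_⟩
  intro v G Γ hv hG hΓ
  set φ : ℝ → ℝ≥0∞ := fun t => (v t ^ (1 / 2 : ℝ) * G t ^ ((1 - μ) / 2)) ^ (2 / (2 - μ)) with hφ
  have hφm : Measurable φ := ((hv.pow_const _).mul (hG.pow_const _)).pow_const _
  have hker : Measurable fun p : ℝ × ℝ => ENNReal.ofReal (|p.1 - p.2| ^ (-σ)) := by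
    refine Measurable.ennreal_ofReal (Measurable.pow_const ?_ _)
    exact (measurable_fst.sub measurable_snd).abs
  set P : ℝ × ℝ → ℝ≥0∞ := fun p => ENNReal.ofReal (|p.1 - p.2| ^ (-σ)) * (φ p.1 * φ p.2) with hP
  have hPm : Measurable P :=
    hker.mul ((hφm.comp measurable_fst).mul (hφm.comp measurable_snd))
  have hpt : ∀ p : ℝ × ℝ, ENNReal.ofReal (|p.1 - p.2| ^ (-b)) * ((v p.1 * v p.2) ^ (1 / 2 : ℝ) *
        (G p.1 * G p.2) ^ ((1 - μ) / 2) * Γ p ^ (μ / 2)) = Γ p ^ (μ / 2) * P p ^ (1 - μ / 2) := by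
    intro p
    have e1 : ENNReal.ofReal (|p.1 - p.2| ^ (-b)) =
        ENNReal.ofReal (|p.1 - p.2| ^ (-σ)) ^ (1 - μ / 2) := by
      rw [ENNReal.ofReal_rpow_of_nonneg (by positivity) (by linarith), ← Real.rpow_mul (abs_nonneg _)]
      congr 2
      rw [hσ]; field_simp
    have e2 : ∀ t, φ t ^ (1 - μ / 2) = v t ^ (1 / 2 : ℝ) * G t ^ ((1 - μ) / 2) := by
      intro t
      rw [hφ, ← ENNReal.rpow_mul, show 2 / (2 - μ) * (1 - μ / 2) = 1 by field_simp, ENNReal.rpow_one]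
    rw [hP]
    simp only
    rw [ENNReal.mul_rpow_of_nonneg _ _ (by linarith : 0 ≤ 1 - μ / 2),
      ENNReal.mul_rpow_of_nonneg _ _ (by linarith : 0 ≤ 1 - μ / 2), ← e1, e2, e2,
      ENNReal.mul_rpow_of_nonneg _ _ (by norm_num),
      ENNReal.mul_rpow_of_nonneg _ _ (by linarith : 0 ≤ (1 - μ) / 2)]
    ring
  simp_rw [hpt]
  have h1 := ENNReal.lintegral_mul_norm_pow_le (μ := (volume : Measure (ℝ × ℝ)))
    hΓ.aemeasurable hPm.aemeasurable (p := μ / 2) (q := 1 - μ / 2)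
    (by linarith) (by linarith) (by ring)
  refine h1.trans ?_
  rw [mul_left_comm]
  gcongr
  have h2 : ∫⁻ p, P p ≤ C * (∫⁻ s, φ s ^ (2 / (2 - σ))) ^ (2 - σ) := by
    rw [Measure.volume_eq_prod, lintegral_prod _ hPm.aemeasurable]
    exact hhls φ hφm
  refine (ENNReal.rpow_le_rpow h2 (by linarith)).trans ?_
  rw [ENNReal.mul_rpow_of_nonneg _ _ (by linarith : 0 ≤ 1 - μ / 2)]
  gcongr
  rw [← ENNReal.rpow_mul]
  set r := (1 - b) + (1 - μ) with hr
  have hr0 : 0 < r := by linarith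
  have hrσ : (2 - σ) * (1 - μ / 2) = r := by rw [hσ, hr]; field_simp; ring
  rw [hrσ]
  have h2σ : 0 < 2 - σ := by linarith
  have h3 : ∀ s, φ s ^ (2 / (2 - σ)) =
      (v s ^ (1 / (1 - b))) ^ ((1 - b) / r) * G s ^ ((1 - μ) / r) := by
    intro s
    rw [hφ, ← ENNReal.rpow_mul, ENNReal.mul_rpow_of_nonneg _ _ (by positivity), ← ENNReal.rpow_mul,
      ← ENNReal.rpow_mul, ← ENNReal.rpow_mul, ← hrσ]
    congr 2 <;> field_simp
  simp_rw [h3]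
  have h4 := ENNReal.lintegral_mul_norm_pow_le (μ := (volume : Measure ℝ))
    (hv.pow_const (1 / (1 - b))).aemeasurable hG.aemeasurable (p := (1 - b) / r)
    (q := (1 - μ) / r) (by positivity) (div_nonneg (by linarith) hr0.le)
    (by rw [← add_div, div_self hr0.ne'])
  refine (ENNReal.rpow_le_rpow h4 hr0.le).trans_eq ?_
  rw [ENNReal.mul_rpow_of_nonneg _ _ hr0.le, ← ENNReal.rpow_mul, ← ENNReal.rpow_mul,
    div_mul_cancel₀ _ hr0.ne', div_mul_cancel₀ _ hr0.ne']

/-- A family of bounded measurable functions on space-time which vanish outside `T × K`, where `T`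
and `K` have finite measure. -/
structure IsBdd {n : ℕ} {E : Type*} [NormedAddCommGroup E] [MeasurableSpace E] (T : Set ℝ)
    (K : Set (Rn n)) (B : ℝ) (h : ℝ × Rn n → E) : Prop where
  meas : Measurable h
  bdd : ∀ q, ‖h q‖ ≤ B
  finT : volume T < ∞
  finK : volume K < ∞
  zeroT : ∀ t x, t ∉ T → h (t, x) = 0
  zeroK : ∀ t x, x ∉ K → h (t, x) = 0

namespace IsBdd

variable {n : ℕ} {T : Set ℝ} {K : Set (Rn n)} {B : ℝ}

lemma zero {E : Type*} [NormedAddCommGroup E] [MeasurableSpace E] {h : ℝ × Rn n → E}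
    (hh : IsBdd T K B h) (q : ℝ × Rn n) (hq : q ∉ T ×ˢ K) : h q = 0 := by
  by_cases h1 : q.1 ∈ T
  · exact hh.zeroK _ _ fun h2 => hq ⟨h1, h2⟩
  · exact hh.zeroT _ _ h1

lemma nonneg {E : Type*} [NormedAddCommGroup E] [MeasurableSpace E] {h : ℝ × Rn n → E}
    (hh : IsBdd T K B h) : 0 ≤ B := (norm_nonneg _).trans (hh.bdd (0, 0))

lemma finTK {E : Type*} [NormedAddCommGroup E] [MeasurableSpace E] {h : ℝ × Rn n → E}
    (hh : IsBdd T K B h) : (volume : Measure (ℝ × Rn n)) (T ×ˢ K) < ∞ := by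
  rw [Measure.volume_eq_prod, Measure.prod_prod]; exact ENNReal.mul_lt_top hh.finT hh.finK

lemma integrable {h : ℝ × Rn n → ℂ} (hh : IsBdd T K B h) : Integrable h :=
  integrable_of_bounded_support hh.meas.aestronglyMeasurable hh.finTK hh.bdd hh.zero

lemma section_meas {E : Type*} [NormedAddCommGroup E] [MeasurableSpace E] {h : ℝ × Rn n → E}
    (hh : IsBdd T K B h) (t : ℝ) : Measurable fun x => h (t, x) :=
  hh.meas.comp measurable_prodMk_left

lemma integrable_section {h : ℝ × Rn n → ℂ} (hh : IsBdd T K B h) (t : ℝ) :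
    Integrable fun x => h (t, x) :=
  integrable_of_bounded_support (hh.section_meas t).aestronglyMeasurable hh.finK
    (fun _ => hh.bdd _) (hh.zeroK t)

lemma mul {W h : ℝ × Rn n → ℂ} {B' : ℝ} (hW : IsBdd T K B' W) (hh : IsBdd T K B h) :
    IsBdd T K (B' * B) fun q => W q * h q where
  meas := hW.meas.mul hh.meas
  bdd q := by rw [norm_mul]; exact mul_le_mul (hW.bdd q) (hh.bdd q) (norm_nonneg _) hW.nonneg
  finT := hW.finT
  finK := hW.finK
  zeroT t x ht := by rw [hW.zeroT t x ht, zero_mul]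
  zeroK t x ht := by rw [hW.zeroK t x ht, zero_mul]

lemma conj {h : ℝ × Rn n → ℂ} (hh : IsBdd T K B h) :
    IsBdd T K B fun q => (starRingEnd ℂ) (h q) where
  meas := Complex.continuous_conj.measurable.comp hh.meas
  bdd q := by rw [RCLike.norm_conj]; exact hh.bdd q
  finT := hh.finT
  finK := hh.finK
  zeroT t x ht := by rw [hh.zeroT t x ht, map_zero]
  zeroK t x ht := by rw [hh.zeroK t x ht, map_zero]

lemma measurable_FT {h : ℝ × Rn n → ℂ} (hh : IsBdd T K B h) :
    Measurable fun q : ℝ × Rn n => FT (fun x => h (q.1, x)) q.2 := by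
  have : StronglyMeasurable fun r : (ℝ × Rn n) × Rn n =>
      Complex.exp (-(Complex.I * dotC r.2 r.1.2)) * h (r.1.1, r.2) := by
    refine Measurable.stronglyMeasurable ?_
    have h1 : Measurable fun r : (ℝ × Rn n) × Rn n => dotC r.2 r.1.2 :=
      measurable_dotC.comp (by fun_prop : Measurable fun r : (ℝ × Rn n) × Rn n => (r.2, r.1.2))
    have h2 : Measurable fun r : (ℝ × Rn n) × Rn n => h (r.1.1, r.2) :=
      hh.meas.comp (by fun_prop)
    exact (h1.const_mul _).neg.cexp.mul h2
  exact (StronglyMeasurable.integral_prod_right' this).measurable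

lemma norm_FT_section_le {h : ℝ × Rn n → ℂ} (hh : IsBdd T K B h) (t : ℝ) (ξ : Rn n) :
    ‖FT (fun x => h (t, x)) ξ‖ ≤ B * (volume K).toReal := by
  refine (norm_FT_le _ _).trans ?_
  calc ∫ x, ‖h (t, x)‖ ≤ ∫ x, (toMeasurable volume K).indicator (fun _ => B) x := by
        refine integral_mono (hh.integrable_section t).norm ?_ fun x => ?_
        · exact (integrable_indicator_iff (measurableSet_toMeasurable _ _)).2
            (integrableOn_const (by rw [measure_toMeasurable]; exact hh.finK.ne))
        · by_cases hx : x ∈ toMeasurable volume K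
          · simpa [hx] using hh.bdd (t, x)
          · simp [hx, hh.zeroK t x fun h => hx (subset_toMeasurable _ _ h)]
    _ = B * (volume K).toReal := by
        rw [integral_indicator (measurableSet_toMeasurable _ _)]
        simp [measureReal_def, mul_comm]

lemma FT_section_zero {h : ℝ × Rn n → ℂ} (hh : IsBdd T K B h) {t : ℝ} (ht : t ∉ T) (ξ : Rn n) :
    FT (fun x => h (t, x)) ξ = 0 := by
  simp [FT, hh.zeroT t _ ht]

end IsBdd

/-- `∫ e^{is|ξ|²} (F(s))^(ξ) ds`. -/
def retFT {n : ℕ} (F : ℝ × Rn n → ℂ) (ξ : Rn n) : ℂ :=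
  ∫ s : ℝ, Complex.exp (Complex.I * s * (‖ξ‖ : ℂ) ^ 2) * FT (fun x => F (s, x)) ξ

lemma norm_exp_I_mul {n : ℕ} (s : ℝ) (ξ : Rn n) :
    ‖Complex.exp (Complex.I * s * (‖ξ‖ : ℂ) ^ 2)‖ = 1 := by
  rw [show Complex.I * s * (‖ξ‖ : ℂ) ^ 2 = ((s * ‖ξ‖ ^ 2 : ℝ) : ℂ) * Complex.I by push_cast; ring]
  exact Complex.norm_exp_ofReal_mul_I _

lemma IsBdd.integral_normSq_retFT {n : ℕ} {T : Set ℝ} {K : Set (Rn n)} {B : ℝ} {F : ℝ × Rn n → ℂ}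
    (hF : IsBdd T K B F) {ε : ℝ} (hε : 0 < ε) :
    Integrable (fun p : ℝ × ℝ => ∫ ξ, Complex.exp (-(ε + Complex.I * (p.1 - p.2)) * (‖ξ‖ : ℂ) ^ 2) *
        ((starRingEnd ℂ) (FT (fun x => F (p.1, x)) ξ) * FT (fun x => F (p.2, x)) ξ)) ∧
    ((∫ ξ, Real.exp (-ε * ‖ξ‖ ^ 2) * ‖retFT F ξ‖ ^ 2 : ℝ) : ℂ) =
      ∫ p : ℝ × ℝ, ∫ ξ, Complex.exp (-(ε + Complex.I * (p.1 - p.2)) * (‖ξ‖ : ℂ) ^ 2) *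
        ((starRingEnd ℂ) (FT (fun x => F (p.1, x)) ξ) * FT (fun x => F (p.2, x)) ξ) := by
  obtain ⟨φ, hφ⟩ : ∃ φ : ℝ × Rn n → ℂ, φ = fun q => FT (fun x => F (q.1, x)) q.2 := ⟨_, rfl⟩
  have hm : Measurable φ := hφ ▸ hF.measurable_FT
  have hφs : ∀ t ξ, FT (fun x => F (t, x)) ξ = φ (t, ξ) := fun t ξ => by rw [hφ]
  simp only [retFT, hφs]
  set g : Rn n → ℝ × ℝ → ℂ := fun ξ p =>
    Complex.exp (-(ε + Complex.I * (p.1 - p.2)) * (‖ξ‖ : ℂ) ^ 2) *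
      ((starRingEnd ℂ) (φ (p.1, ξ)) * φ (p.2, ξ)) with hg
  have hgm : Measurable (Function.uncurry g) := by
    have h0 : Measurable fun r : Rn n × ℝ × ℝ => φ (r.2.1, r.1) :=
      hm.comp (by fun_prop : Measurable fun r : Rn n × ℝ × ℝ => (r.2.1, r.1))
    have h1 : Measurable fun r : Rn n × ℝ × ℝ => (starRingEnd ℂ) (φ (r.2.1, r.1)) :=
      Complex.continuous_conj.measurable.comp h0
    have h2 : Measurable fun r : Rn n × ℝ × ℝ => φ (r.2.2, r.1) :=
      hm.comp (by fun_prop : Measurable fun r : Rn n × ℝ × ℝ => (r.2.2, r.1))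
    have h3 : Measurable fun r : Rn n × ℝ × ℝ =>
      Complex.exp (-(ε + Complex.I * (r.2.1 - r.2.2)) * (‖r.1‖ : ℂ) ^ 2) :=
      Continuous.measurable (by fun_prop)
    exact h3.mul (h1.mul h2)
  have hTT : (volume : Measure (ℝ × ℝ)) (T ×ˢ T) < ∞ := by
    rw [Measure.volume_eq_prod, Measure.prod_prod]; exact ENNReal.mul_lt_top hF.finT hF.finT
  set B' := B * (volume K).toReal with hB'
  have hB'0 : 0 ≤ B' := mul_nonneg hF.nonneg ENNReal.toReal_nonneg
  set k : ℝ × ℝ → ℝ := fun p => (toMeasurable volume (T ×ˢ T)).indicator (fun _ => B' * B') p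
  have hk : Integrable k := by
    refine (integrable_indicator_iff (measurableSet_toMeasurable _ _)).2 ?_
    exact integrableOn_const (by rw [measure_toMeasurable]; exact hTT.ne)
  have hgi : Integrable (Function.uncurry g) (volume.prod volume) := by
    refine ((integrable_rexp_neg_mul_sq (n := n) hε).mul_prod hk).mono'
      hgm.aestronglyMeasurable (Filter.Eventually.of_forall fun r => ?_)
    simp only [Function.uncurry, hg, norm_mul, norm_cexp_neg_mul_sq, RCLike.norm_conj]
    rw [show ((ε : ℂ) + Complex.I * (r.2.1 - r.2.2)).re = ε by simp]
    refine mul_le_mul_of_nonneg_left ?_ (Real.exp_pos _).le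
    by_cases hr : r.2 ∈ toMeasurable volume (T ×ˢ T)
    · simp only [k, indicator_of_mem hr, ← hφs]
      exact mul_le_mul (hF.norm_FT_section_le _ _) (hF.norm_FT_section_le _ _) (norm_nonneg _) hB'0
    · simp only [k, indicator_of_notMem hr, ← hφs]
      by_cases h1 : r.2.1 ∈ T
      · rw [hF.FT_section_zero (fun h2 => hr (subset_toMeasurable _ _ ⟨h1, h2⟩)), norm_zero,
          mul_zero]
      · rw [hF.FT_section_zero h1, norm_zero, zero_mul]
  refine ⟨hgi.integral_prod_right, ?_⟩
  rw [← integral_complex_ofReal]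
  refine Eq.trans ?_ (integral_integral_swap hgi)
  refine integral_congr_ae (Filter.Eventually.of_forall fun ξ => ?_)
  simp only
  rw [Complex.ofReal_mul, Complex.ofReal_pow, ← Complex.conj_mul', ← integral_conj,
    ← integral_prod_mul, ← integral_const_mul]
  refine integral_congr_ae (Filter.Eventually.of_forall fun p => ?_)
  simp only
  rw [map_mul, ← Complex.exp_conj, map_mul, map_mul, Complex.conj_I, map_pow, Complex.conj_ofReal,
    Complex.conj_ofReal, mul_mul_mul_comm, ← mul_assoc, Complex.ofReal_exp, ← Complex.exp_add,
    ← Complex.exp_add]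
  congr 2
  push_cast
  ring

/-- `Σ_j ‖h_j(t)‖²`. -/
def mass {n : ℕ} (J : Finset ℕ) (h : ℕ → ℝ × Rn n → ℂ) (t : ℝ) : ℝ :=
  ∑ j ∈ J, ∫ x, ‖h j (t, x)‖ ^ 2

/-- The squared Hilbert–Schmidt norm of the kernel `Σ_j conj h_j(t,x) h_j(s,y)` in `(x,y)`. -/
def hsSq {n : ℕ} (J : Finset ℕ) (h : ℕ → ℝ × Rn n → ℂ) (p : ℝ × ℝ) : ℝ :=
  ∫ q : Rn n × Rn n, ‖∑ j ∈ J, (starRingEnd ℂ) (h j (p.1, q.1)) * h j (p.2, q.2)‖ ^ 2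

lemma mass_nonneg {n : ℕ} (J : Finset ℕ) (h : ℕ → ℝ × Rn n → ℂ) (t : ℝ) : 0 ≤ mass J h t :=
  Finset.sum_nonneg fun _ _ => integral_nonneg fun _ => by positivity

lemma hsSq_nonneg {n : ℕ} (J : Finset ℕ) (h : ℕ → ℝ × Rn n → ℂ) (p : ℝ × ℝ) : 0 ≤ hsSq J h p :=
  integral_nonneg fun _ => by positivity

lemma measurable_mass {n : ℕ} (J : Finset ℕ) {h : ℕ → ℝ × Rn n → ℂ} (hh : ∀ j, Measurable (h j)) :
    Measurable (mass J h) := by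
  refine Finset.measurable_sum _ fun j _ => ?_
  have : StronglyMeasurable fun q : ℝ × Rn n => ‖h j q‖ ^ 2 :=
    ((hh j).norm.pow_const 2).stronglyMeasurable
  exact this.integral_prod_right'.measurable

lemma measurable_hsSq {n : ℕ} (J : Finset ℕ) {h : ℕ → ℝ × Rn n → ℂ} (hh : ∀ j, Measurable (h j)) :
    Measurable (hsSq J h) := by
  have : StronglyMeasurable fun r : (ℝ × ℝ) × (Rn n × Rn n) =>
      ‖∑ j ∈ J, (starRingEnd ℂ) (h j (r.1.1, r.2.1)) * h j (r.1.2, r.2.2)‖ ^ 2 := by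
    refine ((Finset.measurable_sum _ fun j _ => Measurable.mul ?_ ?_).norm.pow_const
      2).stronglyMeasurable
    · have h0 : Measurable fun r : (ℝ × ℝ) × (Rn n × Rn n) => h j (r.1.1, r.2.1) :=
        (hh j).comp (by fun_prop)
      exact Complex.continuous_conj.measurable.comp h0
    · exact (hh j).comp (by fun_prop)
  exact this.integral_prod_right'.measurable

lemma normSq_sum_conj_mul_le {ι : Type*} (J : Finset ι) (a b : ι → ℂ) :
    ‖∑ j ∈ J, (starRingEnd ℂ) (a j) * b j‖ ^ 2 ≤
      (∑ j ∈ J, ‖a j‖ ^ 2) * ∑ j ∈ J, ‖b j‖ ^ 2 := by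
  calc _ ≤ (∑ j ∈ J, ‖a j‖ * ‖b j‖) ^ 2 := by
        refine pow_le_pow_left₀ (norm_nonneg _) ((norm_sum_le _ _).trans_eq ?_) 2
        simp
    _ ≤ _ := Finset.sum_mul_sq_le_sq_mul_sq _ _ _

lemma hsSq_le {n : ℕ} (J : Finset ℕ) {T : Set ℝ} {K : Set (Rn n)} {B : ℝ}
    {h : ℕ → ℝ × Rn n → ℂ} (hh : ∀ j, IsBdd T K B (h j)) (p : ℝ × ℝ) :
    hsSq J h p ≤ mass J h p.1 * mass J h p.2 := by
  have hi : ∀ j t, Integrable fun x => ‖h j (t, x)‖ ^ 2 := fun j t =>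
    integrable_normSq_of_bounded_support (hh j).finK ((hh j).section_meas t) (fun x => (hh j).bdd _)
      ((hh j).zeroK t)
  have hs : ∀ t, Integrable fun x => ∑ j ∈ J, ‖h j (t, x)‖ ^ 2 := fun t =>
    integrable_finsetSum _ fun j _ => hi j t
  simp only [mass, ← integral_finsetSum _ fun j _ => hi j _]
  rw [← integral_prod_mul]
  exact integral_mono_of_nonneg (Filter.Eventually.of_forall fun q => by positivity)
    ((hs p.1).mul_prod (hs p.2))
    (Filter.Eventually.of_forall fun q => normSq_sum_conj_mul_le _ _ _)

lemma interpolation_bound {n : ℕ} {θ μ b r τ G₁ G₂ w₁ w₂ Γ : ℝ} (hμ : 0 < μ) (hμθ : μ ≤ θ)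
    (hθ1 : θ < 1) (hb : b = n * θ / 2) (hτ : 0 < τ) (hr : τ ≤ r) (hG₁ : 0 ≤ G₁) (hG₂ : 0 ≤ G₂)
    (hw₁ : 0 ≤ w₁) (hw₂ : 0 ≤ w₂) (hΓ : 0 ≤ Γ) (hΓG : Γ ≤ G₁ * G₂) :
    ((2 * π) ^ n * (√G₁ * √G₂)) ^ (1 - θ) *
      ((π / r) ^ ((n : ℝ) / 2) * (√(w₁ * w₂) * √Γ)) ^ θ ≤
    (((2 * π) ^ n) ^ (1 - θ) * π ^ b) * (τ ^ (-b) * ((w₁ ^ θ * w₂ ^ θ) ^ (1 / 2 : ℝ) *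
      (G₁ * G₂) ^ ((1 - μ) / 2) * Γ ^ (μ / 2))) := by
  have hr0 : 0 < r := hτ.trans_le hr
  have hθ : 0 < θ := hμ.trans_le hμθ
  have hb0 : 0 ≤ b := by rw [hb]; positivity
  have hG : 0 ≤ G₁ * G₂ := mul_nonneg hG₁ hG₂
  have hw : 0 ≤ w₁ * w₂ := mul_nonneg hw₁ hw₂
  have e1 : ((2 * π) ^ n * (√G₁ * √G₂)) ^ (1 - θ) =
      ((2 * π) ^ n) ^ (1 - θ) * (G₁ * G₂) ^ ((1 - θ) / 2) := by
    rw [Real.mul_rpow (by positivity) (by positivity), ← Real.sqrt_mul hG₁, Real.sqrt_eq_rpow,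
      ← Real.rpow_mul hG]
    congr 2; ring
  have e2 : ((π / r) ^ ((n : ℝ) / 2) * (√(w₁ * w₂) * √Γ)) ^ θ =
      (π / r) ^ b * ((w₁ ^ θ * w₂ ^ θ) ^ (1 / 2 : ℝ) * Γ ^ (θ / 2)) := by
    have i1 : ((π / r) ^ ((n : ℝ) / 2)) ^ θ = (π / r) ^ b := by
      rw [← Real.rpow_mul (by positivity), hb]; congr 1; ring
    have i2 : √(w₁ * w₂) ^ θ = (w₁ ^ θ * w₂ ^ θ) ^ (1 / 2 : ℝ) := by
      rw [Real.sqrt_eq_rpow, ← Real.mul_rpow hw₁ hw₂, ← Real.rpow_mul hw, ← Real.rpow_mul hw,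
        mul_comm θ]
    have i3 : √Γ ^ θ = Γ ^ (θ / 2) := by
      rw [Real.sqrt_eq_rpow, ← Real.rpow_mul hΓ]; congr 1; ring
    rw [Real.mul_rpow (by positivity) (by positivity), Real.mul_rpow (by positivity) (by positivity),
      i1, i2, i3]
  have e3 : (π / r) ^ b ≤ π ^ b * τ ^ (-b) := by
    rw [Real.rpow_neg hτ.le, ← Real.inv_rpow hτ.le, ← Real.mul_rpow (by positivity) (by positivity),
      ← div_eq_mul_inv]
    exact Real.rpow_le_rpow (by positivity) (div_le_div_of_nonneg_left (by positivity) hτ hr) hb0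
  have e4 : Γ ^ (θ / 2) ≤ Γ ^ (μ / 2) * (G₁ * G₂) ^ ((θ - μ) / 2) := by
    rw [show θ / 2 = μ / 2 + (θ - μ) / 2 by ring,
      Real.rpow_add_of_nonneg hΓ (by linarith) (by linarith)]
    gcongr
  have e5 : (G₁ * G₂) ^ ((1 - μ) / 2) = (G₁ * G₂) ^ ((1 - θ) / 2) * (G₁ * G₂) ^ ((θ - μ) / 2) := by
    rw [← Real.rpow_add_of_nonneg hG (by linarith) (by linarith)]
    congr 1; ring
  rw [e1, e2, e5]
  calc _ ≤ ((2 * π) ^ n) ^ (1 - θ) * (G₁ * G₂) ^ ((1 - θ) / 2) * ((π ^ b * τ ^ (-b)) *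
        ((w₁ ^ θ * w₂ ^ θ) ^ (1 / 2 : ℝ) * (Γ ^ (μ / 2) * (G₁ * G₂) ^ ((θ - μ) / 2)))) := by
        gcongr
    _ = _ := by ring

lemma ae_fst_ne_snd : ∀ᵐ p : ℝ × ℝ, p.1 ≠ p.2 := by
  have hm : MeasurableSet {p : ℝ × ℝ | ¬ p.1 ≠ p.2} := by
    simpa using measurableSet_eq_fun measurable_fst measurable_snd
  refine (Measure.measure_prod_null hm).2 (Filter.Eventually.of_forall fun t => ?_)
  simp

/-- The bound for the smoothed dual Strichartz form. -/
lemma exists_sum_normSq_retFT_le {n : ℕ} {θ μ b : ℝ} (hμ : 0 < μ) (hμθ : μ ≤ θ)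
    (hθ1 : θ < 1) (hb : b = n * θ / 2) (hb0 : 0 < b) (hbμ : μ < 2 * (1 - b)) :
    ∃ C : ℝ≥0∞, C ≠ ∞ ∧ ∀ (J : Finset ℕ) (T : Set ℝ) (K : Set (Rn n)) (B M δ ε : ℝ)
      (W : ℝ × Rn n → ℝ) (h : ℕ → ℝ × Rn n → ℂ), 0 < δ → 0 < ε → IsBdd T K M W →
      (∀ q, W q = 0 ∨ δ ≤ W q) → (∀ j, IsBdd T K B (h j)) →
      ENNReal.ofReal (∑ j ∈ J, ∫ ξ : Rn n, Real.exp (-ε * ‖ξ‖ ^ 2) *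
        ‖retFT (fun q => W q * h j q) ξ‖ ^ 2) ≤
      C * ((∫⁻ p, ENNReal.ofReal (hsSq J h p)) ^ (μ / 2) *
        ((∫⁻ t, ENNReal.ofReal ((∫ x, W (t, x) ^ (2 / θ)) ^ θ) ^ (1 / (1 - b))) ^ (1 - b) *
          (∫⁻ t, ENNReal.ofReal (mass J h t)) ^ (1 - μ))) := by
  have hθ : 0 < θ := hμ.trans_le hμθ
  obtain ⟨C, hC, hCb⟩ := time_integration hb0 hμ (hμθ.trans_lt hθ1) hbμ
  set C₀ := ((2 * π) ^ n) ^ (1 - θ) * π ^ b with hC₀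
  refine ⟨ENNReal.ofReal C₀ * C, ENNReal.mul_ne_top ENNReal.ofReal_ne_top hC, ?_⟩
  intro J T K B M δ ε W h hδ hε hW hWδ hh
  have hWn : ∀ q, 0 ≤ W q := fun q => (hWδ q).elim (fun h => h.ge) fun h => hδ.le.trans h
  have hWM : ∀ q, W q ≤ M := fun q => (Real.le_norm_self _).trans (hW.bdd q)
  have hWC : IsBdd T K M fun q => (W q : ℂ) :=
    ⟨Complex.measurable_ofReal.comp hW.meas, fun q => by simpa using hW.bdd q, hW.finT, hW.finK,
      fun t x ht => by simp [hW.zeroT t x ht], fun t x hx => by simp [hW.zeroK t x hx]⟩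
  have hF : ∀ j, IsBdd T K (M * B) fun q => (W q : ℂ) * h j q := fun j => hWC.mul (hh j)
  set I : ℕ → ℝ × ℝ → ℂ := fun j p => ∫ ξ : Rn n,
    Complex.exp (-(ε + Complex.I * (p.1 - p.2)) * (‖ξ‖ : ℂ) ^ 2) *
        ((starRingEnd ℂ) (FT (fun x => (W (p.1, x) : ℂ) * h j (p.1, x)) ξ) *
          FT (fun x => (W (p.2, x) : ℂ) * h j (p.2, x)) ξ) with hI
  have h1 : ∀ j, ((∫ ξ : Rn n, Real.exp (-ε * ‖ξ‖ ^ 2) *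
      ‖retFT (fun q => W q * h j q) ξ‖ ^ 2 : ℝ) : ℂ) = ∫ p, I j p :=
    fun j => ((hF j).integral_normSq_retFT hε).2
  set S := ∑ j ∈ J, ∫ ξ : Rn n, Real.exp (-ε * ‖ξ‖ ^ 2) *
        ‖retFT (fun q => W q * h j q) ξ‖ ^ 2 with hS
  set v : ℝ → ℝ≥0∞ := fun t => ENNReal.ofReal ((∫ x, W (t, x) ^ (2 / θ)) ^ θ) with hv
  have hvm : Measurable v := by
    have : StronglyMeasurable fun q : ℝ × Rn n => W q ^ (2 / θ) :=
      (hW.meas.pow_const _).stronglyMeasurable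
    exact (this.integral_prod_right'.measurable.pow_const _).ennreal_ofReal
  have hS0 : 0 ≤ S := Finset.sum_nonneg fun j _ => integral_nonneg fun ξ => by positivity
  have h2 : ENNReal.ofReal S ≤ ∫⁻ p, ‖∑ j ∈ J, I j p‖ₑ := by
    have e : (S : ℂ) = ∫ p, ∑ j ∈ J, I j p := by
      rw [hS, Complex.ofReal_sum, Finset.sum_congr rfl fun j _ => h1 j]
      exact (integral_finsetSum _ fun j _ => ((hF j).integral_normSq_retFT hε).1).symm
    calc ENNReal.ofReal S = ‖(S : ℂ)‖ₑ := by
          rw [← ofReal_norm, Complex.norm_real, Real.norm_of_nonneg hS0]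
      _ ≤ _ := by rw [e]; exact enorm_integral_le_lintegral_enorm _
  have h3 : ∀ p : ℝ × ℝ, p.1 ≠ p.2 → ‖∑ j ∈ J, I j p‖ ≤
      C₀ * (|p.1 - p.2| ^ (-b) * (((∫ x, W (p.1, x) ^ (2 / θ)) ^ θ *
        (∫ x, W (p.2, x) ^ (2 / θ)) ^ θ) ^ (1 / 2 : ℝ) *
        (mass J h p.1 * mass J h p.2) ^ ((1 - μ) / 2) * hsSq J h p ^ (μ / 2))) := by
    intro p hp
    set z : ℂ := ε + Complex.I * (p.1 - p.2) with hz
    have hzre : z.re = ε := by simp [hz]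
    have hzim : z.im = p.1 - p.2 := by simp [hz]
    have hfix := norm_integral_weighted_le J (z := z) (by rw [hzre]; exact hε) hW.finK
      (fun j => (hh j).section_meas p.1) (fun j => (hh j).section_meas p.2)
      (fun j x => (hh j).bdd _) (fun j x => (hh j).bdd _) (fun j => (hh j).zeroK p.1)
      (fun j => (hh j).zeroK p.2) (hW.section_meas p.1) (hW.section_meas p.2) hδ
      (fun x => hWδ _) (fun x => hWδ _) (fun x => hWM _) (fun x => hWM _) (hW.zeroK p.1)
      (hW.zeroK p.2) hθ hθ1
    refine hfix.trans (interpolation_bound hμ hμθ hθ1 hb (abs_pos.2 (sub_ne_zero.2 hp)) ?_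
      (mass_nonneg J h _) (mass_nonneg J h _)
      (integral_nonneg fun x => Real.rpow_nonneg (hWn _) _)
      (integral_nonneg fun x => Real.rpow_nonneg (hWn _) _) (hsSq_nonneg J h p) (hsSq_le J hh p))
    rw [← hzim]; exact Complex.abs_im_le_norm z
  have h4 := hCb v (fun t => ENNReal.ofReal (mass J h t)) (fun p => ENNReal.ofReal (hsSq J h p)) hvm
    (measurable_mass J fun j => (hh j).meas).ennreal_ofReal
    (measurable_hsSq J fun j => (hh j).meas).ennreal_ofReal
  refine h2.trans ?_
  rw [mul_assoc]
  refine le_trans ?_ (mul_le_mul_right h4 _)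
  rw [← lintegral_const_mul' _ _ ENNReal.ofReal_ne_top]
  refine lintegral_mono_ae (ae_fst_ne_snd.mono fun p hp => ?_)
  rw [← ofReal_norm]
  refine (ENNReal.ofReal_le_ofReal (h3 p hp)).trans_eq ?_
  have hI0 : ∀ t, 0 ≤ ∫ x, W (t, x) ^ (2 / θ) := fun t =>
    integral_nonneg fun x => Real.rpow_nonneg (hWn _) _
  have hm0 := mass_nonneg J h
  have hs0 := hsSq_nonneg J h p
  have hC₀0 : 0 ≤ C₀ := by positivity
  have hI1 := fun t => Real.rpow_nonneg (hI0 t) θ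
  have hmm := mul_nonneg (hm0 p.1) (hm0 p.2)
  rw [ENNReal.ofReal_mul hC₀0,
    ENNReal.ofReal_mul (p := |p.1 - p.2| ^ (-b)) (Real.rpow_nonneg (abs_nonneg _) _),
    ENNReal.ofReal_mul (mul_nonneg (Real.rpow_nonneg (mul_nonneg (hI1 _) (hI1 _)) _)
      (Real.rpow_nonneg hmm _)),
    ENNReal.ofReal_mul (Real.rpow_nonneg (mul_nonneg (hI1 _) (hI1 _)) _),
    ← ENNReal.ofReal_rpow_of_nonneg (mul_nonneg (hI1 _) (hI1 _)) (by norm_num),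
    ← ENNReal.ofReal_rpow_of_nonneg hmm (by linarith),
    ← ENNReal.ofReal_rpow_of_nonneg hs0 (by linarith),
    ENNReal.ofReal_mul (hI1 _), ENNReal.ofReal_mul (hm0 _)]

/-- The Gram matrix of a system of space-time functions. -/
def gram {n : ℕ} (h : ℕ → ℝ × Rn n → ℂ) (i j : ℕ) : ℂ :=
  ∫ q, (starRingEnd ℂ) (h j q) * h i q

lemma normSq_sum_conj_mul {ι : Type*} (J : Finset ι) (a b : ι → ℂ) :
    ((‖∑ j ∈ J, (starRingEnd ℂ) (a j) * b j‖ ^ 2 : ℝ) : ℂ) =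
      ∑ i ∈ J, ∑ j ∈ J, ((starRingEnd ℂ) (a j) * a i) * ((starRingEnd ℂ) (b i) * b j) := by
  rw [Complex.ofReal_pow, ← Complex.conj_mul', map_sum, Finset.sum_mul_sum]
  refine Finset.sum_congr rfl fun i _ => Finset.sum_congr rfl fun j _ => ?_
  rw [map_mul, Complex.conj_conj]
  ring

lemma lintegral_hsSq {n : ℕ} (J : Finset ℕ) {T : Set ℝ} {K : Set (Rn n)} {B : ℝ}
    {h : ℕ → ℝ × Rn n → ℂ} (hh : ∀ j, IsBdd T K B (h j)) :
    ∫⁻ p, ENNReal.ofReal (hsSq J h p) =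
      ENNReal.ofReal (∑ i ∈ J, ∑ j ∈ J, ‖gram h i j‖ ^ 2) := by
  set c : ℕ → ℕ → ℝ → ℂ := fun i j t => ∫ x, (starRingEnd ℂ) (h j (t, x)) * h i (t, x) with hc
  have hB : ∀ i j, IsBdd T K (B * B) fun q => (starRingEnd ℂ) (h j q) * h i q := fun i j =>
    (hh j).conj.mul (hh i)
  have hci : ∀ i j, Integrable (c i j) := fun i j => by
    have := (hB i j).integrable
    rw [Measure.volume_eq_prod] at this
    exact this.integral_prod_left
  have hcs : ∀ i j, ∫ t, c i j t = gram h i j := fun i j => by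
    have := (hB i j).integrable
    rw [Measure.volume_eq_prod] at this
    rw [gram, Measure.volume_eq_prod, integral_prod _ this]
  have hcc : ∀ i j t, (starRingEnd ℂ) (c i j t) = c j i t := fun i j t => by
    simp only [hc, ← integral_conj]
    refine integral_congr_ae (Filter.Eventually.of_forall fun x => ?_)
    simp only [map_mul, Complex.conj_conj]
    ring
  have hgc : ∀ i j, (starRingEnd ℂ) (gram h i j) = gram h j i := fun i j => by
    rw [← hcs, ← hcs, ← integral_conj]
    simp only [hcc]
  have hexp : ∀ p, (hsSq J h p : ℂ) = ∑ i ∈ J, ∑ j ∈ J, c i j p.1 * c j i p.2 := fun p => by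
    have hInt : ∀ i j, Integrable fun q : Rn n × Rn n =>
        ((starRingEnd ℂ) (h j (p.1, q.1)) * h i (p.1, q.1)) *
          ((starRingEnd ℂ) (h i (p.2, q.2)) * h j (p.2, q.2)) := fun i j =>
      ((hB i j).integrable_section p.1).mul_prod ((hB j i).integrable_section p.2)
    rw [hsSq, ← integral_complex_ofReal]
    simp only [normSq_sum_conj_mul]
    rw [integral_finsetSum _ fun i _ => integrable_finsetSum _ fun j _ => hInt i j]
    refine Finset.sum_congr rfl fun i _ => ?_
    rw [integral_finsetSum _ fun j _ => hInt i j]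
    refine Finset.sum_congr rfl fun j _ => ?_
    exact integral_prod_mul (fun x => (starRingEnd ℂ) (h j (p.1, x)) * h i (p.1, x))
      fun y => (starRingEnd ℂ) (h i (p.2, y)) * h j (p.2, y)
  have hi : ∀ i j, Integrable fun p : ℝ × ℝ => c i j p.1 * c j i p.2 := fun i j =>
    (hci i j).mul_prod (hci j i)
  have hInt : Integrable fun p => (hsSq J h p : ℂ) := by
    simp only [hexp]
    exact integrable_finsetSum _ fun i _ => integrable_finsetSum _ fun j _ => hi i j
  have hInt' : Integrable (hsSq J h) := by simpa using hInt.re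
  rw [← ofReal_integral_eq_lintegral_ofReal hInt' (Filter.Eventually.of_forall (hsSq_nonneg J h))]
  congr 1
  have : ((∫ p, hsSq J h p : ℝ) : ℂ) = ((∑ i ∈ J, ∑ j ∈ J, ‖gram h i j‖ ^ 2 : ℝ) : ℂ) := by
    rw [← integral_complex_ofReal]
    simp only [hexp]
    rw [integral_finsetSum _ fun i _ => integrable_finsetSum _ fun j _ => hi i j]
    push_cast
    refine Finset.sum_congr rfl fun i _ => ?_
    rw [integral_finsetSum _ fun j _ => hi i j]
    refine Finset.sum_congr rfl fun j _ => ?_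
    rw [Measure.volume_eq_prod, integral_prod_mul, hcs, hcs, ← hgc i j, Complex.mul_conj']
  exact_mod_cast this

lemma IsBdd.normSq {n : ℕ} {T : Set ℝ} {K : Set (Rn n)} {B : ℝ} {h : ℝ × Rn n → ℂ}
    (hh : IsBdd T K B h) : Integrable fun q => ‖h q‖ ^ 2 := by
  have := (hh.conj.mul hh).integrable.norm
  refine this.congr (Filter.Eventually.of_forall fun q => ?_)
  simp only [norm_mul, RCLike.norm_conj, sq]

lemma lintegral_mass {n : ℕ} (J : Finset ℕ) {T : Set ℝ} {K : Set (Rn n)} {B : ℝ}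
    {h : ℕ → ℝ × Rn n → ℂ} (hh : ∀ j, IsBdd T K B (h j)) :
    ∫⁻ t, ENNReal.ofReal (mass J h t) = ENNReal.ofReal (∑ j ∈ J, ∫ q, ‖h j q‖ ^ 2) := by
  have hi : ∀ j, Integrable (fun q : ℝ × Rn n => ‖h j q‖ ^ 2) (volume.prod volume) := fun j =>
    (hh j).normSq
  have hInt : ∀ j, Integrable fun t => ∫ x, ‖h j (t, x)‖ ^ 2 := fun j => (hi j).integral_prod_left
  have hm : Integrable (mass J h) := integrable_finsetSum _ fun j _ => hInt j
  rw [← ofReal_integral_eq_lintegral_ofReal hm (Filter.Eventually.of_forall (mass_nonneg J h))]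
  congr 1
  simp only [mass]
  rw [integral_finsetSum _ fun j _ => hInt j]
  exact Finset.sum_congr rfl fun j _ => (integral_prod _ (hi j)).symm

lemma gram_self {n : ℕ} (h : ℕ → ℝ × Rn n → ℂ) (j : ℕ) :
    gram h j j = ((∫ q, ‖h j q‖ ^ 2 : ℝ) : ℂ) := by
  rw [gram, ← integral_complex_ofReal]
  simp only [Complex.conj_mul', Complex.ofReal_pow]

/-- Integrable, square integrable and with integrable Fourier transform. -/
structure IsNice {n : ℕ} (f : Rn n → ℂ) : Prop where
  int : Integrable f
  sq : Integrable fun x => ‖f x‖ ^ 2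
  ft : Integrable (FT f)

lemma schrodinger_eq {n : ℕ} (f : Rn n → ℂ) (t : ℝ) (x : Rn n) :
    schrodinger f t x = ((2 * π : ℝ) ^ (-(n : ℝ)) : ℝ) •
      ∫ ξ, Complex.exp (Complex.I * (dotC x ξ - (t : ℂ) * (‖ξ‖ : ℂ) ^ 2)) * FT f ξ := by
  simp [schrodinger, prop]

lemma norm_exp_phase {n : ℕ} (t : ℝ) (x ξ : Rn n) :
    ‖Complex.exp (Complex.I * (dotC x ξ - (t : ℂ) * (‖ξ‖ : ℂ) ^ 2))‖ = 1 := by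
  rw [dotC, show ∀ a : ℝ, Complex.I * ((a : ℂ) - (t : ℂ) * (‖ξ‖ : ℂ) ^ 2) =
    ((a - t * ‖ξ‖ ^ 2 : ℝ) : ℂ) * Complex.I by intro a; push_cast; ring]
  exact Complex.norm_exp_ofReal_mul_I _

lemma continuous_phase {n : ℕ} : Continuous fun r : (ℝ × Rn n) × Rn n =>
    Complex.exp (Complex.I * (dotC r.1.2 r.2 - (r.1.1 : ℂ) * (‖r.2‖ : ℂ) ^ 2)) := by
  have h1 : Continuous fun r : (ℝ × Rn n) × Rn n => dotC r.1.2 r.2 :=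
    continuous_dotC.comp (by fun_prop : Continuous fun r : (ℝ × Rn n) × Rn n => (r.1.2, r.2))
  have h2 : Continuous fun r : (ℝ × Rn n) × Rn n => (r.1.1 : ℂ) * (‖r.2‖ : ℂ) ^ 2 := by fun_prop
  exact (continuous_const.mul (h1.sub h2)).cexp

lemma continuous_schrodinger {n : ℕ} {f : Rn n → ℂ} (hf : Integrable (FT f)) :
    Continuous fun q : ℝ × Rn n => schrodinger f q.1 q.2 := by
  simp only [schrodinger_eq]
  suffices h : Continuous fun q : ℝ × Rn n =>
      ∫ ξ, Complex.exp (Complex.I * (dotC q.2 ξ - (q.1 : ℂ) * (‖ξ‖ : ℂ) ^ 2)) * FT f ξ from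
    (continuous_const_smul ((2 * π : ℝ) ^ (-(n : ℝ)) : ℝ)).comp h
  refine continuous_of_dominated (bound := fun ξ => ‖FT f ξ‖) (fun q => ?_) (fun q => ?_) hf.norm
    (Filter.Eventually.of_forall fun ξ => ?_)
  · exact (continuous_phase.comp (by fun_prop : Continuous fun ξ : Rn n => (q, ξ))).aestronglyMeasurable.mul hf.1
  · exact Filter.Eventually.of_forall fun ξ => by rw [norm_mul, norm_exp_phase, one_mul]
  · exact (continuous_phase.comp (by fun_prop : Continuous fun q : ℝ × Rn n => (q, ξ))).mul continuous_const

lemma norm_schrodinger_le {n : ℕ} (f : Rn n → ℂ) (t : ℝ) (x : Rn n) :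
    ‖schrodinger f t x‖ ≤ (2 * π) ^ (-(n : ℝ)) * ∫ ξ, ‖FT f ξ‖ := by
  rw [schrodinger_eq, norm_smul, Real.norm_of_nonneg (by positivity)]
  gcongr
  refine (norm_integral_le_integral_norm _).trans_eq ?_
  simp only [norm_mul, norm_exp_phase, one_mul]

/-- The propagator is dual to `retFT`. -/
lemma integral_conj_schrodinger_mul {n : ℕ} {f : Rn n → ℂ} (hf : Integrable f)
    (hf' : Integrable (FT f)) {T : Set ℝ}
    {K : Set (Rn n)} {B : ℝ} {F : ℝ × Rn n → ℂ} (hF : IsBdd T K B F) :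
    ∫ q, (starRingEnd ℂ) (schrodinger f q.1 q.2) * F q =
      ((2 * π : ℝ) ^ (-(n : ℝ)) : ℝ) • ∫ ξ, (starRingEnd ℂ) (FT f ξ) * retFT F ξ := by
  have hm := (continuous_FT hf).measurable
  obtain ⟨φ, hφ⟩ : ∃ φ : Rn n → ℂ, φ = FT f := ⟨_, rfl⟩
  simp only [schrodinger_eq]
  rw [← hφ] at hf' hm ⊢
  set g : (ℝ × Rn n) → Rn n → ℂ := fun q ξ => (starRingEnd ℂ)
    (Complex.exp (Complex.I * (dotC q.2 ξ - (q.1 : ℂ) * (‖ξ‖ : ℂ) ^ 2)) * φ ξ) * F q with hg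
  have hgi : Integrable (Function.uncurry g) (volume.prod volume) := by
    refine (hF.integrable.norm.mul_prod hf'.norm).mono' ?_ (Filter.Eventually.of_forall fun r => ?_)
    · have h0 : Measurable fun r : (ℝ × Rn n) × Rn n =>
          Complex.exp (Complex.I * (dotC r.1.2 r.2 - (r.1.1 : ℂ) * (‖r.2‖ : ℂ) ^ 2)) * φ r.2 :=
        continuous_phase.measurable.mul (hm.comp measurable_snd)
      have h1 := Complex.continuous_conj.measurable.comp h0
      exact (h1.mul (hF.meas.comp measurable_fst)).aestronglyMeasurable
    · simp only [Function.uncurry, hg, norm_mul, RCLike.norm_conj, norm_exp_phase, one_mul]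
      rw [mul_comm]
  have e1 : ∀ q, (starRingEnd ℂ) (((2 * π : ℝ) ^ (-(n : ℝ)) : ℝ) •
      ∫ ξ, Complex.exp (Complex.I * (dotC q.2 ξ - (q.1 : ℂ) * (‖ξ‖ : ℂ) ^ 2)) * φ ξ) * F q =
      ((2 * π : ℝ) ^ (-(n : ℝ)) : ℝ) • ∫ ξ, g q ξ := fun q => by
    rw [Complex.real_smul, map_mul, Complex.conj_ofReal, ← integral_conj, Complex.real_smul,
      mul_assoc, ← integral_mul_const]
  simp only [e1]
  rw [integral_smul, integral_integral_swap hgi]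
  congr 1
  refine integral_congr_ae (Filter.Eventually.of_forall fun ξ => ?_)
  simp only [retFT]
  have hFi : Integrable (fun q => g q ξ) (volume.prod volume) := by
    refine (hF.integrable.norm.mul_const ‖φ ξ‖).mono' ?_ (Filter.Eventually.of_forall fun q => ?_)
    · have h0 : Measurable fun q : ℝ × Rn n =>
          Complex.exp (Complex.I * (dotC q.2 ξ - (q.1 : ℂ) * (‖ξ‖ : ℂ) ^ 2)) * φ ξ :=
        (continuous_phase.comp (by fun_prop : Continuous fun q : ℝ × Rn n => (q, ξ))).measurable.mul_const _
      have h1 := Complex.continuous_conj.measurable.comp h0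
      exact (h1.mul hF.meas).aestronglyMeasurable
    · simp only [hg, norm_mul, RCLike.norm_conj, norm_exp_phase, one_mul]
      rw [mul_comm]
  rw [Measure.volume_eq_prod, integral_prod _ hFi, ← integral_const_mul]
  refine integral_congr_ae (Filter.Eventually.of_forall fun s => ?_)
  simp only [FT]
  rw [← integral_const_mul, ← integral_const_mul]
  refine integral_congr_ae (Filter.Eventually.of_forall fun x => ?_)
  simp only [hg]
  rw [map_mul, ← Complex.exp_conj, map_mul, map_sub, map_mul, map_pow, Complex.conj_I,
    Complex.conj_ofReal, Complex.conj_ofReal, conj_dotC,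
    show -Complex.I * (dotC x ξ - (s : ℂ) * (‖ξ‖ : ℂ) ^ 2) =
      Complex.I * s * (‖ξ‖ : ℂ) ^ 2 + -(Complex.I * dotC x ξ) by ring, Complex.exp_add]
  ring

lemma IsBdd.norm_retFT_le {n : ℕ} {T : Set ℝ} {K : Set (Rn n)} {B : ℝ} {F : ℝ × Rn n → ℂ}
    (hF : IsBdd T K B F) (ξ : Rn n) : ‖retFT F ξ‖ ≤ ∫ s, ∫ x, ‖F (s, x)‖ := by
  have hi : Integrable (fun q => ‖F q‖) (volume.prod volume) := hF.integrable.norm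
  refine norm_integral_le_of_norm_le hi.integral_prod_left
    (Filter.Eventually.of_forall fun s => ?_)
  rw [norm_mul, norm_exp_I_mul, one_mul]
  exact norm_FT_le _ _

lemma IsBdd.measurable_retFT {n : ℕ} {T : Set ℝ} {K : Set (Rn n)} {B : ℝ} {F : ℝ × Rn n → ℂ}
    (hF : IsBdd T K B F) : Measurable (retFT F) := by
  obtain ⟨φ, hφ⟩ : ∃ φ : ℝ × Rn n → ℂ, φ = fun q => FT (fun x => F (q.1, x)) q.2 := ⟨_, rfl⟩
  have hm : Measurable φ := hφ ▸ hF.measurable_FT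
  have hφs : ∀ t ξ, FT (fun x => F (t, x)) ξ = φ (t, ξ) := fun t ξ => by rw [hφ]
  have : StronglyMeasurable fun r : Rn n × ℝ =>
      Complex.exp (Complex.I * r.2 * (‖r.1‖ : ℂ) ^ 2) * φ (r.2, r.1) := by
    have h1 : Measurable fun r : Rn n × ℝ => Complex.exp (Complex.I * r.2 * (‖r.1‖ : ℂ) ^ 2) :=
      Continuous.measurable (by fun_prop)
    have h2 : Measurable fun r : Rn n × ℝ => φ (r.2, r.1) :=
      hm.comp (by fun_prop : Measurable fun r : Rn n × ℝ => (r.2, r.1))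
    exact (h1.mul h2).stronglyMeasurable
  have h3 : retFT F = fun ξ => ∫ s : ℝ, Complex.exp (Complex.I * s * (‖ξ‖ : ℂ) ^ 2) * φ (s, ξ) := by
    funext ξ; simp only [retFT, hφs]
  rw [h3]
  exact (this.integral_prod_right').measurable

lemma integral_normSq_sum_eq {X ι : Type*} [DecidableEq ι] [MeasurableSpace X] {m : Measure X}
    (J : Finset ι) {f : ι → X → ℂ} (hf : ∀ i ∈ J, AEStronglyMeasurable (f i) m)
    (hf2 : ∀ i ∈ J, Integrable (fun x => ‖f i x‖ ^ 2) m)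
    (ho : ∀ i ∈ J, ∀ k ∈ J, ∫ x, f i x * (starRingEnd ℂ) (f k x) ∂m = if i = k then 1 else 0)
    (a : ι → ℂ) :
    Integrable (fun x => ‖∑ i ∈ J, a i * f i x‖ ^ 2) m ∧
      ∫ x, ‖∑ i ∈ J, a i * f i x‖ ^ 2 ∂m = ∑ i ∈ J, ‖a i‖ ^ 2 := by
  have hInt : ∀ i ∈ J, ∀ k ∈ J, Integrable
      (fun x => (a i * (starRingEnd ℂ) (a k)) * (f i x * (starRingEnd ℂ) (f k x))) m := by
    intro i hi k hk
    refine Integrable.const_mul ?_ _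
    refine ((hf2 i hi).add (hf2 k hk)).mono' ((hf i hi).mul
      (Complex.continuous_conj.comp_aestronglyMeasurable (hf k hk)))
      (Filter.Eventually.of_forall fun x => ?_)
    rw [norm_mul, RCLike.norm_conj, Pi.add_apply]
    nlinarith [sq_nonneg (‖f i x‖ - ‖f k x‖), norm_nonneg (f i x), norm_nonneg (f k x),
      mul_nonneg (norm_nonneg (f i x)) (norm_nonneg (f k x))]
  have hexp : ∀ x, ((‖∑ i ∈ J, a i * f i x‖ ^ 2 : ℝ) : ℂ) = ∑ i ∈ J, ∑ k ∈ J,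
      (a i * (starRingEnd ℂ) (a k)) * (f i x * (starRingEnd ℂ) (f k x)) := fun x => by
    rw [Complex.ofReal_pow, ← Complex.mul_conj', map_sum, Finset.sum_mul_sum]
    refine Finset.sum_congr rfl fun i _ => Finset.sum_congr rfl fun k _ => ?_
    rw [map_mul]; ring
  have h1 : Integrable (fun x => ((‖∑ i ∈ J, a i * f i x‖ ^ 2 : ℝ) : ℂ)) m := by
    simp only [hexp]
    exact integrable_finsetSum _ fun i hi => integrable_finsetSum _ fun k hk => hInt i hi k hk
  refine ⟨by simpa only [RCLike.re_to_complex, Complex.ofReal_re] using h1.re, ?_⟩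
  have h2 : ((∫ x, ‖∑ i ∈ J, a i * f i x‖ ^ 2 ∂m : ℝ) : ℂ) = ((∑ i ∈ J, ‖a i‖ ^ 2 : ℝ) : ℂ) := by
    rw [← integral_complex_ofReal]
    simp only [hexp]
    rw [integral_finsetSum _ fun i hi => integrable_finsetSum _ fun k hk => hInt i hi k hk,
      Complex.ofReal_sum]
    refine Finset.sum_congr rfl fun i hi => ?_
    rw [integral_finsetSum _ fun k hk => hInt i hi k hk, Finset.sum_eq_single_of_mem i hi]
    · rw [integral_const_mul, ho i hi i hi, if_pos rfl, mul_one, Complex.mul_conj']; push_cast; rfl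
    · intro k hk hki
      rw [integral_const_mul, ho i hi k hk, if_neg (Ne.symm hki), mul_zero]
  exact_mod_cast h2

lemma FT_sum {n : ℕ} (J : Finset ℕ) {f : ℕ → Rn n → ℂ} (hf : ∀ i ∈ J, Integrable (f i))
    (a : ℕ → ℂ) (ξ : Rn n) : FT (fun x => ∑ i ∈ J, a i * f i x) ξ = ∑ i ∈ J, a i * FT (f i) ξ := by
  simp only [FT, Finset.mul_sum]
  rw [integral_finsetSum _ fun i hi => integrable_FT_integrand ((hf i hi).const_mul _) ξ]
  refine Finset.sum_congr rfl fun i _ => ?_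
  rw [← integral_const_mul]
  refine integral_congr_ae (Filter.Eventually.of_forall fun x => ?_)
  simp only
  ring

/-- Bessel's inequality on the Fourier side, with a Gaussian weight. -/
lemma sum_normSq_integral_FT_le {n : ℕ} (J : Finset ℕ) {f : ℕ → Rn n → ℂ}
    (hf : ∀ i ∈ J, Integrable (f i)) (hf2 : ∀ i ∈ J, Integrable fun x => ‖f i x‖ ^ 2)
    (ho : ∀ i ∈ J, ∀ k ∈ J, ∫ x, f i x * (starRingEnd ℂ) (f k x) = if i = k then 1 else 0)
    {φ : Rn n → ℂ} (hφ : Measurable φ) {B : ℝ} (hB : ∀ ξ, ‖φ ξ‖ ≤ B) {ε : ℝ} (hε : 0 < ε) :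
    ∑ i ∈ J, ‖∫ ξ, (Real.exp (-ε * ‖ξ‖ ^ 2) : ℂ) * ((starRingEnd ℂ) (FT (f i) ξ) * φ ξ)‖ ^ 2 ≤
      (2 * π) ^ n * ∫ ξ, Real.exp (-ε * ‖ξ‖ ^ 2) * ‖φ ξ‖ ^ 2 := by
  set a : ℕ → ℂ := fun i =>
    ∫ ξ, (Real.exp (-ε * ‖ξ‖ ^ 2) : ℂ) * ((starRingEnd ℂ) (FT (f i) ξ) * φ ξ) with ha
  set A := ∑ i ∈ J, ‖a i‖ ^ 2 with hA
  obtain ⟨hg2, hgA⟩ := integral_normSq_sum_eq J (fun i hi => (hf i hi).1) hf2 ho a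
  set g : Rn n → ℂ := fun x => ∑ i ∈ J, a i * f i x with hg
  have hgi : Integrable g := integrable_finsetSum _ fun i hi => (hf i hi).const_mul _
  have hGle := integral_exp_mul_normSq_FT_le hε hgi hg2
  rw [hgA] at hGle
  have hexpc : Continuous fun ξ : Rn n => Real.exp (-ε * ‖ξ‖ ^ 2) := by fun_prop
  have hB0 : 0 ≤ B := (norm_nonneg _).trans (hB 0)
  have hInt : ∀ u : Rn n → ℂ, Integrable u → Integrable fun ξ =>
      (Real.exp (-ε * ‖ξ‖ ^ 2) : ℂ) * ((starRingEnd ℂ) (FT u ξ) * φ ξ) := fun u hu => by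
    have hc := continuous_FT hu
    refine ((integrable_rexp_neg_mul_sq (n := n) hε).mul_const ((∫ x, ‖u x‖) * B)).mono' ?_
      (Filter.Eventually.of_forall fun ξ => ?_)
    · exact ((Complex.measurable_ofReal.comp hexpc.measurable).mul
        ((Complex.continuous_conj.comp hc).measurable.mul hφ)).aestronglyMeasurable
    · rw [norm_mul, norm_mul, RCLike.norm_conj, Complex.norm_real,
        Real.norm_of_nonneg (Real.exp_pos _).le]
      gcongr
      · exact norm_FT_le u ξ
      · exact hB ξ
  have key : ((A : ℝ) : ℂ) =
      ∫ ξ, (Real.exp (-ε * ‖ξ‖ ^ 2) : ℂ) * ((starRingEnd ℂ) (FT g ξ) * φ ξ) := by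
    rw [hA, Complex.ofReal_sum]
    have : ∀ ξ, (Real.exp (-ε * ‖ξ‖ ^ 2) : ℂ) * ((starRingEnd ℂ) (FT g ξ) * φ ξ) = ∑ i ∈ J,
        (starRingEnd ℂ) (a i) *
          ((Real.exp (-ε * ‖ξ‖ ^ 2) : ℂ) * ((starRingEnd ℂ) (FT (f i) ξ) * φ ξ)) := fun ξ => by
      rw [hg, FT_sum J hf, map_sum, Finset.sum_mul, Finset.mul_sum]
      refine Finset.sum_congr rfl fun i _ => ?_
      rw [map_mul]; ring
    simp only [this]
    rw [integral_finsetSum _ fun i hi => (hInt _ (hf i hi)).const_mul _]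
    refine Finset.sum_congr rfl fun i _ => ?_
    rw [integral_const_mul, Complex.ofReal_pow, ← Complex.conj_mul']
  have hsq : ∀ ξ : Rn n, √(Real.exp (-ε * ‖ξ‖ ^ 2)) * √(Real.exp (-ε * ‖ξ‖ ^ 2)) =
      Real.exp (-ε * ‖ξ‖ ^ 2) := fun ξ => Real.mul_self_sqrt (Real.exp_pos _).le
  have hsq2 : ∀ (ξ : Rn n) (c : ℝ), (√(Real.exp (-ε * ‖ξ‖ ^ 2)) * c) ^ 2 =
      Real.exp (-ε * ‖ξ‖ ^ 2) * c ^ 2 := fun ξ c => by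
    rw [mul_pow, sq (√_), hsq]
  have hφi : Integrable fun ξ => Real.exp (-ε * ‖ξ‖ ^ 2) * ‖φ ξ‖ ^ 2 := by
    refine ((integrable_rexp_neg_mul_sq (n := n) hε).mul_const (B ^ 2)).mono'
      (hexpc.measurable.mul (hφ.norm.pow_const 2)).aestronglyMeasurable
      (Filter.Eventually.of_forall fun ξ => ?_)
    rw [Real.norm_of_nonneg (by positivity)]
    gcongr
    exact hB ξ
  have hA0 : 0 ≤ A := Finset.sum_nonneg fun _ _ => by positivity
  have hcs : A ≤ √(∫ ξ, Real.exp (-ε * ‖ξ‖ ^ 2) * ‖FT g ξ‖ ^ 2) *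
      √(∫ ξ, Real.exp (-ε * ‖ξ‖ ^ 2) * ‖φ ξ‖ ^ 2) := by
    calc A = ‖((A : ℝ) : ℂ)‖ := by rw [Complex.norm_real, Real.norm_of_nonneg hA0]
      _ ≤ ∫ ξ, (√(Real.exp (-ε * ‖ξ‖ ^ 2)) * ‖FT g ξ‖) * (√(Real.exp (-ε * ‖ξ‖ ^ 2)) * ‖φ ξ‖) := by
          rw [key]
          refine (norm_integral_le_integral_norm _).trans_eq ?_
          refine integral_congr_ae (Filter.Eventually.of_forall fun ξ => ?_)
          simp only
          rw [norm_mul, norm_mul, RCLike.norm_conj, Complex.norm_real,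
            Real.norm_of_nonneg (Real.exp_pos _).le, mul_mul_mul_comm, hsq]
      _ ≤ _ := by
          have := continuous_FT hgi
          refine (integral_mul_le_sqrt_mul_sqrt ?_ ?_ (fun ξ => by positivity)
            (fun ξ => by positivity) ?_ ?_).trans_eq ?_
          · exact (by fun_prop : Continuous _).aestronglyMeasurable
          · exact (hexpc.sqrt.measurable.mul hφ.norm).aestronglyMeasurable
          · simp only [hsq2]; exact integrable_exp_mul_normSq_FT hε hgi
          · simp only [hsq2]; exact hφi
          · simp only [hsq2]
  set S := ∫ ξ, Real.exp (-ε * ‖ξ‖ ^ 2) * ‖φ ξ‖ ^ 2 with hS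
  have hS0 : 0 ≤ S := integral_nonneg fun ξ => by positivity
  have h3 : A ≤ √((2 * π) ^ n * A) * √S :=
    hcs.trans (mul_le_mul_of_nonneg_right (Real.sqrt_le_sqrt hGle) (Real.sqrt_nonneg _))
  have h4 : A ^ 2 ≤ ((2 * π) ^ n * A) * S := by
    calc A ^ 2 ≤ (√((2 * π) ^ n * A) * √S) ^ 2 := pow_le_pow_left₀ hA0 h3 2
      _ = _ := by rw [mul_pow, Real.sq_sqrt (by positivity), Real.sq_sqrt hS0]
  rcases hA0.eq_or_lt with h | h
  · rw [← h]; positivity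
  · refine le_of_mul_le_mul_left ?_ h
    nlinarith

lemma sum_normSq_integral_FT_le_of_forall {n : ℕ} (J : Finset ℕ) {f : ℕ → Rn n → ℂ}
    (hf : ∀ i ∈ J, IsNice (f i))
    (ho : ∀ i ∈ J, ∀ k ∈ J, ∫ x, f i x * (starRingEnd ℂ) (f k x) = if i = k then 1 else 0)
    {φ : ℕ → Rn n → ℂ} (hφ : ∀ j, Measurable (φ j)) {B : ℕ → ℝ} (hB : ∀ j ξ, ‖φ j ξ‖ ≤ B j) {S : ℝ}
    (hS : ∀ ε, 0 < ε → ∑ j ∈ J, ∫ ξ, Real.exp (-ε * ‖ξ‖ ^ 2) * ‖φ j ξ‖ ^ 2 ≤ S) :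
    ∑ j ∈ J, ∑ i ∈ J, ‖∫ ξ, (starRingEnd ℂ) (FT (f i) ξ) * φ j ξ‖ ^ 2 ≤ (2 * π) ^ n * S := by
  have hlim : Filter.Tendsto (fun k : ℕ => ∑ j ∈ J, ∑ i ∈ J,
      ‖∫ ξ : Rn n, (Real.exp (-(1 / ((k : ℝ) + 1)) * ‖ξ‖ ^ 2) : ℂ) *
        ((starRingEnd ℂ) (FT (f i) ξ) * φ j ξ)‖ ^ 2) Filter.atTop
      (nhds (∑ j ∈ J, ∑ i ∈ J, ‖∫ ξ, (starRingEnd ℂ) (FT (f i) ξ) * φ j ξ‖ ^ 2)) := by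
    refine tendsto_finsetSum _ fun j _ => tendsto_finsetSum _ fun i hi =>
      (Filter.Tendsto.norm ?_).pow 2
    have hm : Measurable fun ξ => (starRingEnd ℂ) (FT (f i) ξ) * φ j ξ :=
      (Complex.continuous_conj.comp (continuous_FT (hf i hi).int)).measurable.mul (hφ j)
    refine tendsto_integral_of_dominated_convergence (fun ξ => ‖FT (f i) ξ‖ * B j) (fun k => ?_)
      ((hf i hi).ft.norm.mul_const _) (fun k => Filter.Eventually.of_forall fun ξ => ?_)
      (Filter.Eventually.of_forall fun ξ => ?_)
    · have : Measurable fun ξ : Rn n => (Real.exp (-(1 / ((k : ℝ) + 1)) * ‖ξ‖ ^ 2) : ℂ) :=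
        Continuous.measurable (by fun_prop)
      exact (this.mul hm).aestronglyMeasurable
    · rw [norm_mul, norm_mul, RCLike.norm_conj, Complex.norm_real,
        Real.norm_of_nonneg (Real.exp_pos _).le]
      have h1 : Real.exp (-(1 / ((k : ℝ) + 1)) * ‖ξ‖ ^ 2) ≤ 1 := by
        rw [Real.exp_le_one_iff, neg_mul]
        exact neg_nonpos.2 (by positivity)
      calc _ ≤ 1 * (‖FT (f i) ξ‖ * B j) := by gcongr; exact hB j ξ
        _ = _ := one_mul _
    · have h1 : Filter.Tendsto (fun k : ℕ => -(1 / ((k : ℝ) + 1)) * ‖ξ‖ ^ 2) Filter.atTop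
          (nhds (-0 * ‖ξ‖ ^ 2)) := tendsto_one_div_add_atTop_nhds_zero_nat.neg.mul_const _
      have h2 := (Complex.continuous_ofReal.tendsto _).comp ((Real.continuous_exp.tendsto _).comp h1)
      have h3 := h2.mul_const ((starRingEnd ℂ) (FT (f i) ξ) * φ j ξ)
      simpa using h3
  refine le_of_tendsto hlim (Filter.Eventually.of_forall fun k => ?_)
  have hk : 0 < 1 / ((k : ℝ) + 1) := by positivity
  refine (Finset.sum_le_sum fun j _ => sum_normSq_integral_FT_le J (fun i hi => (hf i hi).int)
    (fun i hi => (hf i hi).sq) ho (hφ j) (hB j) hk).trans ?_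
  rw [← Finset.mul_sum]
  exact mul_le_mul_of_nonneg_left (hS _ hk) (by positivity)

lemma le_of_self_improving {x y C V N : ℝ≥0∞} {μ : ℝ} (hμ1 : μ < 1)
    (hy : y ≠ ∞) (hN : N ≠ ∞) (h1 : y ≤ C * (y ^ (μ / 2) * (V * x ^ (1 - μ))))
    (h2 : x ^ 2 ≤ N * y) : x ≤ C * (N ^ (1 - μ / 2) * V) := by
  rcases eq_or_ne x 0 with hx | hx
  · simp [hx]
  have hNy : N * y ≠ 0 := fun h => by
    rw [h] at h2; exact hx (by simpa using h2)
  have hy0 : y ≠ 0 := (mul_ne_zero_iff.1 hNy).2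
  have hN0 : N ≠ 0 := (mul_ne_zero_iff.1 hNy).1
  have hx1 : x ≤ N ^ (1 / 2 : ℝ) * y ^ (1 / 2 : ℝ) := by
    rw [← ENNReal.mul_rpow_of_nonneg _ _ (by norm_num)]
    calc x = (x ^ 2) ^ (1 / 2 : ℝ) := by
          rw [← ENNReal.rpow_two, ← ENNReal.rpow_mul]; norm_num
      _ ≤ _ := ENNReal.rpow_le_rpow h2 (by norm_num)
  have hyr : ∀ s : ℝ, y ^ s ≠ 0 ∧ y ^ s ≠ ∞ := fun s =>
    ⟨by simp [ENNReal.rpow_eq_zero_iff, hy0, hy], by simp [ENNReal.rpow_eq_top_iff, hy0, hy]⟩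
  have hxp : x ^ (1 - μ) ≤ N ^ ((1 - μ) / 2) * y ^ ((1 - μ) / 2) := by
    refine (ENNReal.rpow_le_rpow hx1 (by linarith)).trans_eq ?_
    rw [ENNReal.mul_rpow_of_nonneg _ _ (by linarith), ← ENNReal.rpow_mul, ← ENNReal.rpow_mul,
      show 1 / 2 * (1 - μ) = (1 - μ) / 2 by ring]
  have h3 : y ^ (1 / 2 : ℝ) ≤ C * (V * N ^ ((1 - μ) / 2)) := by
    rw [← ENNReal.mul_le_mul_iff_right (hyr (1 / 2)).1 (hyr (1 / 2)).2]
    calc y ^ (1 / 2 : ℝ) * y ^ (1 / 2 : ℝ) = y := by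
          rw [← ENNReal.rpow_add _ _ hy0 hy]; norm_num
      _ ≤ C * (y ^ (μ / 2) * (V * (N ^ ((1 - μ) / 2) * y ^ ((1 - μ) / 2)))) := by
          refine h1.trans ?_; gcongr
      _ = (y ^ (μ / 2) * y ^ ((1 - μ) / 2)) * (C * (V * N ^ ((1 - μ) / 2))) := by ring
      _ = _ := by
          rw [← ENNReal.rpow_add _ _ hy0 hy, show μ / 2 + (1 - μ) / 2 = 1 / 2 by ring]
  calc x ≤ N ^ (1 / 2 : ℝ) * (C * (V * N ^ ((1 - μ) / 2))) := hx1.trans (by gcongr)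
    _ = C * ((N ^ (1 / 2 : ℝ) * N ^ ((1 - μ) / 2)) * V) := by ring
    _ = _ := by
        rw [← ENNReal.rpow_add _ _ hN0 hN, show 1 / 2 + (1 - μ) / 2 = 1 - μ / 2 by ring]

/-- Restricted orthonormal Strichartz estimate, tested against a weight `W²`. -/
lemma exists_lintegral_weight_mul_sum_le {n : ℕ} {θ μ b : ℝ} (hμ : 0 < μ) (hμθ : μ ≤ θ)
    (hθ1 : θ < 1) (hb : b = n * θ / 2) (hb0 : 0 < b) (hbμ : μ < 2 * (1 - b)) :
    ∃ C : ℝ≥0∞, C ≠ ∞ ∧ ∀ (J : Finset ℕ) (T : Set ℝ) (K : Set (Rn n)) (M δ : ℝ)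
      (W : ℝ × Rn n → ℝ) (f : ℕ → Rn n → ℂ), 0 < δ → IsBdd T K M W →
      (∀ q, W q = 0 ∨ δ ≤ W q) → (∀ j ∈ J, IsNice (f j)) →
      (∀ i ∈ J, ∀ k ∈ J, ∫ x, f i x * (starRingEnd ℂ) (f k x) = if i = k then 1 else 0) →
      (∫⁻ t, ENNReal.ofReal ((∫ x, W (t, x) ^ (2 / θ)) ^ θ) ^ (1 / (1 - b))) ^ (1 - b) ≠ ∞ →
      ∫⁻ q : ℝ × Rn n, ENNReal.ofReal (W q ^ 2 * ∑ j ∈ J, ‖schrodinger (f j) q.1 q.2‖ ^ 2) ≤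
      C * ((J.card : ℝ≥0∞) ^ (1 - μ / 2) *
        (∫⁻ t, ENNReal.ofReal ((∫ x, W (t, x) ^ (2 / θ)) ^ θ) ^ (1 / (1 - b))) ^ (1 - b)) := by
  obtain ⟨C, hC, hCb⟩ := exists_sum_normSq_retFT_le hμ hμθ hθ1 hb hb0 hbμ
  set κ : ℝ := (2 * π) ^ (-(n : ℝ)) with hκ
  have hκ0 : 0 < κ := by positivity
  have hκn : κ * (2 * π) ^ n = 1 := by
    rw [hκ, ← Real.rpow_natCast, ← Real.rpow_add (by positivity)]; simp
  refine ⟨ENNReal.ofReal κ * C, ENNReal.mul_ne_top ENNReal.ofReal_ne_top hC, ?_⟩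
  intro J T K M δ W f hδ hW hWδ hf ho hV
  set V := (∫⁻ t, ENNReal.ofReal ((∫ x, W (t, x) ^ (2 / θ)) ^ θ) ^ (1 / (1 - b))) ^ (1 - b) with hVd
  set B : ℝ := M * ∑ j ∈ J, κ * ∫ ξ, ‖FT (f j) ξ‖ with hBd
  have hM : 0 ≤ M := hW.nonneg
  have hnn : ∀ j, 0 ≤ κ * ∫ ξ, ‖FT (f j) ξ‖ := fun j =>
    mul_nonneg hκ0.le (integral_nonneg fun _ => norm_nonneg _)
  set h : ℕ → ℝ × Rn n → ℂ := fun j q =>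
    if j ∈ J then (W q : ℂ) * schrodinger (f j) q.1 q.2 else 0 with hh
  have hhJ : ∀ j ∈ J, ∀ q, h j q = (W q : ℂ) * schrodinger (f j) q.1 q.2 := fun j hj q => by
    simp [hh, hj]
  have hbd : ∀ j, IsBdd T K B (h j) := by
    intro j
    by_cases hj : j ∈ J
    · have he : h j = fun q => (W q : ℂ) * schrodinger (f j) q.1 q.2 := funext (hhJ j hj)
      rw [he]
      refine ⟨(Complex.measurable_ofReal.comp hW.meas).mul
        (continuous_schrodinger (hf j hj).ft).measurable, fun q => ?_, hW.finT, hW.finK,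
        fun t x ht => by simp [hW.zeroT t x ht], fun t x hx => by simp [hW.zeroK t x hx]⟩
      rw [norm_mul, Complex.norm_real]
      refine mul_le_mul (hW.bdd q) ((norm_schrodinger_le _ _ _).trans ?_) (norm_nonneg _) hM
      exact Finset.single_le_sum (f := fun j => κ * ∫ ξ, ‖FT (f j) ξ‖) (fun i _ => hnn i) hj
    · have he : h j = fun _ => 0 := by funext q; simp [hh, hj]
      rw [he]
      exact ⟨measurable_const, fun q => by
        rw [norm_zero]; exact mul_nonneg hM (Finset.sum_nonneg fun i _ => hnn i), hW.finT, hW.finK,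
        fun _ _ _ => rfl, fun _ _ _ => rfl⟩
  have hWC : IsBdd T K M fun q => (W q : ℂ) :=
    ⟨Complex.measurable_ofReal.comp hW.meas, fun q => by simpa using hW.bdd q, hW.finT, hW.finK,
      fun t x ht => by simp [hW.zeroT t x ht], fun t x hx => by simp [hW.zeroK t x hx]⟩
  have hF : ∀ j, IsBdd T K (M * B) fun q => (W q : ℂ) * h j q := fun j => hWC.mul (hbd j)
  have hgram : ∀ j ∈ J, ∀ i ∈ J, gram h j i =
      κ • ∫ ξ, (starRingEnd ℂ) (FT (f i) ξ) * retFT (fun q => (W q : ℂ) * h j q) ξ := by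
    intro j hj i hi
    rw [hκ, ← integral_conj_schrodinger_mul (hf i hi).int (hf i hi).ft (hF j), gram]
    refine integral_congr_ae (Filter.Eventually.of_forall fun q => ?_)
    simp only [hhJ i hi, map_mul, Complex.conj_ofReal]
    ring
  set H := ∑ i ∈ J, ∑ j ∈ J, ‖gram h i j‖ ^ 2 with hH
  set X := ∑ j ∈ J, ∫ q, ‖h j q‖ ^ 2 with hX
  set R := C * ((ENNReal.ofReal H) ^ (μ / 2) * (V * (ENNReal.ofReal X) ^ (1 - μ))) with hR
  have hRt : R ≠ ∞ := by
    refine ENNReal.mul_ne_top hC (ENNReal.mul_ne_top ?_ (ENNReal.mul_ne_top hV ?_))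
    · exact ENNReal.rpow_ne_top_of_nonneg (by linarith) ENNReal.ofReal_ne_top
    · exact ENNReal.rpow_ne_top_of_nonneg (by linarith) ENNReal.ofReal_ne_top
  have hS : ∀ ε, 0 < ε → ∑ j ∈ J, ∫ ξ, Real.exp (-ε * ‖ξ‖ ^ 2) *
      ‖retFT (fun q => (W q : ℂ) * h j q) ξ‖ ^ 2 ≤ R.toReal := fun ε hε => by
    rw [← ENNReal.ofReal_le_iff_le_toReal hRt]
    have := hCb J T K B M δ ε W h hδ hε hW hWδ hbd
    rwa [lintegral_hsSq J hbd, lintegral_mass J hbd] at this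
  have hB := sum_normSq_integral_FT_le_of_forall J hf ho (fun j => (hF j).measurable_retFT)
    (fun j ξ => (hF j).norm_retFT_le ξ) hS
  have hHle : H ≤ κ * R.toReal := by
    have : H = κ ^ 2 * ∑ j ∈ J, ∑ i ∈ J, ‖∫ ξ, (starRingEnd ℂ) (FT (f i) ξ) *
        retFT (fun q => (W q : ℂ) * h j q) ξ‖ ^ 2 := by
      rw [hH, Finset.mul_sum]
      refine Finset.sum_congr rfl fun j hj => ?_
      rw [Finset.mul_sum]
      refine Finset.sum_congr rfl fun i hi => ?_
      rw [hgram j hj i hi, norm_smul, Real.norm_of_nonneg hκ0.le, mul_pow]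
    rw [this]
    calc _ ≤ κ ^ 2 * ((2 * π) ^ n * R.toReal) := by gcongr
      _ = κ * (κ * (2 * π) ^ n) * R.toReal := by ring
      _ = _ := by rw [hκn, mul_one]
  have h1 : ENNReal.ofReal H ≤ (ENNReal.ofReal κ * C) *
      ((ENNReal.ofReal H) ^ (μ / 2) * (V * (ENNReal.ofReal X) ^ (1 - μ))) := by
    rw [mul_assoc, ← hR, ← ENNReal.ofReal_toReal hRt, ← ENNReal.ofReal_mul hκ0.le]
    exact ENNReal.ofReal_le_ofReal hHle
  have hX0 : 0 ≤ X := Finset.sum_nonneg fun j _ => integral_nonneg fun q => by positivity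
  have h2 : (ENNReal.ofReal X) ^ 2 ≤ (J.card : ℝ≥0∞) * ENNReal.ofReal H := by
    have : X ^ 2 ≤ J.card * H := by
      have e1 : ∀ j, (∫ q, ‖h j q‖ ^ 2) ^ 2 = ‖gram h j j‖ ^ 2 := fun j => by
        rw [gram_self, Complex.norm_real, Real.norm_eq_abs, sq_abs]
      refine sq_sum_le_card_mul_sum_sq.trans (mul_le_mul_of_nonneg_left ?_ (Nat.cast_nonneg _))
      refine Finset.sum_le_sum fun j hj => ?_
      rw [e1]
      exact Finset.single_le_sum (f := fun i => ‖gram h j i‖ ^ 2) (fun i _ => by positivity) hj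
    rw [← ENNReal.ofReal_pow hX0, ← ENNReal.ofReal_natCast, ← ENNReal.ofReal_mul (Nat.cast_nonneg _)]
    exact ENNReal.ofReal_le_ofReal this
  have h3 := le_of_self_improving (by linarith) ENNReal.ofReal_ne_top (ENNReal.natCast_ne_top _)
    h1 h2
  refine le_trans (le_of_eq ?_) h3
  have e2 : ∀ q : ℝ × Rn n, W q ^ 2 * ∑ j ∈ J, ‖schrodinger (f j) q.1 q.2‖ ^ 2 =
      ∑ j ∈ J, ‖h j q‖ ^ 2 := fun q => by
    rw [Finset.mul_sum]
    refine Finset.sum_congr rfl fun j hj => ?_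
    rw [hhJ j hj, norm_mul, mul_pow, Complex.norm_real, Real.norm_eq_abs, sq_abs]
  simp only [e2]
  rw [← ofReal_integral_eq_lintegral_ofReal
    (integrable_finsetSum _ fun j _ => (hbd j).normSq)
    (Filter.Eventually.of_forall fun q => Finset.sum_nonneg fun j _ => by positivity),
    integral_finsetSum _ fun j _ => (hbd j).normSq]

lemma lintegral_rpow_Ioo_ne_top {r : ℝ} (hr : -1 < r) :
    ∫⁻ τ in Ioo (0 : ℝ) 1, ENNReal.ofReal (τ ^ r) ≠ ∞ := by
  have h := (intervalIntegral.intervalIntegrable_rpow' (a := 0) (b := 1) hr).1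
  have h1 : IntegrableOn (fun τ : ℝ => τ ^ r) (Ioo 0 1) := h.mono_set Ioo_subset_Ioc_self
  exact h1.lintegral_lt_top.ne

lemma ofReal_eq_lintegral_indicator (r : ℝ) :
    ENNReal.ofReal r = ∫⁻ τ in Ioi (0 : ℝ), (Iio r).indicator (fun _ => 1) τ := by
  rw [lintegral_indicator measurableSet_Iio, lintegral_one, Measure.restrict_restrict
    measurableSet_Iio, Measure.restrict_apply_univ, Iio_inter_Ioi, Real.volume_Ioo, sub_zero]

/-- A restricted estimate with growth `|J|^s` implies a weighted estimate with weights in `ℓ^α`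
when `s < 1/α`. -/
lemma sum_mul_le_of_restricted {ι : Type*} {α s : ℝ} (hα : 0 < α) (hs : 0 ≤ s) {J : Finset ι}
    {x : ι → ℝ≥0∞} {D : ℝ≥0∞} (hx : ∀ I ⊆ J, ∑ j ∈ I, x j ≤ D * (I.card : ℝ≥0∞) ^ s)
    {lam : ι → ℝ} (hl : ∀ j, 0 ≤ lam j) {L : ℝ} (hL : 0 < L)
    (hlL : ∑ j ∈ J, lam j ^ α ≤ L ^ α) :
    ∑ j ∈ J, ENNReal.ofReal (lam j) * x j ≤
      (∫⁻ τ in Ioo (0 : ℝ) 1, ENNReal.ofReal (τ ^ (-(α * s)))) * (ENNReal.ofReal L * D) := by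
  classical
  set r : ι → ℝ := fun j => lam j / L with hr
  have hr0 : ∀ j, 0 ≤ r j := fun j => div_nonneg (hl j) hL.le
  have hrs : ∑ j ∈ J, r j ^ α ≤ 1 := by
    simp only [hr, Real.div_rpow (hl _) hL.le, ← Finset.sum_div]
    exact (div_le_one (by positivity)).2 hlL
  have hr1 : ∀ j ∈ J, r j ≤ 1 := fun j hj => by
    by_contra! h
    have h1 : 1 < r j ^ α := Real.one_lt_rpow h hα
    have := Finset.single_le_sum (f := fun j => r j ^ α)
      (fun i _ => Real.rpow_nonneg (hr0 i) α) hj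
    linarith
  have hcard : ∀ τ : ℝ, 0 < τ → ((J.filter fun j => τ < r j).card : ℝ) ≤ τ ^ (-α) := fun τ hτ => by
    have h1 : ((J.filter fun j => τ < r j).card : ℝ) * τ ^ α ≤ 1 := by
      calc _ = ∑ j ∈ J.filter fun j => τ < r j, τ ^ α := by rw [Finset.sum_const, nsmul_eq_mul]
        _ ≤ ∑ j ∈ J.filter fun j => τ < r j, r j ^ α :=
            Finset.sum_le_sum fun j hj => Real.rpow_le_rpow hτ.le (Finset.mem_filter.1 hj).2.le hα.le
        _ ≤ ∑ j ∈ J, r j ^ α := Finset.sum_le_sum_of_subset_of_nonneg (Finset.filter_subset _ _)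
            fun i _ _ => Real.rpow_nonneg (hr0 i) α
        _ ≤ 1 := hrs
    rw [Real.rpow_neg hτ.le, ← one_div]
    exact (le_div_iff₀ (by positivity)).2 h1
  have hpt : ∀ τ ∈ Ioi (0 : ℝ), ∑ j ∈ J, (Iio (r j)).indicator (fun _ => 1) τ * x j ≤
      (Ioo (0 : ℝ) 1).indicator (fun τ => ENNReal.ofReal (τ ^ (-(α * s))) * D) τ := by
    intro τ hτ
    have hτ0 : 0 < τ := hτ
    have e : ∑ j ∈ J, (Iio (r j)).indicator (fun _ => (1 : ℝ≥0∞)) τ * x j =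
        ∑ j ∈ J.filter fun j => τ < r j, x j := by
      rw [Finset.sum_filter]
      refine Finset.sum_congr rfl fun j _ => ?_
      by_cases h : τ < r j <;> simp [h]
    rw [e]
    by_cases h1 : τ < 1
    · rw [indicator_of_mem (show τ ∈ Ioo (0 : ℝ) 1 from ⟨hτ0, h1⟩), mul_comm]
      refine (hx _ (Finset.filter_subset _ _)).trans (mul_le_mul_right ?_ _)
      rw [← ENNReal.ofReal_natCast, ENNReal.ofReal_rpow_of_nonneg (Nat.cast_nonneg _) hs]
      refine ENNReal.ofReal_le_ofReal ((Real.rpow_le_rpow (Nat.cast_nonneg _) (hcard τ hτ0) hs).trans_eq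
        ?_)
      rw [← Real.rpow_mul hτ0.le, neg_mul]
    · have : (J.filter fun j => τ < r j) = ∅ := by
        refine Finset.filter_eq_empty_iff.2 fun j hj h => h1 (h.trans_le (hr1 j hj))
      rw [this, Finset.sum_empty]
      exact zero_le
  have h1 : ∑ j ∈ J, ENNReal.ofReal (r j) * x j ≤
      (∫⁻ τ in Ioo (0 : ℝ) 1, ENNReal.ofReal (τ ^ (-(α * s)))) * D := by
    have hm : ∀ j, Measurable fun τ => (Iio (r j)).indicator (fun _ => (1 : ℝ≥0∞)) τ := fun j =>
      measurable_const.indicator measurableSet_Iio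
    calc ∑ j ∈ J, ENNReal.ofReal (r j) * x j
        = ∫⁻ τ in Ioi (0 : ℝ), ∑ j ∈ J, (Iio (r j)).indicator (fun _ => 1) τ * x j := by
          rw [lintegral_finsetSum _ fun j _ => (hm j).mul_const _]
          refine Finset.sum_congr rfl fun j _ => ?_
          rw [lintegral_mul_const _ (hm j), ← ofReal_eq_lintegral_indicator]
      _ ≤ ∫⁻ τ in Ioi (0 : ℝ),
          (Ioo (0 : ℝ) 1).indicator (fun τ => ENNReal.ofReal (τ ^ (-(α * s))) * D) τ :=
          setLIntegral_mono' measurableSet_Ioi hpt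
      _ = _ := by
          rw [lintegral_indicator measurableSet_Ioo, Measure.restrict_restrict measurableSet_Ioo,
            Ioo_inter_Ioi, max_self, lintegral_mul_const _ (by fun_prop)]
  calc ∑ j ∈ J, ENNReal.ofReal (lam j) * x j
      = ENNReal.ofReal L * ∑ j ∈ J, ENNReal.ofReal (r j) * x j := by
        rw [Finset.mul_sum]
        refine Finset.sum_congr rfl fun j _ => ?_
        rw [← mul_assoc, ← ENNReal.ofReal_mul hL.le, hr, mul_div_cancel₀ _ hL.ne']
    _ ≤ ENNReal.ofReal L * _ := mul_le_mul_right h1 _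
    _ = _ := by ring

/-- Weighted orthonormal Strichartz estimate for finite systems, tested against a weight `W²`. -/
lemma exists_lintegral_weight_mul_density_le {n : ℕ} {θ b α : ℝ} (hθb : 2 * (1 - b) ≤ θ)
    (hθ1 : θ < 1) (hb : b = n * θ / 2) (hb0 : 0 < b) (hα : 1 ≤ α) (hαb : α < 1 / b) :
    ∃ C : ℝ≥0∞, C ≠ ∞ ∧ ∀ (J : Finset ℕ) (T : Set ℝ) (K : Set (Rn n)) (M δ : ℝ)
      (W : ℝ × Rn n → ℝ) (f : ℕ → Rn n → ℂ) (lam : ℕ → ℝ) (L : ℝ), 0 < δ → IsBdd T K M W →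
      (∀ q, W q = 0 ∨ δ ≤ W q) → (∀ j ∈ J, IsNice (f j)) →
      (∀ i ∈ J, ∀ k ∈ J, ∫ x, f i x * (starRingEnd ℂ) (f k x) = if i = k then 1 else 0) →
      (∀ j, 0 ≤ lam j) → 0 < L → ∑ j ∈ J, lam j ^ α ≤ L ^ α →
      (∫⁻ t, ENNReal.ofReal ((∫ x, W (t, x) ^ (2 / θ)) ^ θ) ^ (1 / (1 - b))) ^ (1 - b) ≠ ∞ →
      ∫⁻ q : ℝ × Rn n, ENNReal.ofReal
          (W q ^ 2 * ∑ j ∈ J, lam j * ‖schrodinger (f j) q.1 q.2‖ ^ 2) ≤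
        C * ENNReal.ofReal L *
        (∫⁻ t, ENNReal.ofReal ((∫ x, W (t, x) ^ (2 / θ)) ^ θ) ^ (1 / (1 - b))) ^ (1 - b) := by
  have hα0 : 0 < α := by linarith
  have hbα : b < 1 / α := by
    rw [lt_div_iff₀ hα0]; rw [lt_div_iff₀ hb0] at hαb; linarith
  have hα1 : 1 / α ≤ 1 := by rw [div_le_one hα0]; exact hα
  set s := (b + 1 / α) / 2 with hs
  have hsα : α * s < 1 := by
    have : s < 1 / α := by rw [hs]; linarith
    rw [lt_div_iff₀ hα0] at this; linarith
  obtain ⟨C, hC, hCb⟩ := exists_lintegral_weight_mul_sum_le (n := n) (θ := θ) (μ := 2 - 2 * s)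
    (b := b) (by linarith) (by linarith) hθ1 hb hb0 (by linarith)
  refine ⟨(∫⁻ τ in Ioo (0 : ℝ) 1, ENNReal.ofReal (τ ^ (-(α * s)))) * C,
    ENNReal.mul_ne_top (lintegral_rpow_Ioo_ne_top (by linarith)) hC, ?_⟩
  intro J T K M δ W f lam L hδ hW hWδ hf ho hl hL hlL hV
  set V := (∫⁻ t, ENNReal.ofReal ((∫ x, W (t, x) ^ (2 / θ)) ^ θ) ^ (1 / (1 - b))) ^ (1 - b) with hVd
  set x : ℕ → ℝ≥0∞ := fun j =>
    ∫⁻ q : ℝ × Rn n, ENNReal.ofReal (W q ^ 2 * ‖schrodinger (f j) q.1 q.2‖ ^ 2) with hxd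
  have hm : ∀ j ∈ J, Measurable fun q : ℝ × Rn n =>
      ENNReal.ofReal (W q ^ 2 * ‖schrodinger (f j) q.1 q.2‖ ^ 2) := fun j hj =>
    ((hW.meas.pow_const 2).mul
      ((continuous_schrodinger (hf j hj).ft).measurable.norm.pow_const 2)).ennreal_ofReal
  have hx : ∀ I ⊆ J, ∑ j ∈ I, x j ≤ (C * V) * (I.card : ℝ≥0∞) ^ s := fun I hI => by
    have h := hCb I T K M δ W f hδ hW hWδ (fun j hj => hf j (hI hj))
      (fun i hi k hk => ho i (hI hi) k (hI hk)) hV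
    rw [show 1 - (2 - 2 * s) / 2 = s by ring, ← hVd] at h
    refine le_trans (le_of_eq ?_) (h.trans_eq (by ring))
    rw [← lintegral_finsetSum' _ fun j hj => (hm j (hI hj)).aemeasurable]
    refine lintegral_congr fun q => ?_
    rw [Finset.mul_sum, ENNReal.ofReal_sum_of_nonneg fun j _ => by positivity]
  have h := sum_mul_le_of_restricted hα0 (by rw [hs]; positivity) hx hl hL hlL
  refine le_trans (le_of_eq ?_) (h.trans_eq (by ring))
  have e : ∀ q : ℝ × Rn n, ENNReal.ofReal
      (W q ^ 2 * ∑ j ∈ J, lam j * ‖schrodinger (f j) q.1 q.2‖ ^ 2) =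
      ∑ j ∈ J, ENNReal.ofReal (lam j) *
        ENNReal.ofReal (W q ^ 2 * ‖schrodinger (f j) q.1 q.2‖ ^ 2) := fun q => by
    rw [Finset.mul_sum, ENNReal.ofReal_sum_of_nonneg fun j _ => by have := hl j; positivity]
    refine Finset.sum_congr rfl fun j _ => ?_
    rw [← ENNReal.ofReal_mul (hl j)]
    congr 1; ring
  simp only [e]
  rw [lintegral_finsetSum' _ fun j hj => ((hm j hj).const_mul _).aemeasurable]
  refine Finset.sum_congr rfl fun j hj => ?_
  rw [lintegral_const_mul _ (hm j hj)]

lemma le_rpow_of_le_mul_rpow {Q A : ℝ≥0∞} {b : ℝ} (hb : 0 < b) (hb1 : b < 1) (hQ : Q ≠ ∞)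
    (h : Q ≤ A * Q ^ (1 - b)) : Q ≤ A ^ (1 / b) := by
  rcases eq_or_ne Q 0 with h0 | h0
  · rw [h0]; exact zero_le
  have h1 : Q ^ b ≤ A := by
    have h2 : Q ^ (1 - b) ≠ 0 := by simp [ENNReal.rpow_eq_zero_iff, h0, hQ]
    have h3 : Q ^ (1 - b) ≠ ∞ := ENNReal.rpow_ne_top_of_nonneg (by linarith) hQ
    rw [← ENNReal.mul_le_mul_iff_left h2 h3, ← ENNReal.rpow_add _ _ h0 hQ]
    simpa using h
  calc Q = (Q ^ b) ^ (1 / b) := by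
        rw [← ENNReal.rpow_mul, mul_one_div_cancel hb.ne', ENNReal.rpow_one]
    _ ≤ _ := ENNReal.rpow_le_rpow h1 (by positivity)

/-- The extremal weight for the duality of `L^q L^p`. -/
lemma lintegral_rpow_le_of_weights {n : ℕ} {θ b : ℝ} (hθ : 0 < θ) (hθ1 : θ < 1) (hb : 1 - θ ≤ b)
    (hb1 : b < 1) {T : Set ℝ} {K : Set (Rn n)} {M δ : ℝ} (hδ : 0 < δ) {ρ U : ℝ × Rn n → ℝ}
    (hρ : IsBdd T K M ρ) (hρδ : ∀ q, ρ q = 0 ∨ δ ≤ ρ q) (hρU : ∀ q, ρ q ≤ U q) {A : ℝ≥0∞}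
    (hA : ∀ (W : ℝ × Rn n → ℝ) (M' δ' : ℝ), 0 < δ' → IsBdd T K M' W →
      (∀ q, W q = 0 ∨ δ' ≤ W q) →
      (∫⁻ t, ENNReal.ofReal ((∫ x, W (t, x) ^ (2 / θ)) ^ θ) ^ (1 / (1 - b))) ^ (1 - b) ≠ ∞ →
      ∫⁻ q, ENNReal.ofReal (W q ^ 2 * U q) ≤ A *
        (∫⁻ t, ENNReal.ofReal ((∫ x, W (t, x) ^ (2 / θ)) ^ θ) ^ (1 / (1 - b))) ^ (1 - b)) :
    ∫⁻ t, {t | δ ≤ ∫ x, ρ (t, x) ^ (1 / (1 - θ))}.indicator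
      (fun t => ENNReal.ofReal ((∫ x, ρ (t, x) ^ (1 / (1 - θ))) ^ ((1 - θ) / b))) t ≤
      A ^ (1 / b) := by
  have hb0 : 0 < b := by linarith
  set p := 1 / (1 - θ) with hp
  have h1θ : 0 < 1 - θ := by linarith
  have hp1 : 1 < p := by rw [hp, lt_div_iff₀ h1θ]; linarith
  have hpθ : p - 1 = θ * p := by rw [hp]; field_simp; ring
  set r := (1 - θ) / b with hr
  have hr0 : 0 < r := by positivity
  have hr1 : r ≤ 1 := (div_le_one hb0).2 hb
  have hρ0 : ∀ q, 0 ≤ ρ q := fun q => (hρδ q).elim (fun h => h.ge) fun h => hδ.le.trans h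
  have hρM : ∀ q, ρ q ≤ M := fun q => (Real.le_norm_self _).trans (hρ.bdd q)
  have hM := hρ.nonneg
  set I : ℝ → ℝ := fun t => ∫ x, ρ (t, x) ^ p with hI
  have hIm : Measurable I := by
    have : StronglyMeasurable fun q : ℝ × Rn n => ρ q ^ p := (hρ.meas.pow_const _).stronglyMeasurable
    exact this.integral_prod_right'.measurable
  have hpb : ∀ q, ‖ρ q ^ p‖ ≤ M ^ p := fun q => by
    rw [Real.norm_of_nonneg (Real.rpow_nonneg (hρ0 q) _)]
    exact Real.rpow_le_rpow (hρ0 q) (hρM q) (by linarith)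
  have hpK : ∀ t x, x ∉ K → ρ (t, x) ^ p = 0 := fun t x hx => by
    rw [hρ.zeroK t x hx, Real.zero_rpow (by linarith)]
  have hpi : ∀ t, Integrable fun x => ρ (t, x) ^ p := fun t =>
    integrable_of_bounded_support ((hρ.section_meas t).pow_const p).aestronglyMeasurable hρ.finK
      (fun x => hpb _) (hpK t)
  have hI0 : ∀ t, 0 ≤ I t := fun t => integral_nonneg fun x => Real.rpow_nonneg (hρ0 _) _
  set Y := M ^ p * (volume K).toReal + 1 with hY
  have hY0 : 0 < Y := by positivity
  have hIY : ∀ t, I t ≤ Y := fun t => by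
    have h1 : ‖∫ x in K, ρ (t, x) ^ p‖ ≤ M ^ p * volume.real K :=
      norm_setIntegral_le_of_norm_le_const hρ.finK fun x _ => hpb _
    rw [setIntegral_eq_integral_of_forall_compl_eq_zero (hpK t)] at h1
    rw [hY]
    exact (Real.le_norm_self _).trans (h1.trans (by rw [measureReal_def]; linarith))
  have hIT : ∀ t, t ∉ T → I t = 0 := fun t ht => by
    simp only [hI, hρ.zeroT t _ ht, Real.zero_rpow (by linarith : p ≠ 0), integral_zero]
  set E : Set ℝ := {t | δ ≤ I t} with hE
  have hEm : MeasurableSet E := measurableSet_le measurable_const hIm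
  set Q := ∫⁻ t, E.indicator (fun t => ENNReal.ofReal (I t ^ r)) t with hQ
  have hQt : Q ≠ ∞ := by
    have hET : E ⊆ toMeasurable volume T := fun t ht => by
      refine subset_toMeasurable _ _ ?_
      by_contra h
      have : δ ≤ I t := ht
      rw [hIT t h] at this; linarith
    refine ne_top_of_le_ne_top ?_ (lintegral_mono (g := (toMeasurable volume T).indicator
      fun _ => ENNReal.ofReal (Y ^ r)) fun t => ?_)
    · rw [lintegral_indicator (measurableSet_toMeasurable _ _), setLIntegral_const,
        measure_toMeasurable]
      exact ENNReal.mul_ne_top ENNReal.ofReal_ne_top hρ.finT.ne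
    · refine (indicator_le_indicator (s := E) (a := t) (f := fun t => ENNReal.ofReal (I t ^ r))
        (g := fun _ => ENNReal.ofReal (Y ^ r)) (ENNReal.ofReal_le_ofReal
        (Real.rpow_le_rpow (hI0 t) (hIY t) hr0.le))).trans ?_
      exact indicator_le_indicator_of_subset hET (fun _ => zero_le) t
  set W : ℝ × Rn n → ℝ := fun q =>
    if δ ≤ I q.1 then (ρ q ^ (p - 1) * I q.1 ^ (r - 1)) ^ (1 / 2 : ℝ) else 0 with hW
  have hWm : Measurable W := by
    refine Measurable.ite (measurableSet_le measurable_const (hIm.comp measurable_fst)) ?_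
      measurable_const
    exact ((hρ.meas.pow_const _).mul ((hIm.comp measurable_fst).pow_const _)).pow_const _
  have hWn : ∀ q, 0 ≤ ρ q ^ (p - 1) * I q.1 ^ (r - 1) := fun q =>
    mul_nonneg (Real.rpow_nonneg (hρ0 q) _) (Real.rpow_nonneg (hI0 _) _)
  have hWz : ∀ q, ρ q = 0 → W q = 0 := fun q hq => by
    simp only [hW, hq, Real.zero_rpow (by linarith : p - 1 ≠ 0), zero_mul]
    rw [Real.zero_rpow (by norm_num), ite_self]
  have hWb : IsBdd T K ((M ^ (p - 1) * δ ^ (r - 1)) ^ (1 / 2 : ℝ)) W := by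
    refine ⟨hWm, fun q => ?_, hρ.finT, hρ.finK, fun t x ht => hWz _ (hρ.zeroT t x ht),
      fun t x hx => hWz _ (hρ.zeroK t x hx)⟩
    by_cases h : δ ≤ I q.1
    · simp only [hW, if_pos h]
      rw [Real.norm_of_nonneg (Real.rpow_nonneg (hWn q) _)]
      refine Real.rpow_le_rpow (hWn q) ?_ (by norm_num)
      exact mul_le_mul (Real.rpow_le_rpow (hρ0 q) (hρM q) (by linarith))
        (Real.rpow_le_rpow_of_nonpos hδ h (by linarith)) (Real.rpow_nonneg (hI0 _) _)
        (Real.rpow_nonneg hM _)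
    · simp only [hW, if_neg h, norm_zero]
      positivity
  have hWδ : ∀ q, W q = 0 ∨ (δ ^ (p - 1) * Y ^ (r - 1)) ^ (1 / 2 : ℝ) ≤ W q := fun q => by
    by_cases h : δ ≤ I q.1
    · rcases hρδ q with h1 | h1
      · exact Or.inl (hWz q h1)
      · right
        simp only [hW, if_pos h]
        refine Real.rpow_le_rpow (by positivity) ?_ (by norm_num)
        exact mul_le_mul (Real.rpow_le_rpow hδ.le h1 (by linarith))
          (Real.rpow_le_rpow_of_nonpos (hδ.trans_le h) (hIY _) (by linarith)) (by positivity)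
          (Real.rpow_nonneg (hρ0 q) _)
    · exact Or.inl (by simp only [hW, if_neg h])
  have hV : ∫⁻ t, ENNReal.ofReal ((∫ x, W (t, x) ^ (2 / θ)) ^ θ) ^ (1 / (1 - b)) = Q := by
    refine lintegral_congr fun t => ?_
    by_cases h : δ ≤ I t
    · have hIt : 0 < I t := hδ.trans_le h
      rw [indicator_of_mem (show t ∈ E from h)]
      have e : ∀ x, W (t, x) ^ (2 / θ) = ρ (t, x) ^ p * I t ^ ((r - 1) / θ) := fun x => by
        simp only [hW, if_pos h]
        rw [← Real.rpow_mul (hWn _), Real.mul_rpow (Real.rpow_nonneg (hρ0 _) _)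
          (Real.rpow_nonneg (hI0 _) _), ← Real.rpow_mul (hρ0 _), ← Real.rpow_mul (hI0 _), hpθ]
        congr 2
        · field_simp
        · field_simp
      simp only [e]
      rw [integral_mul_const, ENNReal.ofReal_rpow_of_nonneg
        (Real.rpow_nonneg (mul_nonneg (hI0 t) (Real.rpow_nonneg (hI0 t) _)) _)
        (by rw [one_div, inv_nonneg]; linarith)]
      congr 1
      change ((I t * I t ^ ((r - 1) / θ)) ^ θ) ^ (1 / (1 - b)) = I t ^ r
      rw [← Real.rpow_one_add' (hI0 t), ← Real.rpow_mul (hI0 t), ← Real.rpow_mul (hI0 t)]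
      · congr 1
        have hb1' : 1 - b ≠ 0 := by linarith
        have h2 : r * b = 1 - θ := by rw [hr]; field_simp
        field_simp
        linarith
      · intro h0
        have h2 : r * b = 1 - θ := by rw [hr]; field_simp
        have h3 : θ + (r - 1) = 0 := by field_simp at h0; linarith
        nlinarith
    · rw [indicator_of_notMem (show t ∉ E from h)]
      simp only [hW, if_neg h]
      rw [Real.zero_rpow (by positivity), integral_zero, Real.zero_rpow hθ.ne', ENNReal.ofReal_zero,
        ENNReal.zero_rpow_of_pos (by rw [one_div, inv_pos]; linarith)]
  have hVt : Q ^ (1 - b) ≠ ∞ := ENNReal.rpow_ne_top_of_nonneg (by linarith) hQt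
  have hmain := hA W _ ((δ ^ (p - 1) * Y ^ (r - 1)) ^ (1 / 2 : ℝ)) (by positivity) hWb hWδ
    (by rw [hV]; exact hVt)
  rw [hV] at hmain
  refine le_rpow_of_le_mul_rpow hb0 hb1 hQt (le_trans ?_ hmain)
  calc Q = ∫⁻ t, ∫⁻ x, ENNReal.ofReal (W (t, x) ^ 2 * ρ (t, x)) := by
        refine lintegral_congr fun t => ?_
        by_cases h : δ ≤ I t
        · have hIt : 0 < I t := hδ.trans_le h
          rw [indicator_of_mem (show t ∈ E from h)]
          have e : ∀ x, W (t, x) ^ 2 * ρ (t, x) = ρ (t, x) ^ p * I t ^ (r - 1) := fun x => by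
            simp only [hW, if_pos h]
            rw [← Real.rpow_natCast, ← Real.rpow_mul (hWn _)]
            norm_num
            rcases (hρ0 (t, x)).eq_or_lt with h0 | h0
            · simp [← h0, Real.zero_rpow (by linarith : p ≠ 0),
                Real.zero_rpow (by linarith : p - 1 ≠ 0)]
            · rw [mul_right_comm, ← Real.rpow_add_one h0.ne']; simp
          simp only [e]
          rw [← ofReal_integral_eq_lintegral_ofReal ((hpi t).mul_const _)
            (Filter.Eventually.of_forall fun x => mul_nonneg (Real.rpow_nonneg (hρ0 _) _)
              (Real.rpow_nonneg (hI0 _) _)), integral_mul_const]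
          congr 1
          change I t ^ r = I t * I t ^ (r - 1)
          rw [← Real.rpow_one_add' (hI0 t) (by linarith)]
          congr 1; ring
        · rw [indicator_of_notMem (show t ∉ E from h)]
          simp [hW, if_neg h]
    _ = ∫⁻ q, ENNReal.ofReal (W q ^ 2 * ρ q) := by
        rw [Measure.volume_eq_prod, lintegral_prod]
        exact ((hWm.pow_const 2).mul hρ.meas).ennreal_ofReal.aemeasurable
    _ ≤ _ := lintegral_mono fun q => ENNReal.ofReal_le_ofReal
        (mul_le_mul_of_nonneg_left (hρU q) (sq_nonneg _))

open Filter Topology in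
/-- Passing to the limit in truncated mixed norm bounds. -/
lemma lintegral_rpow_le_of_truncations {n : ℕ} {p r : ℝ} (hp : 0 < p) (hr : 0 < r)
    {ρ : ℕ → ℝ × Rn n → ℝ} {U : ℝ × Rn n → ℝ≥0∞} (hm : ∀ N, Measurable (ρ N))
    (h0 : ∀ N q, 0 ≤ ρ N q) (hmono : ∀ q, Monotone fun N => ρ N q)
    (hlim : ∀ q, Tendsto (fun N => ENNReal.ofReal (ρ N q)) atTop (𝓝 (U q)))
    (hInt : ∀ N t, Integrable fun x => ρ N (t, x) ^ p) {δ : ℕ → ℝ}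
    (hδ : Tendsto δ atTop (𝓝 0)) {D : ℝ≥0∞}
    (h : ∀ N, ∫⁻ t, {t | δ N ≤ ∫ x, ρ N (t, x) ^ p}.indicator
      (fun t => ENNReal.ofReal ((∫ x, ρ N (t, x) ^ p) ^ r)) t ≤ D) :
    ∫⁻ t, (∫⁻ x, U (t, x) ^ p) ^ r ≤ D := by
  set I : ℕ → ℝ → ℝ := fun N t => ∫ x, ρ N (t, x) ^ p with hI
  have hI0 : ∀ N t, 0 ≤ I N t := fun N t => integral_nonneg fun x => Real.rpow_nonneg (h0 N _) _
  have hIm : ∀ N, Measurable (I N) := fun N => by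
    have : StronglyMeasurable fun q : ℝ × Rn n => ρ N q ^ p :=
      ((hm N).pow_const _).stronglyMeasurable
    exact this.integral_prod_right'.measurable
  have hIl : ∀ t, Tendsto (fun N => ENNReal.ofReal (I N t)) atTop (𝓝 (∫⁻ x, U (t, x) ^ p)) := by
    intro t
    have e : ∀ N, ENNReal.ofReal (I N t) = ∫⁻ x, ENNReal.ofReal (ρ N (t, x)) ^ p := fun N => by
      rw [hI]
      simp only
      rw [ofReal_integral_eq_lintegral_ofReal (hInt N t)
        (Eventually.of_forall fun x => Real.rpow_nonneg (h0 N _) _)]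
      exact lintegral_congr fun x => (ENNReal.ofReal_rpow_of_nonneg (h0 N _) hp.le).symm
    simp only [e]
    refine lintegral_tendsto_of_tendsto_of_monotone (fun N => ?_) ?_ ?_
    · exact (((hm N).comp measurable_prodMk_left).ennreal_ofReal.pow_const p).aemeasurable
    · exact Eventually.of_forall fun x N N' hN => ENNReal.rpow_le_rpow
        (ENNReal.ofReal_le_ofReal (hmono (t, x) hN)) hp.le
    · exact Eventually.of_forall fun x => (ENNReal.continuous_rpow_const.tendsto _).comp (hlim (t, x))
  set G : ℕ → ℝ → ℝ≥0∞ := fun N t => {t | δ N ≤ I N t}.indicator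
      (fun t => ENNReal.ofReal (I N t ^ r)) t with hG
  have hGm : ∀ N, Measurable (G N) := fun N =>
    ((hIm N).pow_const r).ennreal_ofReal.indicator (measurableSet_le measurable_const (hIm N))
  have hpt : ∀ t, (∫⁻ x, U (t, x) ^ p) ^ r ≤ liminf (fun N => G N t) atTop := by
    intro t
    rcases eq_or_ne (∫⁻ x, U (t, x) ^ p) 0 with hz | hz
    · rw [hz, ENNReal.zero_rpow_of_pos hr]; exact zero_le
    · obtain ⟨c, hc0, hc⟩ := ENNReal.lt_iff_exists_nnreal_btwn.1 (pos_iff_ne_zero.2 hz)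
      have hc0' : (0 : ℝ) < c := by exact_mod_cast hc0
      have h1 : ∀ᶠ N in atTop, (c : ℝ≥0∞) < ENNReal.ofReal (I N t) := (hIl t).eventually_const_lt hc
      have h2 : ∀ᶠ N in atTop, δ N < c := hδ.eventually_lt_const hc0'
      have h3 : ∀ᶠ N in atTop, ENNReal.ofReal (I N t) ^ r = G N t := by
        filter_upwards [h1, h2] with N h1 h2
        have h4 : (c : ℝ) < I N t := by
          rwa [ENNReal.lt_ofReal_iff_toReal_lt (by simp)] at h1
        rw [hG]
        simp only
        rw [indicator_of_mem (show t ∈ {t | δ N ≤ I N t} from (h2.trans h4).le),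
          ENNReal.ofReal_rpow_of_nonneg (hI0 N t) hr.le]
      exact (((ENNReal.continuous_rpow_const.tendsto _).comp (hIl t)).congr' h3).liminf_eq.ge
  calc _ ≤ ∫⁻ t, liminf (fun N => G N t) atTop := lintegral_mono hpt
    _ ≤ liminf (fun N => ∫⁻ t, G N t) atTop := lintegral_liminf_le hGm
    _ ≤ D := (liminf_le_liminf (Eventually.of_forall h)).trans (by simp)

lemma FT_eq_zero_of_not_integrable {n : ℕ} {f : Rn n → ℂ} (hf : ¬ Integrable f) : FT f = 0 := by
  funext ξ
  refine integral_undef fun h => hf ?_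
  have h2 := h.bdd_mul (c := 1) (f := fun x : Rn n => Complex.exp (Complex.I * dotC x ξ)) ?_ ?_
  · refine h2.congr (Filter.Eventually.of_forall fun x => ?_)
    simp only
    rw [← mul_assoc, ← Complex.exp_add]; simp
  · refine Continuous.aestronglyMeasurable ?_
    have := (continuous_dotC (n := n)).comp (by fun_prop : Continuous fun x : Rn n => (x, ξ))
    fun_prop
  · exact Filter.Eventually.of_forall fun x => (norm_exp_I_dotC x ξ).le

lemma schrodinger_eq_zero_of_not_isNice {n : ℕ} {f : Rn n → ℂ}
    (h1 : ∫ x, f x * (starRingEnd ℂ) (f x) = 1) (hf : ¬ IsNice f) : schrodinger f = 0 := by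
  have hsq : Integrable fun x => ‖f x‖ ^ 2 := by
    have h2 : Integrable fun x => f x * (starRingEnd ℂ) (f x) := by
      by_contra h3
      rw [integral_undef h3] at h1
      exact zero_ne_one h1
    refine h2.norm.congr (Filter.Eventually.of_forall fun x => ?_)
    simp [sq]
  funext t x
  rw [schrodinger_eq]
  by_cases hi : Integrable f
  swap
  · simp [FT_eq_zero_of_not_integrable hi]
  rw [integral_undef, smul_zero]; rfl
  intro h
  refine hf ⟨hi, hsq, ?_⟩
  have h2 := h.bdd_mul (c := 1) (f := fun ξ : Rn n =>
    Complex.exp (-(Complex.I * (dotC x ξ - (t : ℂ) * (‖ξ‖ : ℂ) ^ 2)))) ?_ ?_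
  · refine h2.congr (Filter.Eventually.of_forall fun ξ => ?_)
    simp only
    rw [← mul_assoc, ← Complex.exp_add]; simp
  · refine Continuous.aestronglyMeasurable ?_
    have := (continuous_dotC (n := n)).comp (by fun_prop : Continuous fun ξ : Rn n => (x, ξ))
    fun_prop
  · refine Filter.Eventually.of_forall fun ξ => ?_
    rw [Complex.exp_neg, norm_inv, norm_exp_phase]; simp

open Filter Topology in
/-- The orthonormal Strichartz estimate on the line `2/q + n/p = n`, for nonnegative coefficients
and in lower integral form. -/
lemma exists_lintegral_density_le {n : ℕ} {θ b α : ℝ} (hθ : 0 < θ) (hθb : 2 * (1 - b) ≤ θ)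
    (hθ1 : θ < 1) (hbθ : 1 - θ ≤ b) (hb1 : b < 1) (hb : b = n * θ / 2) (hα : 1 ≤ α)
    (hαb : α < 1 / b) :
    ∃ C : ℝ≥0∞, C ≠ ∞ ∧ ∀ (f : ℕ → Rn n → ℂ) (lam : ℕ → ℝ) (L : ℝ), OrthonormalL2 f →
      (∀ j, 0 ≤ lam j) → 0 < L → (∀ J : Finset ℕ, ∑ j ∈ J, lam j ^ α ≤ L ^ α) →
      ∫⁻ t, (∫⁻ x, (∑' j, ENNReal.ofReal (lam j * ‖schrodinger (f j) t x‖ ^ 2)) ^ (1 / (1 - θ))) ^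
        ((1 - θ) / b) ≤ (C * ENNReal.ofReal L) ^ (1 / b) := by
  classical
  have hb0 : 0 < b := by linarith
  obtain ⟨C, hC, hCb⟩ := exists_lintegral_weight_mul_density_le (n := n) hθb hθ1 hb hb0 hα hαb
  refine ⟨C, hC, ?_⟩
  intro f lam L ho hl hL hlL
  have hz : ∀ j, ¬ IsNice (f j) → schrodinger (f j) = 0 := fun j hj =>
    schrodinger_eq_zero_of_not_isNice (by rw [ho j j, if_pos rfl]) hj
  set J : ℕ → Finset ℕ := fun N => (Finset.range N).filter fun j => IsNice (f j) with hJ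
  set u : ℕ → ℝ × Rn n → ℝ := fun j q => lam j * ‖schrodinger (f j) q.1 q.2‖ ^ 2 with hu
  have hu0 : ∀ j q, 0 ≤ u j q := fun j q => mul_nonneg (hl j) (sq_nonneg _)
  set S : ℕ → ℝ × Rn n → ℝ := fun N q => ∑ j ∈ J N, u j q with hS
  have hS0 : ∀ N q, 0 ≤ S N q := fun N q => Finset.sum_nonneg fun j _ => hu0 j q
  have hSe : ∀ N q, S N q = ∑ j ∈ Finset.range N, u j q := fun N q => by
    rw [hS, hJ]
    simp only
    rw [Finset.sum_filter_of_ne]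
    intro j _ h
    by_contra h2
    exact h (by simp [hu, hz j h2])
  have hSmono : ∀ q, Monotone fun N => S N q := fun q N N' h => by
    simp only [hSe]
    exact Finset.sum_le_sum_of_subset_of_nonneg (Finset.range_mono h) fun j _ _ => hu0 j q
  have hSm : ∀ N, Measurable (S N) := fun N => Finset.measurable_fun_sum _ fun j hj =>
    ((continuous_schrodinger (Finset.mem_filter.1 hj).2.ft).measurable.norm.pow_const 2).const_mul _
  set M : ℕ → ℝ := fun N => ∑ j ∈ J N, lam j * ((2 * π) ^ (-(n : ℝ)) * ∫ ξ, ‖FT (f j) ξ‖) ^ 2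
  have hSM : ∀ N q, S N q ≤ M N := fun N q => Finset.sum_le_sum fun j _ =>
    mul_le_mul_of_nonneg_left (pow_le_pow_left₀ (norm_nonneg _) (norm_schrodinger_le _ _ _) 2) (hl j)
  set E : ℕ → Set (ℝ × Rn n) := fun N =>
    {q | 1 / ((N : ℝ) + 1) ≤ S N q ∧ q.1 ∈ Icc (-(N : ℝ)) N ∧ q.2 ∈ Metric.closedBall (0 : Rn n) N}
    with hE
  have hEm : ∀ N, MeasurableSet (E N) := fun N =>
    (measurableSet_le measurable_const (hSm N)).inter
      ((measurable_fst measurableSet_Icc).inter (measurable_snd measurableSet_closedBall))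
  have hEmono : ∀ N N', N ≤ N' → E N ⊆ E N' := fun N N' h q hq => by
    have h' : (N : ℝ) ≤ N' := by exact_mod_cast h
    refine ⟨le_trans ?_ (hq.1.trans (hSmono q h)), ⟨?_, hq.2.1.2.trans h'⟩,
      Metric.closedBall_subset_closedBall h' hq.2.2⟩
    · exact one_div_le_one_div_of_le (by positivity) (by linarith)
    · have := hq.2.1.1; linarith
  set ρ : ℕ → ℝ × Rn n → ℝ := fun N => (E N).indicator (S N) with hρ
  have hρS : ∀ N q, ρ N q ≤ S N q := fun N q => indicator_le_self' (fun q _ => hS0 N q) q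
  have hρ0 : ∀ N q, 0 ≤ ρ N q := fun N q => indicator_nonneg (fun q _ => hS0 N q) q
  have hρb : ∀ N : ℕ, IsBdd (Icc (-(N : ℝ)) N) (Metric.closedBall (0 : Rn n) N) (M N) (ρ N) := fun N => by
    refine ⟨(hSm N).indicator (hEm N), fun q => ?_, measure_Icc_lt_top, measure_closedBall_lt_top,
      fun t x ht => indicator_of_notMem (fun h => ht h.2.1) _,
      fun t x hx => indicator_of_notMem (fun h => hx h.2.2) _⟩
    rw [Real.norm_of_nonneg (hρ0 N q)]
    exact (hρS N q).trans (hSM N q)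
  have h1θ : 0 < 1 - θ := by linarith
  refine lintegral_rpow_le_of_truncations (p := 1 / (1 - θ)) (r := (1 - θ) / b) (ρ := ρ)
    (δ := fun N : ℕ => 1 / ((N : ℝ) + 1))
    (U := fun q => ∑' j, ENNReal.ofReal (lam j * ‖schrodinger (f j) q.1 q.2‖ ^ 2))
    (by positivity) (by positivity) (fun N => (hρb N).meas) hρ0 ?_ ?_ ?_
    tendsto_one_div_add_atTop_nhds_zero_nat ?_
  · intro q N N' h
    simp only [hρ]
    by_cases h1 : q ∈ E N
    · rw [indicator_of_mem h1, indicator_of_mem (hEmono N N' h h1)]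
      exact hSmono q h
    · rw [indicator_of_notMem h1]
      exact hρ0 N' q
  · intro q
    have hl : Tendsto (fun N => ENNReal.ofReal (S N q)) atTop (𝓝 (∑' j, ENNReal.ofReal (u j q))) := by
      simp only [hSe, ENNReal.ofReal_sum_of_nonneg fun j _ => hu0 j q]
      exact ENNReal.summable.hasSum.tendsto_sum_nat
    refine hl.congr' ?_
    by_cases h : ∃ N, 0 < S N q
    · obtain ⟨N₀, hN₀⟩ := h
      have e1 : ∀ᶠ N : ℕ in atTop, 1 / ((N : ℝ) + 1) < S N₀ q :=
        tendsto_one_div_add_atTop_nhds_zero_nat.eventually_lt_const hN₀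
      have e2 : ∀ᶠ N : ℕ in atTop, |q.1| ≤ N := tendsto_natCast_atTop_atTop.eventually_ge_atTop _
      have e3 : ∀ᶠ N : ℕ in atTop, ‖q.2‖ ≤ N := tendsto_natCast_atTop_atTop.eventually_ge_atTop _
      filter_upwards [e1, e2, e3, eventually_ge_atTop N₀] with N e1 e2 e3 e4
      rw [hρ]
      simp only
      rw [indicator_of_mem]
      exact ⟨e1.le.trans (hSmono q e4), abs_le.1 e2, by simpa using e3⟩
    · push Not at h
      refine Eventually.of_forall fun N => ?_
      beta_reduce
      rw [(h N).antisymm (hS0 N q), ((hρS N q).trans (h N)).antisymm (hρ0 N q)]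
  · intro N t
    refine integrable_of_bounded_support (B := M N ^ (1 / (1 - θ)))
      (((hρb N).section_meas t).pow_const _).aestronglyMeasurable (hρb N).finK (fun x => ?_)
      fun x hx => ?_
    · rw [Real.norm_of_nonneg (Real.rpow_nonneg (hρ0 N _) _)]
      exact Real.rpow_le_rpow (hρ0 N _) ((hρS N _).trans (hSM N _)) (by positivity)
    · rw [(hρb N).zeroK t x hx, Real.zero_rpow (by positivity)]
  · intro N
    refine lintegral_rpow_le_of_weights hθ hθ1 hbθ hb1 (by positivity) (hρb N) (fun q => ?_) (hρS N)
      fun W M' δ' hδ' hW hWδ hV => ?_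
    · by_cases h : q ∈ E N
      · right
        simp only [hρ]
        rw [indicator_of_mem h]
        exact h.1
      · exact Or.inl (indicator_of_notMem h _)
    · exact hCb (J N) _ _ M' δ' W f lam L hδ' hW hWδ (fun j hj => (Finset.mem_filter.1 hj).2)
        (fun i _ k _ => ho i k) hl hL (hlL _) hV

lemma segAD_relations {n : ℕ} (hn : 2 ≤ n) {a b : ℝ}
    (hab : ∃ t ∈ Ico (0 : ℝ) 1, (a, b) = (1 - t) • ptA n + t • ptD n) :
    0 < a ∧ a < 1 ∧ b < 1 ∧ (n : ℝ) / (n + 1) ≤ b ∧ b = n * (1 - a) / 2 := by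
  obtain ⟨t, ⟨ht0, ht1⟩, h⟩ := hab
  have hn' : (2 : ℝ) ≤ n := by exact_mod_cast hn
  simp only [ptA, ptD, Prod.smul_mk, Prod.mk_add_mk, smul_eq_mul, Prod.mk.injEq] at h
  obtain ⟨ha, hb⟩ := h
  have e1 : b = n / (n + 1) + t / (n + 1) := by rw [hb]; field_simp; ring
  have e2 : a = 1 - 2 * b / n := by rw [hb, ha]; field_simp; ring
  have h1 : (n : ℝ) / (n + 1) ≤ b := by
    rw [e1]; have : 0 ≤ t / (n + 1) := by positivity
    linarith
  have h2 : b < 1 := by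
    rw [e1, ← add_div, div_lt_one (by positivity)]; linarith
  have h3 : 0 < b := lt_of_lt_of_le (by positivity) h1
  have h4 : 2 * b / n < 1 := by rw [div_lt_one (by linarith)]; linarith
  have h5 : 0 < 2 * b / n := by positivity
  refine ⟨by linarith, by linarith, h2, h1, ?_⟩
  rw [e2]; field_simp; ring

lemma toReal_expOf {a : ℝ} (ha : 0 < a) : (expOf a).toReal = 1 / a := by
  rw [expOf, ENNReal.toReal_inv, ENNReal.toReal_ofReal ha.le, one_div]

lemma expOf_ne_top {a : ℝ} (ha : 0 < a) : expOf a ≠ ∞ := by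
  simp [expOf, ha]

lemma expOf_ne_zero (a : ℝ) : expOf a ≠ 0 := by
  simp [expOf]

lemma mixedLp_expOf {n : ℕ} {a b : ℝ} (ha : 0 < a) (hb : 0 < b) (u : ℝ → Rn n → ℝ) :
    mixedLp (expOf b) (expOf a) u = (∫⁻ t, (∫⁻ x, ‖u t x‖ₑ ^ (1 / a)) ^ (a / b)) ^ b := by
  rw [mixedLp, eLp, if_neg (expOf_ne_top hb), toReal_expOf hb, one_div_one_div]
  congr 1
  refine lintegral_congr fun t => ?_
  rw [eLpNorm_eq_lintegral_rpow_enorm_toReal (expOf_ne_zero a) (expOf_ne_top ha), toReal_expOf ha,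
    one_div_one_div, ← ENNReal.rpow_mul, mul_one_div]

lemma seqNormE_ofReal {α : ℝ} (hα : 0 < α) (lam : ℕ → ℝ) :
    seqNormE (ENNReal.ofReal α) lam = (∑' j, ENNReal.ofReal |lam j| ^ α) ^ (1 / α) := by
  rw [seqNormE, if_neg ENNReal.ofReal_ne_top, ENNReal.toReal_ofReal hα.le]

lemma enorm_density_le {n : ℕ} (lam : ℕ → ℝ) (f : ℕ → Rn n → ℂ) (t : ℝ) (x : Rn n) :
    ‖density lam f t x‖ₑ ≤ ∑' j, ENNReal.ofReal (|lam j| * ‖schrodinger (f j) t x‖ ^ 2) := by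
  refine (enorm_tsum_le_tsum_enorm).trans_eq (tsum_congr fun j => ?_)
  rw [← ofReal_norm, norm_mul, Real.norm_eq_abs, norm_pow, norm_norm]

theorem exists_orthonormal_strichartz {n : ℕ} (hn : 2 ≤ n) {a b : ℝ}
    (hab : ∃ t ∈ Ico (0 : ℝ) 1, (a, b) = (1 - t) • ptA n + t • ptD n) {α : ℝ} (hα : 1 ≤ α)
    (hαb : α < 1 / b) :
    ∃ C : ℝ, 0 < C ∧ ∀ (f : ℕ → Rn n → ℂ) (lam : ℕ → ℝ),
      OrthonormalL2 f → seqNormE (ENNReal.ofReal α) lam ≠ ∞ →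
      mixedLp (expOf b) (expOf a) (density lam f)
        ≤ ENNReal.ofReal C * seqNormE (ENNReal.ofReal α) lam := by
  obtain ⟨ha0, ha1, hb1, hbn, hbe⟩ := segAD_relations hn hab
  have hn' : (2 : ℝ) ≤ n := by exact_mod_cast hn
  have hb0 : 0 < b := lt_of_lt_of_le (by positivity) hbn
  have hα0 : 0 < α := by linarith
  rw [div_le_iff₀ (by positivity)] at hbn
  have h1 : 2 * (1 - b) ≤ 1 - a := by
    have : 0 ≤ (n : ℝ) * ((n + 1) * (1 - a) - 2) := by nlinarith
    have := (mul_nonneg_iff_of_pos_left (by linarith : (0 : ℝ) < n)).1 this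
    nlinarith
  have h2 : 1 - (1 - a) ≤ b := by
    have : 0 ≤ (n : ℝ) * (b - a) := by nlinarith
    have := (mul_nonneg_iff_of_pos_left (by linarith : (0 : ℝ) < n)).1 this
    linarith
  obtain ⟨C, hC, hCb⟩ := exists_lintegral_density_le (n := n) (θ := 1 - a) (by linarith) h1
    (by linarith) h2 hb1 hbe hα hαb
  refine ⟨C.toReal + 1, by positivity, ?_⟩
  intro f lam ho hlam
  rw [mixedLp_expOf ha0 hb0]
  rw [seqNormE_ofReal hα0] at hlam ⊢
  set Sg := ∑' j, ENNReal.ofReal |lam j| ^ α with hSg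
  have hU : ∫⁻ t, (∫⁻ x, ‖density lam f t x‖ₑ ^ (1 / a)) ^ (a / b) ≤
      ∫⁻ t, (∫⁻ x, (∑' j, ENNReal.ofReal (|lam j| * ‖schrodinger (f j) t x‖ ^ 2)) ^ (1 / a)) ^
        (a / b) :=
    lintegral_mono fun t => ENNReal.rpow_le_rpow (lintegral_mono fun x => ENNReal.rpow_le_rpow
      (enorm_density_le lam f t x) (by positivity)) (by positivity)
  rcases eq_or_ne Sg 0 with h0 | h0
  · have hl0 : ∀ j, lam j = 0 := fun j => by
      have := ENNReal.tsum_eq_zero.1 h0 j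
      rw [ENNReal.rpow_eq_zero_iff_of_pos hα0, ENNReal.ofReal_eq_zero] at this
      exact abs_nonpos_iff.1 this
    refine (ENNReal.rpow_le_rpow hU hb0.le).trans ?_
    simp [hl0, ha0, hb0, div_pos ha0 hb0]
  have hLt : Sg ^ (1 / α) ≠ 0 := by
    simp [ENNReal.rpow_eq_zero_iff, h0, hα0.le]
  set L := (Sg ^ (1 / α)).toReal with hL
  have hL0 : 0 < L := ENNReal.toReal_pos hLt hlam
  have hLe : ENNReal.ofReal L = Sg ^ (1 / α) := ENNReal.ofReal_toReal hlam
  have hLS : ENNReal.ofReal (L ^ α) = Sg := by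
    rw [← ENNReal.ofReal_rpow_of_pos hL0, hLe, ← ENNReal.rpow_mul, one_div_mul_cancel hα0.ne',
      ENNReal.rpow_one]
  have h := hCb f (fun j => |lam j|) L ho (fun j => abs_nonneg _) hL0 fun J => by
    rw [← ENNReal.ofReal_le_ofReal_iff (by positivity), hLS,
      ENNReal.ofReal_sum_of_nonneg fun j _ => by positivity, hSg]
    refine le_trans (le_of_eq ?_) (ENNReal.sum_le_tsum J)
    exact Finset.sum_congr rfl fun j _ => (ENNReal.ofReal_rpow_of_nonneg (abs_nonneg _) hα0.le).symm
  rw [_root_.sub_sub_cancel] at h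
  calc _ ≤ ((C * ENNReal.ofReal L) ^ (1 / b)) ^ b := ENNReal.rpow_le_rpow (hU.trans h) hb0.le
    _ = C * Sg ^ (1 / α) := by
        rw [← ENNReal.rpow_mul, one_div_mul_cancel hb0.ne', ENNReal.rpow_one, hLe]
    _ ≤ _ := by
        gcongr
        rw [← ENNReal.ofReal_toReal hC]
        exact ENNReal.ofReal_le_ofReal (by simp)

open FourierTransform SchwartzMap

lemma FT_eq_fourier {n : ℕ} (f : Rn n → ℂ) (ξ : Rn n) : FT f ξ = 𝓕 f ((2 * π)⁻¹ • ξ) := by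
  rw [Real.fourier_eq', FT]
  refine integral_congr_ae (Filter.Eventually.of_forall fun x => ?_)
  simp only [smul_eq_mul, dotC_eq_inner, inner_smul_right]
  congr 2
  push_cast
  have : (π : ℂ) ≠ 0 := by exact_mod_cast Real.pi_ne_zero
  field_simp

lemma FT_fourierInv {n : ℕ} (h : 𝓢(Rn n, ℂ)) (ξ : Rn n) :
    FT ((𝓕⁻ h : 𝓢(Rn n, ℂ)) : Rn n → ℂ) ξ = h ((2 * π)⁻¹ • ξ) := by
  rw [FT_eq_fourier, ← SchwartzMap.fourier_coe, FourierTransform.fourier_fourierInv_eq]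

lemma integral_fourierInv_mul_conj {n : ℕ} (g h : 𝓢(Rn n, ℂ)) :
    ∫ x, (𝓕⁻ g : 𝓢(Rn n, ℂ)) x * (starRingEnd ℂ) ((𝓕⁻ h : 𝓢(Rn n, ℂ)) x) =
      ∫ x, g x * (starRingEnd ℂ) (h x) := by
  have := SchwartzMap.integral_inner_fourier_fourier (𝓕⁻ h : 𝓢(Rn n, ℂ)) (𝓕⁻ g : 𝓢(Rn n, ℂ))
  simpa [FourierTransform.fourier_fourierInv_eq] using this.symm

/-- A bump at frequency `v`, modulated so that it focuses at time `s`. -/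
def focusing {n : ℕ} (χ : ContDiffBump (0 : Rn n)) (v : Rn n) (s : ℝ) (w : Rn n) : ℂ :=
  Complex.exp (Complex.I * ((s : ℂ) * ((‖(2 * π) • w‖ ^ 2 : ℝ) : ℂ))) * (χ (w - v) : ℂ)

lemma contDiff_focusing {n : ℕ} (χ : ContDiffBump (0 : Rn n)) (v : Rn n) (s : ℝ) :
    ContDiff ℝ (⊤ : ℕ∞) (focusing χ v s) := by
  have h1 : ContDiff ℝ (⊤ : ℕ∞) fun w : Rn n => ((‖(2 * π) • w‖ ^ 2 : ℝ) : ℂ) :=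
    Complex.ofRealCLM.contDiff.comp ((contDiff_norm_sq ℝ).comp (contDiff_const_smul (2 * π)))
  have h2 : ContDiff ℝ (⊤ : ℕ∞) fun w : Rn n => (χ (w - v) : ℂ) :=
    Complex.ofRealCLM.contDiff.comp (χ.contDiff.comp (contDiff_id.sub contDiff_const))
  exact ((contDiff_const.mul (contDiff_const.mul h1)).cexp).mul h2

lemma focusing_eq_zero {n : ℕ} {χ : ContDiffBump (0 : Rn n)} {v : Rn n} {s : ℝ} {w : Rn n}
    (hw : χ.rOut ≤ dist w v) : focusing χ v s w = 0 := by
  have : χ (w - v) = 0 := χ.zero_of_le_dist (by simpa [dist_eq_norm] using hw)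
  simp [focusing, this]

lemma hasCompactSupport_focusing {n : ℕ} (χ : ContDiffBump (0 : Rn n)) (v : Rn n) (s : ℝ) :
    HasCompactSupport (focusing χ v s) := by
  refine HasCompactSupport.of_support_subset_isCompact (isCompact_closedBall v χ.rOut) fun w hw => ?_
  by_contra h
  exact hw (focusing_eq_zero (not_le.1 h).le)

/-- The wave packet with frequency profile `focusing χ v s`. -/
def packet {n : ℕ} (χ : ContDiffBump (0 : Rn n)) (v : Rn n) (s : ℝ) : 𝓢(Rn n, ℂ) :=
  𝓕⁻ ((hasCompactSupport_focusing χ v s).toSchwartzMap (contDiff_focusing χ v s))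

lemma FT_packet {n : ℕ} (χ : ContDiffBump (0 : Rn n)) (v : Rn n) (s : ℝ) (ξ : Rn n) :
    FT (packet χ v s) ξ = focusing χ v s ((2 * π)⁻¹ • ξ) := by
  rw [packet, FT_fourierInv]; rfl

lemma FT_const_mul {n : ℕ} (c : ℂ) (f : Rn n → ℂ) (ξ : Rn n) :
    FT (fun x => c * f x) ξ = c * FT f ξ := by
  rw [FT, FT, ← integral_const_mul]
  congr 1; ext x; ring

lemma schrodinger_const_mul {n : ℕ} (c : ℂ) (f : Rn n → ℂ) (t : ℝ) (x : Rn n) :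
    schrodinger (fun x => c * f x) t x = c * schrodinger f t x := by
  rw [schrodinger_eq, schrodinger_eq, mul_smul_comm, ← integral_const_mul]
  congr 2; ext ξ; rw [FT_const_mul]; ring

lemma integral_packet_mul_conj {n : ℕ} (χ : ContDiffBump (0 : Rn n)) (v v' : Rn n) (s s' : ℝ) :
    ∫ x, packet χ v s x * (starRingEnd ℂ) (packet χ v' s' x) =
      ∫ w, focusing χ v s w * (starRingEnd ℂ) (focusing χ v' s' w) := by
  rw [packet, packet, integral_fourierInv_mul_conj]; rfl

lemma integral_packet_mul_conj_self {n : ℕ} (χ : ContDiffBump (0 : Rn n)) (v : Rn n) (s : ℝ) :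
    ∫ x, packet χ v s x * (starRingEnd ℂ) (packet χ v s x) = ((∫ w, χ w ^ 2 : ℝ) : ℂ) := by
  rw [integral_packet_mul_conj, ← integral_sub_right_eq_self (fun w => χ w ^ 2) v, ← integral_complex_ofReal]
  refine integral_congr_ae (Filter.Eventually.of_forall fun w => ?_)
  simp only [Complex.mul_conj, Complex.normSq_eq_norm_sq, focusing, norm_mul]
  rw [show Complex.I * ((s : ℂ) * ((‖(2 * π) • w‖ ^ 2 : ℝ) : ℂ)) =
    ((s * ‖(2 * π) • w‖ ^ 2 : ℝ) : ℂ) * Complex.I by push_cast; ring, Complex.norm_exp_ofReal_mul_I]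
  simp

lemma integral_packet_mul_conj_of_disjoint {n : ℕ} (χ : ContDiffBump (0 : Rn n)) {v v' : Rn n}
    (s s' : ℝ) (h : 2 * χ.rOut ≤ dist v v') :
    ∫ x, packet χ v s x * (starRingEnd ℂ) (packet χ v' s' x) = 0 := by
  rw [integral_packet_mul_conj]
  refine integral_eq_zero_of_ae (Filter.Eventually.of_forall fun w => ?_)
  have := dist_triangle_left v v' w
  rcases le_total χ.rOut (dist w v) with h1 | h1
  · simp [focusing_eq_zero h1]
  · simp [focusing_eq_zero (χ := χ) (v := v') (s := s') (w := w) (by linarith)]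

lemma schrodinger_packet {n : ℕ} (χ : ContDiffBump (0 : Rn n)) (v : Rn n) (s t : ℝ) (x : Rn n) :
    ‖schrodinger (packet χ v s) t x‖ =
      ‖schrodinger (packet χ 0 0) (t - s) (x - (2 * (t - s)) • (2 * π) • v)‖ := by
  have hπ : (2 * π) ≠ 0 := by positivity
  rw [schrodinger_eq, schrodinger_eq, norm_smul, norm_smul]
  congr 1
  set V := (2 * π) • v with hV
  rw [← integral_add_right_eq_self _ V]
  have hn : ‖Complex.exp (Complex.I * (dotC x V - ((t - s : ℝ) : ℂ) * (‖V‖ : ℂ) ^ 2))‖ = 1 :=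
    norm_exp_phase _ _ _
  rw [← one_mul ‖∫ ξ, _ * FT (packet χ 0 0) ξ‖, ← hn, ← norm_mul, ← integral_const_mul]
  congr 2
  ext η
  rw [FT_packet, FT_packet]
  have e1 : (2 * π)⁻¹ • (η + V) - v = (2 * π)⁻¹ • η := by
    rw [hV, smul_add, smul_smul, inv_mul_cancel₀ hπ, one_smul, add_sub_cancel_right]
  have e2 : ∀ z : Rn n, (2 * π) • (2 * π)⁻¹ • z = z := fun z => by
    rw [smul_smul, mul_inv_cancel₀ hπ, one_smul]
  simp only [focusing, e1, e2, sub_zero, Complex.ofReal_zero, zero_mul, mul_zero, Complex.exp_zero,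
    one_mul]
  rw [← mul_assoc, ← mul_assoc (Complex.exp _), ← Complex.exp_add, ← Complex.exp_add]
  congr 2
  have e3 : ‖η + V‖ ^ 2 = ‖η‖ ^ 2 + 2 * inner ℝ V η + ‖V‖ ^ 2 := by
    rw [norm_add_sq_real, real_inner_comm]
  have e4 : ((‖η + V‖ : ℝ) : ℂ) ^ 2 = (‖η‖ : ℂ) ^ 2 + 2 * ((inner ℝ V η : ℝ) : ℂ) + (‖V‖ : ℂ) ^ 2 := by
    exact_mod_cast congrArg Complex.ofReal e3
  simp only [dotC_eq_inner, inner_add_right, inner_sub_left, inner_smul_left]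
  push_cast
  rw [e4]
  simp
  ring

lemma integrable_FT_packet {n : ℕ} (χ : ContDiffBump (0 : Rn n)) (v : Rn n) (s : ℝ) :
    Integrable (FT (packet χ v s)) := by
  have h : Integrable (focusing χ v s) :=
    (contDiff_focusing χ v s).continuous.integrable_of_hasCompactSupport
      (hasCompactSupport_focusing χ v s)
  rw [show FT (packet χ v s) = _ from funext (FT_packet χ v s)]
  exact h.comp_smul (by positivity)

lemma schrodinger_packet_zero_ne_zero {n : ℕ} (χ : ContDiffBump (0 : Rn n)) :
    schrodinger (packet χ 0 0) 0 0 ≠ 0 := by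
  rw [schrodinger_eq]
  refine smul_ne_zero (by positivity) ?_
  have e : ∀ ξ : Rn n, Complex.exp (Complex.I * (dotC 0 ξ - ((0 : ℝ) : ℂ) * (‖ξ‖ : ℂ) ^ 2)) *
      FT (packet χ 0 0) ξ = ((χ ((2 * π)⁻¹ • ξ) : ℝ) : ℂ) := fun ξ => by
    rw [FT_packet]; simp [focusing, dotC_eq_inner]
  simp only [e]
  rw [integral_complex_ofReal, Measure.integral_comp_smul]
  have := χ.integral_pos (μ := volume)
  simp [this.ne', Real.pi_ne_zero]

/-- An orthonormal sequence whose `k`-th member is bounded below near time `k`. -/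
lemma exists_focusing_orthonormal {n : ℕ} (hn : 0 < n) :
    ∃ (f : ℕ → Rn n → ℂ) (κ r : ℝ) (y : ℕ → ℝ → Rn n), OrthonormalL2 f ∧ 0 < κ ∧ 0 < r ∧ r ≤ 1 ∧
      ∀ k : ℕ, ∀ t ∈ Ico (k : ℝ) (k + r), ∀ x ∈ Metric.ball (y k t) r,
        κ ≤ ‖schrodinger (f k) t x‖ := by
  let χ : ContDiffBump (0 : Rn n) := ⟨1 / 4, 1 / 2, by norm_num, by norm_num⟩
  set e : Rn n := EuclideanSpace.single ⟨0, hn⟩ 1 with he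
  have hen : ‖e‖ = 1 := by simp [he]
  set m := ∫ w, χ w ^ 2 with hm
  have hm0 : 0 < m := by
    refine (χ.continuous.pow 2).integral_pos_of_hasCompactSupport_nonneg_nonzero (x := 0)
      ?_ (fun w => sq_nonneg _) ?_
    · exact χ.hasCompactSupport.comp_left (g := fun s : ℝ => s ^ 2) (by simp)
    · rw [χ.one_of_mem_closedBall (by simp [χ.rIn_pos.le])]; simp
  set c : ℝ := (√m)⁻¹ with hc
  have hc0 : 0 < c := by positivity
  set U : ℝ × Rn n → ℂ := fun q => schrodinger (packet χ 0 0) q.1 q.2 with hU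
  have hU0 : 0 < ‖U 0‖ := norm_pos_iff.2 (schrodinger_packet_zero_ne_zero χ)
  have hUc : Continuous U := continuous_schrodinger (integrable_FT_packet χ 0 0)
  obtain ⟨ε, hε, hεU⟩ := Metric.eventually_nhds_iff.1
    (hUc.norm.continuousAt.eventually_const_lt (half_lt_self hU0))
  refine ⟨fun k x => c * packet χ ((k : ℝ) • e) k x, c * (‖U 0‖ / 2), min ε 1,
    fun k t => (2 * (t - k)) • (2 * π) • (k : ℝ) • e, ?_, by positivity, by positivity,
    min_le_right _ _, ?_⟩
  · intro j k
    have h : ∀ x : Rn n, (c : ℂ) * packet χ ((j : ℝ) • e) j x *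
        (starRingEnd ℂ) ((c : ℂ) * packet χ ((k : ℝ) • e) k x) = ((c ^ 2 : ℝ) : ℂ) *
        (packet χ ((j : ℝ) • e) j x * (starRingEnd ℂ) (packet χ ((k : ℝ) • e) k x)) := fun x => by
      rw [map_mul, Complex.conj_ofReal]; push_cast; ring
    simp only [h]
    rw [integral_const_mul]
    split_ifs with hjk
    · subst hjk
      rw [integral_packet_mul_conj_self, ← hm, ← Complex.ofReal_mul, hc, inv_pow, Real.sq_sqrt hm0.le,
        inv_mul_cancel₀ hm0.ne', Complex.ofReal_one]
    · rw [integral_packet_mul_conj_of_disjoint, mul_zero]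
      rw [dist_eq_norm, ← sub_smul, norm_smul, hen, mul_one, Real.norm_eq_abs]
      change 2 * (1 / 2 : ℝ) ≤ _
      have h1 : (1 : ℤ) ≤ |(j : ℤ) - k| := Int.one_le_abs (sub_ne_zero.2 (by exact_mod_cast hjk))
      have h2 : (1 : ℝ) ≤ |(j : ℝ) - k| := by exact_mod_cast h1
      linarith
  · intro k t ht x hx
    rw [schrodinger_const_mul, norm_mul, Complex.norm_real, Real.norm_of_nonneg hc0.le,
      schrodinger_packet χ ((k : ℝ) • e)]
    refine mul_le_mul_of_nonneg_left ?_ hc0.le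
    refine (hεU (y := (t - k, x - (2 * (t - k)) • (2 * π) • (k : ℝ) • e)) ?_).le
    rw [Prod.dist_eq, max_lt_iff]
    constructor
    · simp only [Prod.fst_zero, dist_zero_right, Real.norm_eq_abs]
      rw [abs_of_nonneg (sub_nonneg.2 ht.1)]
      have := min_le_left ε 1
      linarith [ht.2]
    · simp only [Prod.snd_zero, dist_zero_right]
      rw [← dist_eq_norm]
      exact (Metric.mem_ball.1 hx).trans_le (min_le_left _ _)

lemma seqNormE_indicator_range {α : ℝ} (hα : 0 < α) (N : ℕ) :
    seqNormE (ENNReal.ofReal α) (fun j => if j < N then 1 else 0) = (N : ℝ≥0∞) ^ (1 / α) := by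
  rw [seqNormE_ofReal hα, tsum_eq_sum (s := Finset.range N)]
  · congr 1
    rw [Finset.sum_congr rfl (g := fun _ => 1) fun j hj => by simp [Finset.mem_range.1 hj]]
    simp
  · intro j hj
    simp [Finset.mem_range.not.1 hj, hα]

lemma sq_norm_le_density_indicator {n : ℕ} (f : ℕ → Rn n → ℂ) {N k : ℕ} (hk : k < N) (t : ℝ)
    (x : Rn n) :
    ‖schrodinger (f k) t x‖ ^ 2 ≤ density (fun j => if j < N then 1 else 0) f t x := by
  rw [density, density2, tsum_eq_sum (s := Finset.range N) fun j hj => by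
    simp [Finset.mem_range.not.1 hj]]
  refine le_trans (by simp [hk]) (Finset.single_le_sum (f := fun j =>
    (if j < N then (1 : ℝ) else 0) * ‖schrodinger (f j) t x‖ ^ 2) (fun j _ => ?_)
    (Finset.mem_range.2 hk))
  split_ifs <;> positivity

theorem not_exists_orthonormal_strichartz {n : ℕ} (hn : 0 < n) {a b α : ℝ} (ha : 0 < a)
    (hb : 0 < b) (hαb : 1 / b < α) :
    ¬ ∃ C : ℝ, 0 < C ∧ ∀ (f : ℕ → Rn n → ℂ) (lam : ℕ → ℝ),
      OrthonormalL2 f → seqNormE (ENNReal.ofReal α) lam ≠ ∞ →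
      mixedLp (expOf b) (expOf a) (density lam f)
        ≤ ENNReal.ofReal C * seqNormE (ENNReal.ofReal α) lam := by
  rintro ⟨C, hC0, hC⟩
  have hα : 0 < α := lt_trans (by positivity) hαb
  obtain ⟨f, κ, r, y, ho, hκ, hr, hr1, hf⟩ := exists_focusing_orthonormal hn
  set c₁ : ℝ≥0∞ := (ENNReal.ofReal (κ ^ 2) ^ (1 / a) * volume (Metric.ball (0 : Rn n) r)) ^ (a / b)
    with hc₁
  have hc₁0 : ENNReal.ofReal r * c₁ ≠ 0 := by
    refine mul_ne_zero (by simpa using hr) ?_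
    rw [hc₁, Ne, ENNReal.rpow_eq_zero_iff_of_pos (by positivity)]
    refine mul_ne_zero ?_ (Metric.measure_ball_pos volume _ hr).ne'
    rw [Ne, ENNReal.rpow_eq_zero_iff_of_pos (by positivity)]
    simpa using hκ.ne'
  obtain ⟨c, hc0, hc⟩ := ENNReal.lt_iff_exists_nnreal_btwn.1 (pos_iff_ne_zero.2 hc₁0)
  have hc0' : (0 : ℝ) < c := by exact_mod_cast hc0
  have key : ∀ N : ℕ, ((N : ℝ) * c) ^ b ≤ C * (N : ℝ) ^ (1 / α) := by
    intro N
    have hs := seqNormE_indicator_range hα N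
    have h := hC f (fun j => if j < N then 1 else 0) ho
      (by rw [hs]; exact ENNReal.rpow_ne_top_of_nonneg (by positivity) (by simp))
    rw [hs, mixedLp_expOf ha hb] at h
    have hlow : (N : ℝ≥0∞) * c ≤ ∫⁻ t, (∫⁻ x,
        ‖density (fun j => if j < N then 1 else 0) f t x‖ₑ ^ (1 / a)) ^ (a / b) := by
      set F : ℝ → ℝ≥0∞ := fun t => (∫⁻ x,
        ‖density (fun j => if j < N then 1 else 0) f t x‖ₑ ^ (1 / a)) ^ (a / b)
      have hF : ∀ k ∈ Finset.range N, ∀ t ∈ Ico (k : ℝ) (k + r), c₁ ≤ F t := by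
        intro k hk t ht
        refine ENNReal.rpow_le_rpow ?_ (by positivity)
        rw [← Measure.addHaar_ball_center volume (y k t) r,
          ← setLIntegral_const]
        refine (setLIntegral_mono' measurableSet_ball fun x hx => ?_).trans
          (setLIntegral_le_lintegral _ _)
        refine ENNReal.rpow_le_rpow ?_ (by positivity)
        have h1 := (pow_le_pow_left₀ hκ.le (hf k t ht x hx) 2).trans
          (sq_norm_le_density_indicator f (Finset.mem_range.1 hk) t x)
        rw [Real.enorm_of_nonneg ((sq_nonneg κ).trans h1)]
        exact ENNReal.ofReal_le_ofReal h1
      have hd : (Finset.range N : Set ℕ).PairwiseDisjoint fun k : ℕ => Ico (k : ℝ) (k + r) := by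
        intro j _ k _ hjk
        refine Set.disjoint_left.2 fun t hj hk => hjk ?_
        have h1 : (j : ℝ) < k + 1 := by linarith [hj.1, hk.2]
        have h2 : (k : ℝ) < j + 1 := by linarith [hk.1, hj.2]
        have h1' : j < k + 1 := by exact_mod_cast h1
        have h2' : k < j + 1 := by exact_mod_cast h2
        omega
      calc (N : ℝ≥0∞) * c ≤ N * (ENNReal.ofReal r * c₁) := by gcongr
        _ = ∑ k ∈ Finset.range N, ∫⁻ t in Ico (k : ℝ) (k + r), c₁ := by
            simp [mul_comm]
        _ ≤ ∑ k ∈ Finset.range N, ∫⁻ t in Ico (k : ℝ) (k + r), F t :=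
            Finset.sum_le_sum fun k hk => setLIntegral_mono' measurableSet_Ico (hF k hk)
        _ = ∫⁻ t in ⋃ k ∈ Finset.range N, Ico (k : ℝ) (k + r), F t :=
            (lintegral_biUnion_finset hd (fun _ _ => measurableSet_Ico) F).symm
        _ ≤ _ := setLIntegral_le_lintegral _ _
    have h2 := (ENNReal.rpow_le_rpow hlow hb.le).trans h
    have e1 : ((N : ℝ≥0∞) * c) ^ b = ENNReal.ofReal (((N : ℝ) * c) ^ b) := by
      rw [← ENNReal.ofReal_rpow_of_nonneg (by positivity) hb.le, ENNReal.ofReal_mul (by positivity)]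
      simp
    have e2 : ENNReal.ofReal C * (N : ℝ≥0∞) ^ (1 / α) =
        ENNReal.ofReal (C * (N : ℝ) ^ (1 / α)) := by
      rw [ENNReal.ofReal_mul hC0.le, ← ENNReal.ofReal_rpow_of_nonneg (by positivity) (by positivity)]
      simp
    rw [e1, e2] at h2
    exact (ENNReal.ofReal_le_ofReal_iff (by positivity)).1 h2
  have hbα : 0 < b - 1 / α := by
    rw [sub_pos, div_lt_iff₀ hα]; rw [div_lt_iff₀ hb] at hαb; linarith
  have ht := (tendsto_rpow_atTop hbα).comp (tendsto_natCast_atTop_atTop (R := ℝ))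
  obtain ⟨N, hN1, hN2⟩ := ((ht.eventually_gt_atTop (C / (c : ℝ) ^ b)).and
    (Filter.eventually_ge_atTop 1)).exists
  have hN0 : (0 : ℝ) < N := by exact_mod_cast hN2
  simp only [Function.comp_apply] at hN1
  rw [Real.rpow_sub hN0, div_lt_div_iff₀ (by positivity) (by positivity)] at hN1
  have := key N
  rw [Real.mul_rpow hN0.le hc0'.le] at this
  linarith

end OS

/-- (Frank–Sabin.)  For `n ≥ 2` and `(1/p, 1/q)` on the half-open
segment `[A, D)`, the orthonormal Strichartz estimate holds for every `α < q` and
fails for every `α > q`.  Here `(a, b) = (1/p, 1/q)`, so `q = 1/b`. -/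
theorem orthonormal_strichartz_AD (n : ℕ) (hn : 2 ≤ n) (a b : ℝ)
    (hab : ∃ t ∈ Ico (0 : ℝ) 1, (a, b) = (1 - t) • ptA n + t • ptD n) :
    (∀ α : ℝ, 1 ≤ α → α < 1 / b →
      ∃ C : ℝ, 0 < C ∧ ∀ (f : ℕ → Rn n → ℂ) (lam : ℕ → ℝ),
        OrthonormalL2 f → seqNormE (ENNReal.ofReal α) lam ≠ ∞ →
        mixedLp (expOf b) (expOf a) (density lam f)
          ≤ ENNReal.ofReal C * seqNormE (ENNReal.ofReal α) lam) ∧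
    ∀ α : ℝ, 1 / b < α →
      ¬ ∃ C : ℝ, 0 < C ∧ ∀ (f : ℕ → Rn n → ℂ) (lam : ℕ → ℝ),
        OrthonormalL2 f → seqNormE (ENNReal.ofReal α) lam ≠ ∞ →
        mixedLp (expOf b) (expOf a) (density lam f)
          ≤ ENNReal.ofReal C * seqNormE (ENNReal.ofReal α) lam := by
  obtain ⟨ha0, -, -, hbn, -⟩ := segAD_relations hn hab
  have hb0 : 0 < b := lt_of_lt_of_le (by positivity) hbn
  exact ⟨fun α hα hαb => exists_orthonormal_strichartz hn hab hα hαb,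
    fun α hαb => not_exists_orthonormal_strichartz (by omega) ha0 hb0 hαb⟩
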